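/- arXiv:math/0608416 — 2 statements merged into one kernel-verified Lean document; each statement's English description precedes it below -/
import Mathlib

section
/- Let X and Y be arc fields on a locally complete metric space M that close, are transverse, and satisfy Conditions E1 and E2, and assume X and Y are 2nd-order locally uniformly tangent to their local flows F and G, i.e., d(X_t(x), F_t(x)) = O(t²) and d(Y_t(x), G_t(x)) = O(t²) locally uniformly in x. If there exist Lipschitz functions a, b : M → ℝ such that [X,Y] ∼ aX+bY, then for every x₀ ∈ M there exists an integral surface of X and Y through x₀. -/
open Metric Set Asymptotics

/-- A metric space is *locally complete* if every point has a complete neighborhood. -/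
def LocallyComplete (M : Type*) [MetricSpace M] : Prop :=
  ∀ x : M, ∃ s ∈ nhds x, IsComplete s

variable {M : Type*} [MetricSpace M]

/-- `X : M → ℝ → M` is an *arc field* (only the values for `t ∈ [-1,1]` are relevant):
it is continuous, `X x 0 = x`, each arc `t ↦ X x t` is Lipschitz, and the Lipschitz
constant (the speed `ρ`) is locally bounded. -/
def IsArcField (X : M → ℝ → M) : Prop :=
  ContinuousOn (fun p : M × ℝ => X p.1 p.2) (univ ×ˢ Icc (-1 : ℝ) 1) ∧
  (∀ x, X x 0 = x) ∧
  (∀ x : M, ∃ r > (0 : ℝ), ∃ K > (0 : ℝ), ∀ y ∈ ball x r, ∀ s ∈ Icc (-1 : ℝ) 1,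
      ∀ t ∈ Icc (-1 : ℝ) 1, dist (X y s) (X y t) ≤ K * |s - t|)

/-- Condition E1. -/
def CondE1 (X : M → ℝ → M) : Prop :=
  ∀ x₀ : M, ∃ r > (0 : ℝ), ∃ δ > (0 : ℝ), ∃ Λ > (0 : ℝ),
    ∀ x ∈ ball x₀ r, ∀ y ∈ ball x₀ r, ∀ t : ℝ, |t| < δ →
      dist (X x t) (X y t) ≤ dist x y * (1 + |t| * Λ)

/-- Condition E2. -/
def CondE2 (X : M → ℝ → M) : Prop :=
  ∀ x₀ : M, ∃ r > (0 : ℝ), ∃ δ > (0 : ℝ), ∃ Ω > (0 : ℝ),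
    ∀ x ∈ ball x₀ r, ∀ s t : ℝ, |s| < δ → |t| < δ →
      dist (X x (s + t)) (X (X x s) t) ≤ |s * t| * Ω

/-- Two arc fields *close*: `d(Y_s X_t x, X_t Y_s x) = O(|st|)` locally uniformly. -/
def Close (X Y : M → ℝ → M) : Prop :=
  ∀ x₀ : M, ∃ C > (0 : ℝ), ∃ r > (0 : ℝ), ∃ δ > (0 : ℝ),
    ∀ x ∈ ball x₀ r, ∀ s t : ℝ, |s| < δ → |t| < δ →
      dist (Y (X x t) s) (X (Y x s) t) ≤ C * |s * t|

/-- `σ` is a solution curve of `X` on the open interval `I` (an open order-connected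
set of reals containing `0`) with initial condition `x`. -/
structure IsSolutionCurve (X : M → ℝ → M) (I : Set ℝ) (σ : ℝ → M) (x : M) : Prop where
  isOpen : IsOpen I
  ordConnected : I.OrdConnected
  zero_mem : (0 : ℝ) ∈ I
  init : σ 0 = x
  cont : ContinuousOn σ I
  tangent : ∀ t ∈ I,
    (fun h : ℝ => dist (σ (t + h)) (X (σ t) h)) =o[nhds (0 : ℝ)] fun h => h

/-- The sum of two arc fields: `(X+Y)_t x := Y_t (X_t x)`. -/
def sumArc (X Y : M → ℝ → M) (x : M) (t : ℝ) : M := Y (X x t) t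

/-- The product of a function `a : M → ℝ` with an arc field:
`(aX)(x,t) := X(x, a(x)·t)`, the time truncated to `[-1,1]`. -/
def smulArc (a : M → ℝ) (X : M → ℝ → M) (x : M) (t : ℝ) : M :=
  X x (max (-1) (min 1 (a x * t)))

/-- The bracket of two arc fields. -/
noncomputable def bracket (X Y : M → ℝ → M) (x : M) (t : ℝ) : M :=
  if 0 ≤ t then
    Y (X (Y (X x (Real.sqrt |t|)) (Real.sqrt |t|)) (-Real.sqrt |t|)) (-Real.sqrt |t|)
  else
    X (Y (X (Y x (Real.sqrt |t|)) (Real.sqrt |t|)) (-Real.sqrt |t|)) (-Real.sqrt |t|)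

/-- Local uniform tangency `Z ∼ W` of arc fields: `d(Z_t x, W_t x) = o(t)`
locally uniformly in `x`. -/
def LocUnifTangent (Z W : M → ℝ → M) : Prop :=
  ∀ x₀ : M, ∃ r > (0 : ℝ), ∀ ε > (0 : ℝ), ∃ δ > (0 : ℝ),
    ∀ x ∈ ball x₀ r, ∀ t : ℝ, 0 < |t| → |t| < δ → dist (Z x t) (W x t) ≤ ε * |t|

/-- Transversality of two arc fields. -/
def Transverse (X Y : M → ℝ → M) : Prop :=
  ∀ x₀ : M, ∃ δ > (0 : ℝ), ∀ x ∈ ball x₀ δ, ∀ s t : ℝ, |s| < δ → |t| < δ →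
    δ * (|s| + |t|) ≤ dist (X x s) (Y x t)

/-- A set `S` is locally uniformly tangent to the arc field `Z`:
`d(Z_t x, S) = o(t)` locally uniformly for `x ∈ S`. -/
def SetTangentTo (S : Set M) (Z : M → ℝ → M) : Prop :=
  ∀ x₀ ∈ S, ∃ r > (0 : ℝ), ∀ ε > (0 : ℝ), ∃ δ > (0 : ℝ), ∀ x ∈ S ∩ ball x₀ r,
    ∀ t : ℝ, 0 < |t| → |t| < δ → Metric.infDist (Z x t) S ≤ ε * |t|

/-- `S` is an integral surface of the arc fields `X` and `Y`: a 2-dimensional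
topological manifold locally uniformly tangent to `aX + bY` for all Lipschitz `a b`. -/
def IsIntegralSurface (X Y : M → ℝ → M) (S : Set M) : Prop :=
  Nonempty (ChartedSpace (EuclideanSpace ℝ (Fin 2)) S) ∧
  ∀ a b : M → ℝ, (∃ K, LipschitzWith K a) → (∃ K, LipschitzWith K b) →
    SetTangentTo S (sumArc (smulArc a X) (smulArc b Y))

/-- The bracket of two local flows `F`, `G` (with time domains `IF x`, `IG x`)
is defined at `(x,t)` if all needed times lie in the relevant domains. -/
noncomputable def FlowBracketDefined (F G : M → ℝ → M) (IF IG : M → Set ℝ)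
    (x : M) (t : ℝ) : Prop :=
  if 0 ≤ t then
    Real.sqrt |t| ∈ IF x ∧ Real.sqrt |t| ∈ IG (F x (Real.sqrt |t|)) ∧
      (-Real.sqrt |t|) ∈ IF (G (F x (Real.sqrt |t|)) (Real.sqrt |t|)) ∧
      (-Real.sqrt |t|) ∈ IG (F (G (F x (Real.sqrt |t|)) (Real.sqrt |t|)) (-Real.sqrt |t|))
  else
    Real.sqrt |t| ∈ IG x ∧ Real.sqrt |t| ∈ IF (G x (Real.sqrt |t|)) ∧
      (-Real.sqrt |t|) ∈ IG (F (G x (Real.sqrt |t|)) (Real.sqrt |t|)) ∧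
      (-Real.sqrt |t|) ∈ IF (G (F (G x (Real.sqrt |t|)) (Real.sqrt |t|)) (-Real.sqrt |t|))

/-- Local uniform tangency of the bracket of two local flows to an arc field `W`,
required only where the bracket is defined. -/
noncomputable def FlowBracketTangent (F G : M → ℝ → M) (IF IG : M → Set ℝ)
    (W : M → ℝ → M) : Prop :=
  ∀ x₀ : M, ∃ r > (0 : ℝ), ∀ ε > (0 : ℝ), ∃ δ > (0 : ℝ), ∀ x ∈ ball x₀ r, ∀ t : ℝ,
    0 < |t| → |t| < δ → FlowBracketDefined F G IF IG x t →
      dist (bracket F G x t) (W x t) ≤ ε * |t|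

/-- Linear speed growth of an arc field. -/
def LinearSpeedGrowth (X : M → ℝ → M) : Prop :=
  ∃ x : M, ∃ c₁ > (0 : ℝ), ∃ c₂ > (0 : ℝ), ∀ r > (0 : ℝ), ∀ y ∈ ball x r,
    ∀ s ∈ Icc (-1 : ℝ) 1, ∀ t ∈ Icc (-1 : ℝ) 1,
      dist (X y s) (X y t) ≤ (c₁ * r + c₂) * |s - t|

/-- Iterated sum of a list of arc fields. -/
def comboList : List (M → ℝ → M) → M → ℝ → M
  | [], x, _ => x
  | Z :: L, x, t => comboList L (Z x t) t

/-- The linear combination `a₁X¹ + ⋯ + aₙXⁿ` of arc fields. -/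
def combo {n : ℕ} (X : Fin n → M → ℝ → M) (a : Fin n → M → ℝ) : M → ℝ → M :=
  comboList (List.ofFn fun i => smulArc (a i) (X i))

/-- The distance from `y` to the set of curves through `x` of the linear span
distribution `Δ(X¹,…,Xⁿ)`. -/
noncomputable def distToSpan {n : ℕ} (X : Fin n → M → ℝ → M) (y x : M) : ℝ :=
  sInf {r : ℝ | ∃ (a : Fin n → ℝ) (s : ℝ), s ∈ Icc (-1 : ℝ) 1 ∧
    r = dist y (combo X (fun i _ => a i) x s)}

/-- Local uniform tangency of an arc field to the distribution `Δ(X¹,…,Xⁿ)`. -/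
noncomputable def TangentToSpan {n : ℕ} (Z : M → ℝ → M) (X : Fin n → M → ℝ → M) : Prop :=
  ∀ x₀ : M, ∃ r > (0 : ℝ), ∀ ε > (0 : ℝ), ∃ δ > (0 : ℝ), ∀ x ∈ ball x₀ r, ∀ t : ℝ,
    0 < |t| → |t| < δ → distToSpan X (Z x t) x ≤ ε * |t|

/-- The family `X¹,…,Xⁿ` is transverse: each `Xⁱ` is transverse to the linear span
of the remaining arc fields (encoded by coefficient functions vanishing at slot `i`). -/
def TransverseFamily {n : ℕ} (X : Fin n → M → ℝ → M) : Prop :=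
  ∀ i : Fin n, ∀ x₀ : M, ∃ δ > (0 : ℝ), ∀ x ∈ ball x₀ δ, ∀ a : Fin n → ℝ, a i = 0 →
    ∀ s t : ℝ, |s| < δ → |t| < δ →
      δ * (|s| + |t|) ≤ dist (X i x t) (combo X (fun j _ => a j) x s)

/-- Involutivity of the distribution `Δ(X¹,…,Xⁿ)`. -/
noncomputable def InvolutiveFamily {n : ℕ} (X : Fin n → M → ℝ → M) : Prop :=
  ∀ i j : Fin n, TangentToSpan (bracket (X i) (X j)) X

/-- `S` is an integral surface for the distribution `Δ(X¹,…,Xⁿ)`. -/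
def IsIntegralSurfaceFamily {n : ℕ} (X : Fin n → M → ℝ → M) (S : Set M) : Prop :=
  Nonempty (ChartedSpace (EuclideanSpace ℝ (Fin n)) S) ∧
  ∀ a : Fin n → M → ℝ, (∀ i, ∃ K, LipschitzWith K (a i)) →
    SetTangentTo S (combo X a)

/-- The time reversal of a family of arcs. -/
def revArc (X : M → ℝ → M) (x : M) (t : ℝ) : M := X x (-t)

/-- `F`, with time domains `I`, is the maximal local flow of `X`. -/
def IsLocalFlow (X : M → ℝ → M) (I : M → Set ℝ) (F : M → ℝ → M) : Prop :=
  ∀ x : M, IsSolutionCurve X (I x) (F x) x ∧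
    ∀ (J : Set ℝ) (τ : ℝ → M), IsSolutionCurve X J τ x → J ⊆ I x ∧ Set.EqOn τ (F x) J

/-- The curve `σ` is tangent from the right to `X` at time `t`. -/
def RightTangent (X : M → ℝ → M) (σ : ℝ → M) (t : ℝ) : Prop :=
  ∀ ε > 0, ∃ δ > 0, ∀ h, 0 < h → h < δ → dist (σ (t + h)) (X (σ t) h) ≤ ε * h

/-- Local constants for an arc field satisfying E1 and E2. -/
structure ArcBox (X : M → ℝ → M) (x₀ : M) (R K : ℝ) : Prop where
  R_pos : 0 < R
  R_le : R ≤ 1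
  K_pos : 0 < K
  complete : ∃ s, IsComplete s ∧ ball x₀ R ⊆ s
  zero : ∀ x, X x 0 = x
  speed : ∀ y ∈ ball x₀ R, ∀ s ∈ Icc (-1 : ℝ) 1, ∀ t ∈ Icc (-1 : ℝ) 1,
    dist (X y s) (X y t) ≤ K * |s - t|
  e1 : ∀ x ∈ ball x₀ R, ∀ y ∈ ball x₀ R, ∀ t : ℝ, |t| < R →
    dist (X x t) (X y t) ≤ (1 + K * |t|) * dist x y
  e2 : ∀ x ∈ ball x₀ R, ∀ s t : ℝ, |s| < R → |t| < R →
    dist (X x (s + t)) (X (X x s) t) ≤ K * (|s| * |t|)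

theorem exists_arcBox (hM : LocallyComplete M) {X : M → ℝ → M} (hX : IsArcField X) (h1 : CondE1 X) (h2 : CondE2 X)
    (x₀ : M) : ∃ R K, ArcBox X x₀ R K := by
  obtain ⟨-, h0, hs⟩ := hX
  obtain ⟨c, hc, hcc⟩ := hM x₀
  obtain ⟨r0, hr0, hc⟩ := Metric.mem_nhds_iff.1 hc
  obtain ⟨r, hr, K, hK, hs⟩ := hs x₀
  obtain ⟨r1, hr1, d1, hd1, K1, hK1, h1⟩ := h1 x₀
  obtain ⟨r2, hr2, d2, hd2, K2, hK2, h2⟩ := h2 x₀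
  refine ⟨min 1 (min (min r0 r) (min (min r1 d1) (min r2 d2))), K + K1 + K2, ?_, ?_, ?_,
    ⟨c, hcc, fun y hy => hc (by simp only [mem_ball, lt_min_iff] at hy ⊢; tauto)⟩, h0, ?_, ?_, ?_⟩
  · positivity
  · exact min_le_left _ _
  · positivity
  · intro y hy s h s' h'
    have := hs y (by simp only [mem_ball, lt_min_iff] at hy ⊢; tauto) s h s' h'
    nlinarith [abs_nonneg (s - s')]
  · intro x hx y hy t ht
    simp only [mem_ball, lt_min_iff] at hx hy ht
    have := h1 x (by simp only [mem_ball]; tauto) y (by simp only [mem_ball]; tauto) t (by tauto)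
    have h3 : 0 ≤ dist x y * |t| := by positivity
    nlinarith
  · intro x hx s t hs' ht
    simp only [mem_ball, lt_min_iff] at hx hs' ht
    have := h2 x (by simp only [mem_ball]; tauto) s t (by tauto) (by tauto)
    rw [abs_mul] at this
    have h3 : 0 ≤ |s| * |t| := by positivity
    nlinarith

theorem ArcBox.rev {X : M → ℝ → M} {x₀ : M} {R K : ℝ} (h : ArcBox X x₀ R K) :
    ArcBox (revArc X) x₀ R K where
  R_pos := h.R_pos
  R_le := h.R_le
  K_pos := h.K_pos
  complete := h.complete
  zero x := by simp [revArc, h.zero]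
  speed y hy s hs t ht := by
    have := h.speed y hy (-s) ⟨by linarith [hs.2], by linarith [hs.1]⟩ (-t)
      ⟨by linarith [ht.2], by linarith [ht.1]⟩
    rwa [show -s - -t = -(s - t) by ring, abs_neg] at this
  e1 x hx y hy t ht := by
    have := h.e1 x hx y hy (-t) (by rwa [abs_neg])
    rwa [abs_neg] at this
  e2 x hx s t hs ht := by
    have := h.e2 x hx (-s) (-t) (by rwa [abs_neg]) (by rwa [abs_neg])
    rw [abs_neg, abs_neg] at this
    simpa [revArc, add_comm] using this

theorem ArcBox.speed_zero {X : M → ℝ → M} {x₀ : M} {R K : ℝ} (h : ArcBox X x₀ R K)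
    {x : M} (hx : x ∈ ball x₀ R) {t : ℝ} (ht : |t| ≤ 1) : dist (X x t) x ≤ K * |t| := by
  have := h.speed x hx t (abs_le.1 ht) 0 (by simp)
  simpa [h.zero] using this

theorem IsArcField.rev {X : M → ℝ → M} (hX : IsArcField X) : IsArcField (revArc X) := by
  obtain ⟨hc, h0, hs⟩ := hX
  refine ⟨?_, fun x => by simp [revArc, h0], fun x => ?_⟩
  · refine hc.comp (f := fun p : M × ℝ => (p.1, -p.2)) (by fun_prop) ?_
    rintro ⟨x, t⟩ ⟨-, h1, h2⟩
    exact ⟨mem_univ _, by simp only at *; linarith, by simp only at *; linarith⟩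
  · obtain ⟨r, hr, K, hK, hs⟩ := hs x
    refine ⟨r, hr, K, hK, fun y hy s hs' t ht => ?_⟩
    have := hs y hy (-s) ⟨by linarith [hs'.2], by linarith [hs'.1]⟩ (-t)
      ⟨by linarith [ht.2], by linarith [ht.1]⟩
    rwa [show -s - -t = -(s - t) by ring, abs_neg] at this

theorem IsSolutionCurve.rev {X : M → ℝ → M} {I : Set ℝ} {σ : ℝ → M} {x : M}
    (h : IsSolutionCurve X I σ x) :
    IsSolutionCurve (revArc X) (Neg.neg ⁻¹' I) (fun t => σ (-t)) x where
  isOpen := h.isOpen.preimage continuous_neg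
  ordConnected := by
    refine ⟨fun a ha b hb c hc => ?_⟩
    exact h.ordConnected.out hb ha ⟨by linarith [hc.2], by linarith [hc.1]⟩
  zero_mem := by simpa using h.zero_mem
  init := by simpa using h.init
  cont := h.cont.comp continuous_neg.continuousOn (fun t ht => ht)
  tangent t ht := by
    have := (h.tangent (-t) ht).comp_tendsto
      (show Filter.Tendsto (fun h : ℝ => -h) (nhds 0) (nhds 0) by
        simpa using (continuous_neg (G := ℝ)).tendsto 0)
    refine IsLittleO.of_neg_right (this.congr_left (fun u => ?_))
    simp [revArc, add_comm]

theorem revArc_revArc {M : Type*} (X : M → ℝ → M) : revArc (revArc X) = X := by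
  funext x t; simp [revArc]

theorem IsLocalFlow.rev {X : M → ℝ → M} {I : M → Set ℝ} {F : M → ℝ → M}
    (h : IsLocalFlow X I F) :
    IsLocalFlow (revArc X) (fun x => Neg.neg ⁻¹' I x) (revArc F) := by
  intro x
  refine ⟨(h x).1.rev, fun J τ hJ => ?_⟩
  have h1 := hJ.rev
  rw [revArc_revArc] at h1
  obtain ⟨h2, h3⟩ := (h x).2 _ _ h1
  refine ⟨fun t ht => h2 (by simpa using ht), fun t ht => ?_⟩
  simpa [revArc] using h3 (x := -t) (by simpa using ht)

theorem IsSolutionCurve.tangent_le {X : M → ℝ → M} {I : Set ℝ} {σ : ℝ → M} {x : M}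
    (h : IsSolutionCurve X I σ x) {t : ℝ} (ht : t ∈ I) {ε : ℝ} (hε : 0 < ε) :
    ∃ δ > 0, ∀ h, |h| < δ → dist (σ (t + h)) (X (σ t) h) ≤ ε * |h| := by
  have := (h.tangent t ht).def hε
  obtain ⟨δ, hδ, h2⟩ := Metric.eventually_nhds_iff.1 this
  refine ⟨δ, hδ, fun u hu => ?_⟩
  have := h2 (y := u) (by simpa using hu)
  simpa using this

theorem IsSolutionCurve.rightTangent {X : M → ℝ → M} {I : Set ℝ} {σ : ℝ → M} {x : M}
    (h : IsSolutionCurve X I σ x) {t : ℝ} (ht : t ∈ I) : RightTangent X σ t := by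
  intro ε hε
  obtain ⟨δ, hδ, h2⟩ := h.tangent_le ht hε
  exact ⟨δ, hδ, fun u hu hu' => by
    have := h2 u (by rwa [abs_of_pos hu]); rwa [abs_of_pos hu] at this⟩

theorem frequently_slope_lt {f : ℝ → ℝ} {t c r : ℝ}
    (h : ∀ ε > 0, ∃ δ > 0, ∀ u, 0 < u → u < δ → f (t + u) - f t ≤ (c + ε) * u) (hr : c < r) :
    ∃ᶠ z in nhdsWithin t (Ioi t), (z - t)⁻¹ * (f z - f t) < r := by
  obtain ⟨δ, hδ, h⟩ := h ((r - c) / 2) (by linarith)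
  refine Filter.Eventually.frequently ?_
  filter_upwards [Ioo_mem_nhdsGT (show t < t + δ by linarith)] with z hz
  have h1 := h (z - t) (by linarith [hz.1]) (by linarith [hz.2])
  have h2 : 0 < z - t := by linarith [hz.1]
  rw [add_sub_cancel] at h1
  rw [inv_mul_lt_iff₀ h2]
  nlinarith

theorem dist_le_of_rightTangent {X : M → ℝ → M} (hX : IsArcField X) {x₀ : M} {R K K' T : ℝ}
    (hbox : ArcBox X x₀ R K) (hK : K < K') {σ : ℝ → M} (hc : ContinuousOn σ (Icc 0 T))
    (ht : ∀ t ∈ Ico 0 T, RightTangent X σ t) (hR : dist (σ 0) x₀ + K' * T ≤ R) :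
    ∀ t ∈ Icc 0 T, dist (σ 0) (σ t) ≤ K' * t := by
  have key : ∀ t, ∃ c : ℝ, t ∈ Ico 0 T → (σ t ∈ ball x₀ R → c ≤ K) ∧
      ∀ ε > 0, ∃ δ > 0, ∀ u, 0 < u → u < δ →
        dist (σ 0) (σ (t + u)) - dist (σ 0) (σ t) ≤ (c + ε) * u := by
    intro t
    by_cases htT : t ∈ Ico 0 T
    swap
    · exact ⟨0, fun h => absurd h htT⟩
    have aux : ∀ c > 0, (∀ u ∈ Icc (-1 : ℝ) 1, dist (X (σ t) 0) (X (σ t) u) ≤ c * |0 - u|) →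
        ∀ ε > 0, ∃ δ > 0, ∀ u, 0 < u → u < δ →
        dist (σ 0) (σ (t + u)) - dist (σ 0) (σ t) ≤ (c + ε) * u := by
      intro c hc hcu ε hε
      obtain ⟨δ, hδ, h1⟩ := ht t htT ε hε
      refine ⟨min δ 1, by positivity, fun u hu hu' => ?_⟩
      obtain ⟨h2, h3⟩ := lt_min_iff.1 hu'
      have h4 := h1 u hu h2
      have h5 := hcu u ⟨by linarith, h3.le⟩
      rw [hX.2.1, zero_sub, abs_neg, abs_of_pos hu] at h5
      have h6 := dist_triangle4 (σ 0) (σ t) (X (σ t) u) (σ (t + u))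
      rw [dist_comm (X (σ t) u)] at h6
      linarith
    by_cases hb : σ t ∈ ball x₀ R
    · exact ⟨K, fun _ => ⟨fun _ => le_rfl, aux K hbox.K_pos
        fun u hu => hbox.speed _ hb 0 (by simp) u hu⟩⟩
    · obtain ⟨r, hr, c, hc, h1⟩ := hX.2.2 (σ t)
      exact ⟨c, fun _ => ⟨fun h => absurd h hb, aux c hc
        fun u hu => h1 _ (mem_ball_self hr) 0 (by simp) u hu⟩⟩
  choose c hc' using key
  have hK0 := hbox.K_pos
  refine image_le_of_liminf_slope_right_lt_deriv_boundary' (f := fun t => dist (σ 0) (σ t))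
    (f' := c) (B := fun t => K' * t) (B' := fun _ => K') (continuous_dist.comp_continuousOn
      (continuousOn_const.prodMk hc)) ?_
    (by simp) (by fun_prop) ?_ ?_
  · intro t ht r hr
    have := frequently_slope_lt (f := fun t => dist (σ 0) (σ t)) (hc' t ht).2 hr
    refine this.mono fun z hz => ?_
    simpa [slope_def_module] using hz
  · intro t _
    simpa using ((hasDerivAt_id t).const_mul K').hasDerivWithinAt
  · intro t ht h
    refine lt_of_le_of_lt ((hc' t ht).1 ?_) hK
    have h1 := dist_triangle_left (σ t) x₀ (σ 0)
    rw [mem_ball]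
    have : K' * t < K' * T := by
      apply mul_lt_mul_of_pos_left ht.2; linarith
    linarith

theorem gronwall_rightTangent {X : M → ℝ → M} {x₀ : M} {R K a b : ℝ}
    (hbox : ArcBox X x₀ R K) {σ τ : ℝ → M} (hσ : ContinuousOn σ (Icc a b))
    (hτ : ContinuousOn τ (Icc a b)) (hσt : ∀ t ∈ Ico a b, RightTangent X σ t)
    (hτt : ∀ t ∈ Ico a b, RightTangent X τ t) (hσb : ∀ t ∈ Ico a b, σ t ∈ ball x₀ R)
    (hτb : ∀ t ∈ Ico a b, τ t ∈ ball x₀ R) :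
    ∀ t ∈ Icc a b, dist (σ t) (τ t) ≤ dist (σ a) (τ a) * Real.exp (K * (t - a)) := by
  intro t ht
  rw [← gronwallBound_ε0]
  refine le_gronwallBound_of_liminf_deriv_right_le (f := fun t => dist (σ t) (τ t))
    (f' := fun t => K * dist (σ t) (τ t)) (continuous_dist.comp_continuousOn (hσ.prodMk hτ)) ?_ le_rfl (by simp) t ht
  intro s hs r hr
  refine frequently_slope_lt (f := fun t => dist (σ t) (τ t)) ?_ hr
  intro ε hε
  obtain ⟨δ, hδ, h1⟩ := hσt s hs (ε / 2) (by positivity)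
  obtain ⟨δ', hδ', h2⟩ := hτt s hs (ε / 2) (by positivity)
  have hR := hbox.R_pos
  refine ⟨min R (min δ δ'), by positivity, fun u hu hu' => ?_⟩
  simp only [lt_min_iff] at hu'
  have h3 := h1 u hu hu'.2.1
  have h4 := h2 u hu hu'.2.2
  have h5 := hbox.e1 _ (hσb s hs) _ (hτb s hs) u (by rw [abs_of_pos hu]; exact hu'.1)
  rw [abs_of_pos hu] at h5
  have h6 := dist_triangle4 (σ (s + u)) (X (σ s) u) (X (τ s) u) (τ (s + u))
  rw [dist_comm (X (τ s) u)] at h6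
  linarith

theorem IsSolutionCurve.shift {X : M → ℝ → M} {I : Set ℝ} {σ : ℝ → M} {x : M}
    (h : IsSolutionCurve X I σ x) {s : ℝ} (hs : s ∈ I) :
    IsSolutionCurve X ((fun t => s + t) ⁻¹' I) (fun t => σ (s + t)) (σ s) where
  isOpen := h.isOpen.preimage (by fun_prop)
  ordConnected := by
    refine ⟨fun a ha b hb c hc => ?_⟩
    exact h.ordConnected.out ha hb ⟨by simp only; linarith [hc.1], by simp only; linarith [hc.2]⟩
  zero_mem := by simpa using hs
  init := by simp
  cont := h.cont.comp (by fun_prop) (fun t ht => ht)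
  tangent t ht := by simpa [add_assoc] using h.tangent (s + t) ht

theorem IsLocalFlow.add {X : M → ℝ → M} {I : M → Set ℝ} {F : M → ℝ → M}
    (h : IsLocalFlow X I F) {x : M} {s t : ℝ} (hs : s ∈ I x) (hst : s + t ∈ I x) :
    F x (s + t) = F (F x s) t :=
  ((h (F x s)).2 _ _ ((h x).1.shift hs)).2 hst

/-- Gluing a solution curve with a second one that agrees with it just before time `β`. -/
theorem IsSolutionCurve.glue {X : M → ℝ → M} {I : Set ℝ} {σ ρ : ℝ → M} {x : M}
    (h : IsSolutionCurve X I σ x) {J : Set ℝ} {y : M} (hρ : IsSolutionCurve X J ρ y)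
    {β η : ℝ} (hβ : 0 < β) (hη : 0 < η) (hIβ : I ⊆ Iio β) (hβI : Ico 0 β ⊆ I) (hηβ : η < β)
    (hJ : Ioo (-η) η ⊆ J) (heq : ∀ s, 0 < s → s < η → σ (β - s) = ρ (-s)) :
    IsSolutionCurve X (I ∪ Ioo (β - η) (β + η))
      (fun t => if t < β then σ t else ρ (t - β)) x := by
  have e1 : ∀ t ∈ I, (fun t => if t < β then σ t else ρ (t - β)) =ᶠ[nhds t] σ := by
    intro t ht
    filter_upwards [Iio_mem_nhds (hIβ ht)] with u hu
    exact if_pos hu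
  have e2 : ∀ t ∈ Ioo (β - η) (β + η),
      (fun t => if t < β then σ t else ρ (t - β)) =ᶠ[nhds t] fun t => ρ (t - β) := by
    intro t ht
    filter_upwards [Ioo_mem_nhds ht.1 ht.2] with u hu
    split_ifs with h1
    · have := heq (β - u) (by linarith) (by linarith [hu.1])
      simpa using this
    · rfl
  have tan : ∀ (τ' : ℝ → M) (t : ℝ),
      (fun t => if t < β then σ t else ρ (t - β)) =ᶠ[nhds t] τ' →
      (fun h : ℝ => dist (τ' (t + h)) (X (τ' t) h)) =o[nhds (0 : ℝ)] (fun h => h) →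
      (fun h : ℝ => dist ((fun t => if t < β then σ t else ρ (t - β)) (t + h))
        (X ((fun t => if t < β then σ t else ρ (t - β)) t) h)) =o[nhds (0 : ℝ)] fun h => h := by
    intro τ' t h1 h2
    refine h2.congr' ?_ Filter.EventuallyEq.rfl
    have h3 : Filter.Tendsto (fun h : ℝ => t + h) (nhds 0) (nhds t) := by
      have : Continuous fun h : ℝ => t + h := by fun_prop
      simpa using this.tendsto 0
    filter_upwards [h3.eventually h1] with u hu
    rw [hu, h1.eq_of_nhds]
  refine ⟨h.isOpen.union isOpen_Ioo, ?_, Or.inl h.zero_mem, ?_, ?_, ?_⟩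
  · rw [← isPreconnected_iff_ordConnected]
    refine IsPreconnected.union (β - η / 2) (hβI ⟨by linarith, by linarith⟩)
      ⟨by linarith, by linarith⟩ (isPreconnected_iff_ordConnected.2 h.ordConnected)
      isPreconnected_Ioo
  · simp [hβ, h.init]
  · rintro t (ht | ht)
    · exact ((h.cont.continuousAt (h.isOpen.mem_nhds ht)).congr (e1 t ht).symm).continuousWithinAt
    · refine (ContinuousAt.congr ?_ (e2 t ht).symm).continuousWithinAt
      refine ContinuousAt.comp (g := ρ) (f := fun t => t - β) ?_ (by fun_prop)
      exact hρ.cont.continuousAt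
        (hρ.isOpen.mem_nhds (hJ ⟨by linarith [ht.1], by linarith [ht.2]⟩))
  · rintro t (ht | ht)
    · exact tan _ t (e1 t ht) (h.tangent t ht)
    · refine tan _ t (e2 t ht) ?_
      have := hρ.tangent (t - β) (hJ ⟨by linarith [ht.1], by linarith [ht.2]⟩)
      simpa [sub_add_eq_add_sub] using this

theorem IsSolutionCurve.dist_le {X : M → ℝ → M} (hX : IsArcField X) {x₀ : M} {R K : ℝ}
    (hbox : ArcBox X x₀ R K) {I : Set ℝ} {σ : ℝ → M} {x : M} (h : IsSolutionCurve X I σ x)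
    {s t : ℝ} (hst : s ≤ t) (hs : s ∈ I) (ht : t ∈ I)
    (hR : dist (σ s) x₀ + 2 * K * (t - s) ≤ R) : dist (σ s) (σ t) ≤ 2 * K * (t - s) := by
  have h1 := h.shift hs
  have hK := hbox.K_pos
  have hsub : Icc 0 (t - s) ⊆ (fun t => s + t) ⁻¹' I := fun u hu =>
    h.ordConnected.out hs ht ⟨by linarith [hu.1], by linarith [hu.2]⟩
  have h2 := dist_le_of_rightTangent hX hbox (show K < 2 * K by linarith) (T := t - s)
    (h1.cont.mono hsub) (fun u hu => h1.rightTangent (hsub (Ico_subset_Icc_self hu)))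
    (by simpa using hR) (t - s) ⟨by linarith, le_rfl⟩
  simpa using h2

theorem IsLocalFlow.mem_domain {X : M → ℝ → M} (hX : IsArcField X)
    {x₀ : M} {R K : ℝ} (hbox : ArcBox X x₀ R K)
    {I : M → Set ℝ} {F : M → ℝ → M} (h : IsLocalFlow X I F) {x : M} {T : ℝ} (hT : 0 ≤ T)
    (hR : dist x x₀ + 2 * K * T < R) : T ∈ I x := by
  by_contra hTI
  have hK := hbox.K_pos
  have hsol := (h x).1
  have hlt : ∀ t ∈ I x, t < T := by
    intro t ht
    by_contra hc
    exact hTI (hsol.ordConnected.out hsol.zero_mem ht ⟨hT, not_lt.1 hc⟩)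
  have hbdd : BddAbove (I x) := ⟨T, fun t ht => (hlt t ht).le⟩
  set β := sSup (I x) with hβdef
  have hβT : β ≤ T := csSup_le ⟨0, hsol.zero_mem⟩ fun t ht => (hlt t ht).le
  have hopen : ∀ t ∈ I x, t < β := by
    intro t ht
    obtain ⟨e, he, h1⟩ := Metric.isOpen_iff.1 hsol.isOpen t ht
    have h2 : t + e / 2 ∈ I x := h1 (by
      rw [mem_ball, Real.dist_eq, add_sub_cancel_left, abs_of_pos (by positivity)]; linarith)
    have := le_csSup hbdd h2
    linarith
  have hβ0 : 0 < β := hopen 0 hsol.zero_mem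
  have hIco : Ico 0 β ⊆ I x := by
    intro t ht
    obtain ⟨s, hs, hts⟩ := exists_lt_of_lt_csSup ⟨0, hsol.zero_mem⟩ ht.2
    exact hsol.ordConnected.out hsol.zero_mem hs ⟨ht.1, hts.le⟩
  have hx0 : F x 0 = x := hsol.init
  have hstay : ∀ t ∈ Ico 0 β, dist (F x t) x₀ ≤ dist x x₀ + 2 * K * t := by
    intro t ht
    have h1 := hsol.dist_le hX hbox ht.1 hsol.zero_mem (hIco ht) (by
      rw [hx0]; nlinarith [ht.2])
    rw [hx0] at h1
    have := dist_triangle_left (F x t) x₀ x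
    linarith
  have hlip : ∀ s ∈ Ico 0 β, ∀ t ∈ Ico 0 β, s ≤ t → dist (F x s) (F x t) ≤ 2 * K * (t - s) := by
    intro s hs t ht hst
    refine hsol.dist_le hX hbox hst (hIco hs) (hIco ht) ?_
    have := hstay s hs
    nlinarith [ht.2]
  have hmem : ∀ᶠ t in nhdsWithin β (Iio β), t ∈ Ico 0 β := by
    filter_upwards [Ioo_mem_nhdsLT hβ0] with t ht using ⟨ht.1.le, ht.2⟩
  have hin : ∀ t ∈ Ico 0 β, F x t ∈ ball x₀ R := by
    intro t ht
    have := hstay t ht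
    rw [mem_ball]
    nlinarith [ht.2]
  obtain ⟨c, hc, hcb⟩ := hbox.complete
  have hcauchy : Cauchy (Filter.map (F x) (nhdsWithin β (Iio β))) := by
    rw [Metric.cauchy_iff]
    refine ⟨inferInstance, fun ε hε => ?_⟩
    have h1 : max 0 (β - ε / (4 * K)) < β := by
      refine max_lt hβ0 ?_
      have : 0 < ε / (4 * K) := by positivity
      linarith
    refine ⟨F x '' Ioo (max 0 (β - ε / (4 * K))) β,
      Filter.image_mem_map (Ioo_mem_nhdsLT h1), ?_⟩
    have h2 : 2 * K * (ε / (4 * K)) = ε / 2 := by field_simp; norm_num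
    have aux : ∀ s ∈ Ioo (max 0 (β - ε / (4 * K))) β, ∀ t ∈ Ioo (max 0 (β - ε / (4 * K))) β,
        s ≤ t → dist (F x s) (F x t) < ε := by
      intro s hs t ht hst
      obtain ⟨h3, h4⟩ := max_lt_iff.1 hs.1
      have := hlip s ⟨h3.le, hs.2⟩ t ⟨h3.le.trans hst, ht.2⟩ hst
      have : 2 * K * (t - s) ≤ 2 * K * (ε / (4 * K)) := by
        apply mul_le_mul_of_nonneg_left _ (by linarith)
        linarith [ht.2]
      linarith
    rintro _ ⟨s, hs, rfl⟩ _ ⟨t, ht, rfl⟩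
    rcases le_total s t with h3 | h3
    · exact aux s hs t ht h3
    · rw [dist_comm]; exact aux t ht s hs h3
  obtain ⟨y, -, hy⟩ := hc _ hcauchy (by
    rw [Filter.le_principal_iff, Filter.mem_map]
    filter_upwards [hmem] with t ht using hcb (hin t ht))
  have hy : Filter.Tendsto (F x) (nhdsWithin β (Iio β)) (nhds y) := hy
  have hyR : y ∈ ball x₀ R := by
    have h1 : dist y x₀ ≤ dist x x₀ + 2 * K * T := by
      refine le_of_tendsto (hy.dist tendsto_const_nhds) ?_
      filter_upwards [hmem] with t ht
      have := hstay t ht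
      nlinarith [ht.2]
    rw [mem_ball]; linarith
  have hysol := (h y).1
  have hnear : ∀ᶠ t in nhds (0 : ℝ), t ∈ I y ∧ F y t ∈ ball x₀ R := by
    have h1 := hysol.isOpen.mem_nhds hysol.zero_mem
    have h2 := hysol.cont.continuousAt h1
    refine Filter.Eventually.and h1 (h2.eventually_mem ?_)
    rw [hysol.init]
    exact isOpen_ball.mem_nhds hyR
  obtain ⟨η', hη', hηI⟩ := Metric.eventually_nhds_iff.1 hnear
  set η := min η' (β / 2)
  have hη : 0 < η := by positivity
  have hη1 : η ≤ η' := min_le_left _ _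
  have hη2 : η ≤ β / 2 := min_le_right _ _
  have hηI : ∀ t ∈ Ioo (-η) η, t ∈ I y ∧ F y t ∈ ball x₀ R := fun t ht => hηI (by
    rw [dist_zero_right, Real.norm_eq_abs, abs_lt]; exact ⟨by linarith [ht.1], by linarith [ht.2]⟩)
  have heq : ∀ s, 0 < s → s < η → F x (β - s) = F y (-s) := by
    intro s hs hsη
    have hgr : ∀ a, 0 < a → a < s → dist (F x (β - s)) (F y (-s)) ≤
        dist (F x (β - a)) (F y (-a)) * Real.exp (K * s) := by
      intro a ha has
      have r1 := hsol.rev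
      have r2 := hysol.rev
      have m1 : ∀ t ∈ Icc a s, β - t ∈ Ico 0 β := fun t ht =>
        ⟨by linarith [ht.2], by linarith [ht.1]⟩
      have m2 : ∀ t ∈ Icc a s, -t ∈ Ioo (-η) η := fun t ht =>
        ⟨by linarith [ht.2], by linarith [ht.1]⟩
      have := gronwall_rightTangent hbox.rev (a := a) (b := s)
        (σ := fun t => F x (β - t)) (τ := fun t => F y (-t))
        (hsol.cont.comp (by fun_prop) fun t ht => hIco (m1 t ht))
        (hysol.cont.comp (by fun_prop) fun t ht => (hηI _ (m2 t ht)).1)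
        (fun t ht => by
          have m3 := hIco (m1 t (Ico_subset_Icc_self ht))
          have := r1.rightTangent (t := t - β) (by simpa using m3)
          intro ε hε
          obtain ⟨δ, hδ, h5⟩ := this ε hε
          refine ⟨δ, hδ, fun u hu hu' => ?_⟩
          have := h5 u hu hu'
          simpa [show -(t - β + u) = β - (t + u) by ring] using this)
        (fun t ht => r2.rightTangent (hηI _ (m2 t (Ico_subset_Icc_self ht))).1)
        (fun t ht => hin _ (m1 t (Ico_subset_Icc_self ht)))
        (fun t ht => (hηI _ (m2 t (Ico_subset_Icc_self ht))).2) s ⟨has.le, le_rfl⟩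
      refine this.trans (mul_le_mul_of_nonneg_left (Real.exp_le_exp.2 ?_) dist_nonneg)
      nlinarith
    have hlim : Filter.Tendsto (fun a => dist (F x (β - a)) (F y (-a)) * Real.exp (K * s))
        (nhdsWithin 0 (Ioi 0)) (nhds (dist y y * Real.exp (K * s))) := by
      refine (Filter.Tendsto.dist (hy.comp ?_) ?_).mul_const _
      · refine tendsto_nhdsWithin_of_tendsto_nhds_of_eventually_within _ ?_ ?_
        · have : Continuous fun a : ℝ => β - a := by fun_prop
          simpa using (this.tendsto 0).mono_left nhdsWithin_le_nhds
        · filter_upwards [self_mem_nhdsWithin] with a ha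
          simp only [mem_Iio, mem_Ioi] at *; linarith
      · have h2 := hysol.cont.continuousAt (hysol.isOpen.mem_nhds hysol.zero_mem)
        have h3 : ContinuousAt (fun a => F y (-a)) 0 :=
          ContinuousAt.comp (g := F y) (f := fun a : ℝ => -a) (by simpa using h2) (by fun_prop)
        have h4 := h3.tendsto
        simp only [neg_zero, hysol.init] at h4
        exact h4.mono_left nhdsWithin_le_nhds
    have h0 : dist (F x (β - s)) (F y (-s)) ≤ dist y y * Real.exp (K * s) := by
      refine ge_of_tendsto hlim ?_
      filter_upwards [Ioo_mem_nhdsGT hs] with a ha using hgr a ha.1 ha.2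
    rw [dist_self, zero_mul] at h0
    exact dist_le_zero.1 h0
  have hglue := hsol.glue hysol hβ0 hη (fun t ht => hopen t ht) hIco (by linarith)
    (fun t ht => (hηI t ht).1) heq
  have := ((h x).2 _ _ hglue).1 (Or.inr ⟨by linarith, by linarith⟩ : β ∈ _)
  exact lt_irrefl _ (hopen β this)

/-- Uniform local estimates for an arc field `X` and its local flow `F` on a ball. -/
structure FlowBox (X F : M → ℝ → M) (z : M) (r K : ℝ) : Prop where
  r_pos : 0 < r
  r_le : r ≤ 1
  K_pos : 0 < K
  arc_lip : ∀ x ∈ ball z r, ∀ y ∈ ball z r, ∀ t : ℝ, |t| < r →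
    dist (X x t) (X y t) ≤ (1 + K * |t|) * dist x y
  arc_speed : ∀ x ∈ ball z r, ∀ t : ℝ, |t| < r → dist (X x t) x ≤ K * |t|
  arc_add : ∀ x ∈ ball z r, ∀ s t : ℝ, |s| < r → |t| < r →
    dist (X x (s + t)) (X (X x s) t) ≤ K * (|s| * |t|)
  flow_zero : ∀ x, F x 0 = x
  flow_lip : ∀ x ∈ ball z r, ∀ y ∈ ball z r, ∀ t : ℝ, |t| < r →
    dist (F x t) (F y t) ≤ (1 + K * |t|) * dist x y
  flow_speed : ∀ x ∈ ball z r, ∀ t : ℝ, |t| < r → dist (F x t) x ≤ K * |t|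
  flow_add : ∀ x ∈ ball z r, ∀ s t : ℝ, |s| < r → |t| < r → |s + t| < r →
    F x (s + t) = F (F x s) t
  near : ∀ x ∈ ball z r, ∀ t : ℝ, |t| < r → dist (X x t) (F x t) ≤ K * |t| ^ 2

theorem IsLocalFlow.estimates {X : M → ℝ → M} (hX : IsArcField X)
    {x₀ : M} {R K : ℝ} (hbox : ArcBox X x₀ R K)
    {I : M → Set ℝ} {F : M → ℝ → M} (h : IsLocalFlow X I F) {x : M} {T : ℝ} (hT : 0 ≤ T)
    (hR : dist x x₀ + 2 * K * T < R) (hKT : K * T ≤ 1) :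
    T ∈ I x ∧ dist (F x T) x ≤ 2 * K * T ∧ ∀ y, dist y x₀ + 2 * K * T < R →
      dist (F x T) (F y T) ≤ (1 + 2 * K * T) * dist x y := by
  have hK := hbox.K_pos
  have key : ∀ y, dist y x₀ + 2 * K * T < R → Icc 0 T ⊆ I y ∧
      ∀ t ∈ Icc 0 T, dist y (F y t) ≤ 2 * K * t := by
    intro y hy
    have hI : Icc 0 T ⊆ I y := (h y).1.ordConnected.out (h y).1.zero_mem
      (h.mem_domain hX hbox hT hy)
    refine ⟨hI, fun t ht => ?_⟩
    have := (h y).1.dist_le hX hbox ht.1 (h y).1.zero_mem (hI ht) (by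
      rw [(h y).1.init]; nlinarith [ht.2])
    simpa [(h y).1.init] using this
  have hball : ∀ y, dist y x₀ + 2 * K * T < R → ∀ t ∈ Ico 0 T, F y t ∈ ball x₀ R := by
    intro y hy t ht
    have := (key y hy).2 t (Ico_subset_Icc_self ht)
    have h2 := dist_triangle_left (F y t) x₀ y
    rw [mem_ball]
    nlinarith [ht.2]
  refine ⟨(key x hR).1 ⟨hT, le_rfl⟩, ?_, fun y hy => ?_⟩
  · rw [dist_comm]; exact (key x hR).2 T ⟨hT, le_rfl⟩
  · have hg := gronwall_rightTangent hbox ((h x).1.cont.mono (key x hR).1)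
      ((h y).1.cont.mono (key y hy).1)
      (fun t ht => (h x).1.rightTangent ((key x hR).1 (Ico_subset_Icc_self ht)))
      (fun t ht => (h y).1.rightTangent ((key y hy).1 (Ico_subset_Icc_self ht)))
      (hball x hR) (hball y hy) T ⟨hT, le_rfl⟩
    rw [(h x).1.init, (h y).1.init, sub_zero, mul_comm] at hg
    refine hg.trans (mul_le_mul_of_nonneg_right ?_ dist_nonneg)
    have h0 : 0 ≤ K * T := by positivity
    have := Real.abs_exp_sub_one_le (x := K * T) (by rwa [abs_of_nonneg h0])
    rw [abs_of_nonneg h0] at this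
    have := (abs_le.1 this).2
    linarith

theorem exists_flowBox (hM : LocallyComplete M) {X : M → ℝ → M} (hX : IsArcField X)
    (h1 : CondE1 X) (h2 : CondE2 X) {I : M → Set ℝ} {F : M → ℝ → M} (h : IsLocalFlow X I F)
    (hXF : ∀ x₀ : M, ∃ C > (0 : ℝ), ∃ r > (0 : ℝ), ∃ δ > (0 : ℝ),
      ∀ x ∈ Metric.ball x₀ r, ∀ t : ℝ, |t| < δ → t ∈ I x →
        dist (X x t) (F x t) ≤ C * t ^ 2) (x₀ : M) :
    ∃ r K, FlowBox X F x₀ r K := by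
  obtain ⟨R, K, hbox⟩ := exists_arcBox hM hX h1 h2 x₀
  obtain ⟨C, hC, r1, hr1, δ, hδ, hn⟩ := hXF x₀
  have hK := hbox.K_pos
  have hR := hbox.R_pos
  have hR1 := hbox.R_le
  set r := min (R / (4 * (K + 1))) (min r1 δ)
  have hr : 0 < r := by positivity
  have hrR : 4 * ((K + 1) * r) ≤ R := by
    have h3 : r ≤ R / (4 * (K + 1)) := min_le_left _ _
    rw [le_div_iff₀ (by positivity)] at h3
    linarith
  have hrr1 : r ≤ r1 := (min_le_right _ _).trans (min_le_left _ _)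
  have hrδ : r ≤ δ := (min_le_right _ _).trans (min_le_right _ _)
  have hKr : 0 < K * r := by positivity
  have hrR' : r ≤ R := by nlinarith
  have hdom : ∀ x ∈ ball x₀ r, ∀ t, t < r → dist x x₀ + 2 * K * t < R := by
    intro x hx t ht
    rw [mem_ball] at hx
    nlinarith
  have hKt : ∀ t, t < r → K * t ≤ 1 := fun t ht => by nlinarith
  have est : ∀ x ∈ ball x₀ r, ∀ t, |t| < r → t ∈ I x ∧ dist (F x t) x ≤ 2 * K * |t| ∧
      ∀ y ∈ ball x₀ r, dist (F x t) (F y t) ≤ (1 + 2 * K * |t|) * dist x y := by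
    intro x hx t ht
    rcases le_total 0 t with h0 | h0
    · rw [abs_of_nonneg h0] at ht ⊢
      obtain ⟨e1, e2, e3⟩ := h.estimates hX hbox h0 (hdom x hx t ht) (hKt t ht)
      exact ⟨e1, e2, fun y hy => e3 y (hdom y hy t ht)⟩
    · rw [abs_of_nonpos h0] at ht ⊢
      obtain ⟨e1, e2, e3⟩ := h.rev.estimates hX.rev hbox.rev (T := -t) (by linarith)
        (hdom x hx _ ht) (hKt _ ht)
      refine ⟨by simpa using e1, by simpa [revArc] using e2, fun y hy => ?_⟩
      simpa [revArc] using e3 y (hdom y hy _ ht)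
  have hsub : ∀ x ∈ ball x₀ r, x ∈ ball x₀ R := fun x hx => ball_subset_ball hrR' hx
  refine ⟨r, 2 * K + C, hr, by linarith, by positivity, ?_, ?_, ?_, fun x => (h x).1.init,
    ?_, ?_, ?_, ?_⟩
  · intro x hx y hy t ht
    have := hbox.e1 x (hsub x hx) y (hsub y hy) t (by linarith)
    refine this.trans (mul_le_mul_of_nonneg_right ?_ dist_nonneg)
    nlinarith [abs_nonneg t]
  · intro x hx t ht
    have := hbox.speed_zero (hsub x hx) (t := t) (by linarith)
    nlinarith [abs_nonneg t]
  · intro x hx s t hs ht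
    have := hbox.e2 x (hsub x hx) s t (by linarith) (by linarith)
    have h5 : 0 ≤ |s| * |t| := by positivity
    nlinarith
  · intro x hx y hy t ht
    refine ((est x hx t ht).2.2 y hy).trans (mul_le_mul_of_nonneg_right ?_ dist_nonneg)
    nlinarith [abs_nonneg t]
  · intro x hx t ht
    have := (est x hx t ht).2.1
    nlinarith [abs_nonneg t]
  · intro x hx s t hs _ hst
    exact h.add (est x hx s hs).1 (est x hx (s + t) hst).1
  · intro x hx t ht
    have := hn x (ball_subset_ball hrr1 hx) t (by linarith) (est x hx t ht).1
    rw [sq_abs]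
    nlinarith [sq_nonneg t]

theorem FlowBox.mono {X F : M → ℝ → M} {z z' : M} {r r' K K' : ℝ} (h : FlowBox X F z r K)
    (hr : 0 < r') (hz : dist z' z + r' ≤ r) (hK : K ≤ K') : FlowBox X F z' r' K' := by
  have hd : 0 ≤ dist z' z := dist_nonneg
  have hs : ∀ x ∈ ball z' r', x ∈ ball z r := fun x hx =>
    ball_subset_ball' (by linarith) hx
  have hr' : r' ≤ r := by linarith
  refine ⟨hr, hr'.trans h.r_le, h.K_pos.trans_le hK, ?_, ?_, ?_, h.flow_zero, ?_, ?_, ?_, ?_⟩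
  · intro x hx y hy t ht
    exact (h.arc_lip x (hs x hx) y (hs y hy) t (by linarith)).trans (by gcongr)
  · intro x hx t ht
    exact (h.arc_speed x (hs x hx) t (by linarith)).trans (by gcongr)
  · intro x hx s t hs' ht
    exact (h.arc_add x (hs x hx) s t (by linarith) (by linarith)).trans (by gcongr)
  · intro x hx y hy t ht
    exact (h.flow_lip x (hs x hx) y (hs y hy) t (by linarith)).trans (by gcongr)
  · intro x hx t ht
    exact (h.flow_speed x (hs x hx) t (by linarith)).trans (by gcongr)
  · intro x hx s t hs' ht hst
    exact h.flow_add x (hs x hx) s t (by linarith) (by linarith) (by linarith)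
  · intro x hx t ht
    exact (h.near x (hs x hx) t (by linarith)).trans (by gcongr)

theorem FlowBox.flow_dist {X F : M → ℝ → M} {z : M} {r K : ℝ} (h : FlowBox X F z r K) {x : M}
    (hx : x ∈ ball z r) {t : ℝ} (ht : |t| < r) : dist (F x t) z ≤ dist x z + K * |t| := by
  have := h.flow_speed x hx t ht
  have := dist_triangle (F x t) x z
  linarith

theorem FlowBox.arc_dist {X F : M → ℝ → M} {z : M} {r K : ℝ} (h : FlowBox X F z r K) {x : M}
    (hx : x ∈ ball z r) {t : ℝ} (ht : |t| < r) : dist (X x t) z ≤ dist x z + K * |t| := by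
  have := h.arc_speed x hx t ht
  have := dist_triangle (X x t) x z
  linarith

theorem flow_close_of_le {X Y F G : M → ℝ → M} {z : M} {r K : ℝ} (hf : FlowBox X F z r K)
    (hg : FlowBox Y G z r K)
    (hc : ∀ x ∈ ball z r, ∀ s t : ℝ, |s| < r → |t| < r →
      dist (Y (X x t) s) (X (Y x s) t) ≤ K * (|s| * |t|))
    {x : M} {s t : ℝ} (hst : |s| ≤ |t|) (ht : |t| < r) (hx : dist x z + K * |t| < r)
    (hKt : K * |t| ≤ 1) : dist (G (F x t) s) (F (G x s) t) ≤ 7 * K * |t| ^ 2 := by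
  have hK := hf.K_pos
  have h0 := abs_nonneg s
  have h1 := abs_nonneg t
  have hs : |s| < r := hst.trans_lt ht
  have hKt0 : 0 ≤ K * |t| := by positivity
  have hKs : K * |s| ≤ K * |t| := by gcongr
  have hxr : x ∈ ball z r := by rw [mem_ball]; linarith
  have m1 : F x t ∈ ball z r := by rw [mem_ball]; linarith [hf.flow_dist hxr ht]
  have m2 : X x t ∈ ball z r := by rw [mem_ball]; linarith [hf.arc_dist hxr ht]
  have m3 : G x s ∈ ball z r := by rw [mem_ball]; linarith [hg.flow_dist hxr hs]
  have m4 : Y x s ∈ ball z r := by rw [mem_ball]; linarith [hg.arc_dist hxr hs]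
  have d1 := hg.near _ m1 s hs
  have d2 := hg.arc_lip _ m1 _ m2 s hs
  have d2' := hf.near _ hxr t ht
  have d3 := hc _ hxr s t hs ht
  have d4 := hf.near _ m4 t ht
  have d5 := hf.flow_lip _ m4 _ m3 t ht
  have d5' := hg.near _ hxr s hs
  have e1 : K * |s| ^ 2 ≤ K * |t| ^ 2 := by gcongr
  have e2 : K * (|s| * |t|) ≤ K * |t| ^ 2 := by
    rw [sq]; gcongr
  have e3 : (1 + K * |s|) * dist (F x t) (X x t) ≤ 2 * (K * |t| ^ 2) := by
    rw [dist_comm (F x t)]; gcongr; linarith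
  have e4 : (1 + K * |t|) * dist (Y x s) (G x s) ≤ 2 * (K * |t| ^ 2) := by
    gcongr
    · linarith
    · linarith
  have t1 := dist_triangle4 (G (F x t) s) (Y (F x t) s) (Y (X x t) s) (F (G x s) t)
  have t2 := dist_triangle4 (Y (X x t) s) (X (Y x s) t) (F (Y x s) t) (F (G x s) t)
  rw [dist_comm (G (F x t) s) (Y (F x t) s)] at t1
  linarith

theorem flow_close_iterate {X Y F G : M → ℝ → M} {z : M} {r K : ℝ} (hf : FlowBox X F z r K)
    (hg : FlowBox Y G z r K)
    (hc : ∀ x ∈ ball z r, ∀ s t : ℝ, |s| < r → |t| < r →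
      dist (Y (X x t) s) (X (Y x s) t) ≤ K * (|s| * |t|))
    {s t : ℝ} (hst : |s| ≤ |t|) (ht : |t| < r)
    (hKt : K * |t| ≤ 1) (n : ℕ) : ∀ x : M, n * |s| < r → K * (n * |s|) ≤ 1 →
      dist x z + K * (n * |s|) + K * |t| < r →
      dist (G (F x t) (n * s)) (F (G x (n * s)) t) ≤ n * (14 * K * |t| ^ 2) := by
  have hK := hf.K_pos
  have h0 := abs_nonneg s
  have h1 := abs_nonneg t
  have hs : |s| < r := hst.trans_lt ht
  induction n with
  | zero => intro x; simp [hg.flow_zero]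
  | succ n ih =>
    intro x hnr hnK hx
    push_cast at hnr hnK hx ⊢
    have hn0 : 0 ≤ (n : ℝ) * |s| := by positivity
    have hKn : 0 ≤ K * (n * |s|) := by positivity
    have hKs : 0 ≤ K * |s| := by positivity
    have hKt0 : 0 ≤ K * |t| := by positivity
    have hns : |(n : ℝ) * s| = n * |s| := by rw [abs_mul, Nat.abs_cast]
    have hn1 : |s + (n : ℝ) * s| = (n + 1) * |s| := by
      rw [show s + (n : ℝ) * s = ((n + 1 : ℕ) : ℝ) * s by push_cast; ring, abs_mul, Nat.abs_cast]
      push_cast; ring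
    have hxr : x ∈ ball z r := by rw [mem_ball]; linarith
    have n1 := hf.flow_dist hxr ht
    have n2 := hg.flow_dist hxr hs
    have m1 : F x t ∈ ball z r := by rw [mem_ball]; linarith
    have m2 : G x s ∈ ball z r := by rw [mem_ball]; linarith
    have m3 : G (F x t) s ∈ ball z r := by rw [mem_ball]; linarith [hg.flow_dist m1 hs]
    have m4 : F (G x s) t ∈ ball z r := by rw [mem_ball]; linarith [hf.flow_dist m2 ht]
    have d1 := flow_close_of_le hf hg hc hst ht (x := x) (by linarith) hKt
    have d2 := hg.flow_lip _ m3 _ m4 (n * s) (by rw [hns]; linarith)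
    have d3 := ih (G x s) (by linarith) (by linarith) (by linarith)
    rw [show ((n : ℝ) + 1) * s = s + n * s by ring,
      hg.flow_add _ m1 s (n * s) hs (by rw [hns]; linarith) (by rw [hn1]; linarith),
      hg.flow_add _ hxr s (n * s) hs (by rw [hns]; linarith) (by rw [hn1]; linarith)]
    have d4 : (1 + K * |(n : ℝ) * s|) * dist (G (F x t) s) (F (G x s) t) ≤
        2 * (7 * K * |t| ^ 2) := by
      gcongr
      rw [hns]; linarith
    have := dist_triangle (G (G (F x t) s) (n * s)) (G (F (G x s) t) (n * s))
      (F (G (G x s) (n * s)) t)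
    linarith

theorem flow_close_of_ge {X Y F G : M → ℝ → M} {z : M} {r K : ℝ} (hf : FlowBox X F z r K)
    (hg : FlowBox Y G z r K)
    (hc : ∀ x ∈ ball z r, ∀ s t : ℝ, |s| < r → |t| < r →
      dist (Y (X x t) s) (X (Y x s) t) ≤ K * (|s| * |t|))
    {s t : ℝ} {x : M} (hts : |t| ≤ |s|) (hs : |s| < r) (hKs : K * |s| ≤ 1)
    (hx : dist x z + K * |s| + K * |t| < r) :
    dist (G (F x t) s) (F (G x s) t) ≤ 28 * K * (|s| * |t|) := by
  have hK := hf.K_pos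
  rcases eq_or_ne t 0 with rfl | ht0
  · simp [hf.flow_zero]
  have ht : 0 < |t| := abs_pos.2 ht0
  have hKt : K * |t| ≤ K * |s| := by gcongr
  set n := ⌈|s| / |t|⌉₊ with hn
  have hs0 : 0 < |s| := ht.trans_le hts
  have h1 : |s| / |t| ≤ n := Nat.le_ceil _
  have h2 : (n : ℝ) < |s| / |t| + 1 := Nat.ceil_lt_add_one (by positivity)
  have h3 : 1 ≤ |s| / |t| := (one_le_div ht).2 hts
  have hnpos : (0 : ℝ) < n := by linarith
  have hσ : |s / n| ≤ |t| := by
    rw [abs_div, Nat.abs_cast, div_le_iff₀ hnpos]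
    rwa [div_le_iff₀ ht, mul_comm] at h1
  have hnσ : (n : ℝ) * |s / n| = |s| := by
    rw [abs_div, Nat.abs_cast]; field_simp
  have hns : (n : ℝ) * (s / n) = s := by field_simp
  have := flow_close_iterate hf hg hc hσ (by linarith) (by linarith) n x (by rwa [hnσ])
    (by rwa [hnσ]) (by rwa [hnσ])
  rw [hns] at this
  refine this.trans ?_
  have h4 : (n : ℝ) * |t| ≤ 2 * |s| := by
    have : (n : ℝ) ≤ 2 * (|s| / |t|) := by linarith
    calc (n : ℝ) * |t| ≤ 2 * (|s| / |t|) * |t| := by gcongr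
      _ = 2 * |s| := by field_simp
  calc (n : ℝ) * (14 * K * |t| ^ 2) = 14 * K * |t| * (n * |t|) := by ring
    _ ≤ 14 * K * |t| * (2 * |s|) := by gcongr
    _ = _ := by ring

theorem exists_flow_close {X Y F G : M → ℝ → M} {z : M} {r K : ℝ} (hf : FlowBox X F z r K)
    (hg : FlowBox Y G z r K)
    (hc : ∀ x ∈ ball z r, ∀ s t : ℝ, |s| < r → |t| < r →
      dist (Y (X x t) s) (X (Y x s) t) ≤ K * (|s| * |t|)) :
    ∃ r' > 0, ∀ x ∈ ball z r', ∀ s t : ℝ, |s| < r' → |t| < r' →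
      dist (G (F x t) s) (F (G x s) t) ≤ 28 * K * (|s| * |t|) := by
  have hK := hf.K_pos
  have hr := hf.r_pos
  have hr1 := hf.r_le
  refine ⟨r / (4 * (K + 1)), by positivity, fun x hx s t hs ht => ?_⟩
  rw [mem_ball, lt_div_iff₀ (by positivity)] at hx
  rw [lt_div_iff₀ (by positivity)] at hs ht
  have hd : 0 ≤ dist x z := dist_nonneg
  have h0 := abs_nonneg s
  have h1 := abs_nonneg t
  have h2 : 0 ≤ K * |s| := by positivity
  have h3 : 0 ≤ K * |t| := by positivity
  have h4 : 0 ≤ K * dist x z := by positivity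
  rcases le_total |t| |s| with h | h
  · exact flow_close_of_ge hf hg hc h (by linarith) (by linarith) (by linarith)
  · have := flow_close_of_ge hg hf (fun x hx s t hs ht => by
      rw [dist_comm, mul_comm |s|]; exact hc x hx t s ht hs) (x := x) h (by linarith)
      (by linarith) (by linarith)
    rwa [dist_comm, mul_comm |t|] at this

/-- `p` is reached from `x` up to `ε * η ^ 2` by a composition of flows with times at most
`B * η ^ 2`. -/
def NearFlows (F G : M → ℝ → M) (B e η : ℝ) (p x : M) : Prop :=
  ∃ α β : ℝ, |α| ≤ B * η ^ 2 ∧ |β| ≤ B * η ^ 2 ∧ dist p (F (G x β) α) ≤ e * η ^ 2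

/-- Uniform local estimates for a pair of arc fields and their flows. -/
structure PairBox (X Y F G : M → ℝ → M) (z : M) (r K : ℝ) : Prop where
  fst : FlowBox X F z r K
  snd : FlowBox Y G z r K
  close_arc : ∀ x ∈ ball z r, ∀ s t : ℝ, |s| < r → |t| < r →
    dist (Y (X x t) s) (X (Y x s) t) ≤ K * (|s| * |t|)
  close_flow : ∀ x ∈ ball z r, ∀ s t : ℝ, |s| < r → |t| < r →
    dist (G (F x t) s) (F (G x s) t) ≤ K * (|s| * |t|)
  brk_pos : ∀ ε > 0, ∃ δ > 0, ∀ x ∈ ball z r, ∀ η, 0 < η → η < δ →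
    NearFlows F G K ε η (Y (X (Y (X x η) η) (-η)) (-η)) x
  brk_neg : ∀ ε > 0, ∃ δ > 0, ∀ x ∈ ball z r, ∀ η, 0 < η → η < δ →
    NearFlows F G K ε η (X (Y (X (Y x η) η) (-η)) (-η)) x

theorem lipschitz_locally_bounded {a : M → ℝ} (ha : ∃ K, LipschitzWith K a) (x₀ : M) :
    ∃ A > 0, ∀ x ∈ ball x₀ 1, |a x| ≤ A := by
  obtain ⟨L, hL⟩ := ha
  refine ⟨|a x₀| + L + 1, by positivity, fun x hx => ?_⟩
  have h1 := hL.dist_le_mul x x₀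
  rw [mem_ball] at hx
  have h2 : (L : ℝ) * dist x x₀ ≤ L * 1 := by gcongr
  rw [Real.dist_eq] at h1
  have := abs_sub_abs_le_abs_sub (a x) (a x₀)
  linarith

theorem flows_near_arcs {X Y F G : M → ℝ → M} {z : M} {r K A η : ℝ} (hf : FlowBox X F z r K)
    (hg : FlowBox Y G z r K)
    (hc : ∀ x ∈ ball z r, ∀ s t : ℝ, |s| < r → |t| < r →
      dist (G (F x t) s) (F (G x s) t) ≤ K * (|s| * |t|))
    {x : M} (hx : x ∈ ball z (r / 2)) (hA : 0 < A) (hη : A * η ^ 2 < r)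
    (hη' : K * (A * η ^ 2) ≤ r / 2) {α β : ℝ} (hα : |α| ≤ A * η ^ 2) (hβ : |β| ≤ A * η ^ 2) :
    dist (Y (X x α) β) (F (G x β) α) ≤ 4 * K * (A * η ^ 2) ^ 2 := by
  have hK := hf.K_pos
  have hr := hf.r_pos
  have hr1 := hf.r_le
  rw [mem_ball] at hx
  have hxr : x ∈ ball z r := by rw [mem_ball]; linarith
  set m := A * η ^ 2
  have hm : 0 ≤ m := by positivity
  have h1 : K * |α| ≤ K * m := by gcongr
  have m1 : X x α ∈ ball z r := by rw [mem_ball]; linarith [hf.arc_dist hxr (t := α) (by linarith)]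
  have m2 : F x α ∈ ball z r := by rw [mem_ball]; linarith [hf.flow_dist hxr (t := α) (by linarith)]
  have d1 := hg.near _ m1 β (by linarith)
  have d2 := hg.flow_lip _ m1 _ m2 β (by linarith)
  have d3 := hf.near _ hxr α (by linarith)
  have d4 := hc _ hxr β α (by linarith) (by linarith)
  have e1 : K * |β| ^ 2 ≤ K * m ^ 2 := by gcongr
  have e2 : (1 + K * |β|) * dist (X x α) (F x α) ≤ 2 * (K * m ^ 2) := by
    gcongr
    · have : K * |β| ≤ K * m := by gcongr
      linarith
    · exact d3.trans (by gcongr)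
  have e3 : K * (|β| * |α|) ≤ K * m ^ 2 := by rw [sq]; gcongr
  have := dist_triangle4 (Y (X x α) β) (G (X x α) β) (G (F x α) β) (F (G x β) α)
  linarith

theorem exists_pos_quadratic_lt {A c : ℝ} (hA : 0 < A) (hc : 0 < c) :
    ∃ δ > 0, ∀ η, 0 ≤ η → η < δ → A * η ^ 2 < c := by
  refine ⟨min 1 (c / A), by positivity, fun η h0 h => ?_⟩
  obtain ⟨h1, h2⟩ := lt_min_iff.1 h
  rw [lt_div_iff₀ hA] at h2
  nlinarith

theorem exists_pairBox (hM : LocallyComplete M) {X Y : M → ℝ → M}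
    (hX : IsArcField X) (hY : IsArcField Y) (hclose : Close X Y)
    (hXE1 : CondE1 X) (hXE2 : CondE2 X) (hYE1 : CondE1 Y) (hYE2 : CondE2 Y)
    {IX IY : M → Set ℝ} {F G : M → ℝ → M}
    (hF : IsLocalFlow X IX F) (hG : IsLocalFlow Y IY G)
    (hXF : ∀ x₀ : M, ∃ C > (0 : ℝ), ∃ r > (0 : ℝ), ∃ δ > (0 : ℝ),
      ∀ x ∈ Metric.ball x₀ r, ∀ t : ℝ, |t| < δ → t ∈ IX x →
        dist (X x t) (F x t) ≤ C * t ^ 2)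
    (hYG : ∀ x₀ : M, ∃ C > (0 : ℝ), ∃ r > (0 : ℝ), ∃ δ > (0 : ℝ),
      ∀ x ∈ Metric.ball x₀ r, ∀ t : ℝ, |t| < δ → t ∈ IY x →
        dist (Y x t) (G x t) ≤ C * t ^ 2)
    {a b : M → ℝ} (ha : ∃ K, LipschitzWith K a) (hb : ∃ K, LipschitzWith K b)
    (hbr : LocUnifTangent (bracket X Y) (sumArc (smulArc a X) (smulArc b Y))) (x₀ : M) :
    ∃ r K, PairBox X Y F G x₀ r K := by
  obtain ⟨r1, K1, hf⟩ := exists_flowBox hM hX hXE1 hXE2 hF hXF x₀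
  obtain ⟨r2, K2, hg⟩ := exists_flowBox hM hY hYE1 hYE2 hG hYG x₀
  obtain ⟨C, hC, r3, hr3, d3, hd3, hc⟩ := hclose x₀
  obtain ⟨A1, hA1, ha⟩ := lipschitz_locally_bounded ha x₀
  obtain ⟨A2, hA2, hb⟩ := lipschitz_locally_bounded hb x₀
  obtain ⟨r4, hr4, hbr⟩ := hbr x₀
  have hr1 := hf.r_pos
  have hr2 := hg.r_pos
  have hK1 := hf.K_pos
  have hK2 := hg.K_pos
  set K := K1 + K2 + C with hKdef
  have hK : 0 < K := by positivity
  set R := min (min r1 r2) (min r3 d3) with hRdef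
  have hR : 0 < R := by positivity
  have hRr1 : R ≤ r1 := (min_le_left _ _).trans (min_le_left _ _)
  have hRr2 : R ≤ r2 := (min_le_left _ _).trans (min_le_right _ _)
  have hRr3 : R ≤ r3 := (min_le_right _ _).trans (min_le_left _ _)
  have hRd3 : R ≤ d3 := (min_le_right _ _).trans (min_le_right _ _)
  have hf := hf.mono (r' := R) (K' := K) (z' := x₀) hR (by simpa using hRr1) (by linarith)
  have hg := hg.mono (r' := R) (K' := K) (z' := x₀) hR (by simpa using hRr2) (by linarith)
  have hc : ∀ x ∈ ball x₀ R, ∀ s t : ℝ, |s| < R → |t| < R →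
      dist (Y (X x t) s) (X (Y x s) t) ≤ K * (|s| * |t|) := by
    intro x hx s t hs ht
    have := hc x (ball_subset_ball hRr3 hx) s t (by linarith) (by linarith)
    rw [abs_mul] at this
    exact this.trans (by gcongr; linarith)
  obtain ⟨r5, hr5, hcf⟩ := exists_flow_close hf hg hc
  set R' := min R r5
  have hR' : 0 < R' := by positivity
  have hR'R : R' ≤ R := min_le_left _ _
  have hR'5 : R' ≤ r5 := min_le_right _ _
  have hf := hf.mono (r' := R') (K' := 28 * K) (z' := x₀) hR' (by simpa using hR'R) (by linarith)
  have hg := hg.mono (r' := R') (K' := 28 * K) (z' := x₀) hR' (by simpa using hR'R) (by linarith)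
  have hcf : ∀ x ∈ ball x₀ R', ∀ s t : ℝ, |s| < R' → |t| < R' →
      dist (G (F x t) s) (F (G x s) t) ≤ 28 * K * (|s| * |t|) := fun x hx s t hs ht =>
    hcf x (ball_subset_ball hR'5 hx) s t (by linarith) (by linarith)
  set A := A1 + A2
  have hA : 0 < A := by positivity
  set r := min (R' / 2) r4
  have hr : 0 < r := by positivity
  have hrR : r ≤ R' / 2 := min_le_left _ _
  have hrr4 : r ≤ r4 := min_le_right _ _
  have hR'1 := hf.r_le
  have hbrk : ∀ ε > 0, ∃ δ > 0, ∀ x ∈ ball x₀ r, ∀ t η, 0 < η → η < δ → |t| = η ^ 2 →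
      NearFlows F G A ε η (bracket X Y x t) x := by
    intro ε hε
    obtain ⟨δ, hδ, h1⟩ := hbr (ε / 2) (by positivity)
    obtain ⟨δ1, hδ1, q1⟩ := exists_pos_quadratic_lt (A := 1) one_pos hδ
    obtain ⟨δ2, hδ2, q2⟩ := exists_pos_quadratic_lt (A := A) hA
      (show 0 < R' / (4 * (28 * K + 1)) by positivity)
    obtain ⟨δ3, hδ3, q3⟩ := exists_pos_quadratic_lt (A := 4 * (28 * K) * A ^ 2)
      (c := ε / 2) (by positivity) (by positivity)
    refine ⟨min δ1 (min δ2 δ3), by positivity, fun x hx t η hη hηδ ht => ?_⟩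
    simp only [lt_min_iff] at hηδ
    have q1 := q1 η hη.le hηδ.1
    have q2 := q2 η hη.le hηδ.2.1
    have q3 := q3 η hη.le hηδ.2.2
    rw [lt_div_iff₀ (by positivity)] at q2
    have hηpos : 0 < η ^ 2 := by positivity
    have hm : 0 < A * η ^ 2 := by positivity
    have hmK : 0 < A * η ^ 2 * K := by positivity
    have h2 := h1 x (ball_subset_ball hrr4 hx) t (by rw [ht]; positivity) (by rw [ht]; linarith)
    have hxR : x ∈ ball x₀ (R' / 2) := ball_subset_ball hrR hx
    have hx1 : x ∈ ball x₀ 1 := ball_subset_ball (by linarith) hx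
    have clamp : ∀ u : ℝ, |u| ≤ 1 → max (-1) (min 1 u) = u := fun u hu => by
      rw [min_eq_right (abs_le.1 hu).2, max_eq_right (abs_le.1 hu).1]
    have hα : |a x * t| ≤ A * η ^ 2 := by
      rw [abs_mul, ht]
      have := ha x hx1
      gcongr; linarith
    have hXd : X x (a x * t) ∈ ball x₀ 1 := by
      have := hf.arc_dist (ball_subset_ball (by linarith) hxR) (t := a x * t) (by linarith)
      have h5 : 28 * K * |a x * t| ≤ 28 * K * (A * η ^ 2) := by gcongr
      rw [mem_ball] at hxR ⊢
      linarith
    have hβ : |b (X x (a x * t)) * t| ≤ A * η ^ 2 := by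
      rw [abs_mul, ht]
      have := hb _ hXd
      gcongr; linarith
    refine ⟨a x * t, b (X x (a x * t)) * t, hα, hβ, ?_⟩
    have h3 := flows_near_arcs hf hg hcf hxR hA (by linarith) (by linarith) hα hβ
    have h4 : sumArc (smulArc a X) (smulArc b Y) x t
        = Y (X x (a x * t)) (b (X x (a x * t)) * t) := by
      simp only [sumArc, smulArc]
      rw [clamp (a x * t) (by linarith), clamp _ (by linarith)]
    rw [h4, ht] at h2
    have h6 : 4 * (28 * K) * (A * η ^ 2) ^ 2 ≤ ε / 2 * η ^ 2 := by
      calc 4 * (28 * K) * (A * η ^ 2) ^ 2 = 4 * (28 * K) * A ^ 2 * η ^ 2 * η ^ 2 := by ring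
        _ ≤ _ := by gcongr
    have := dist_triangle (bracket X Y x t) (Y (X x (a x * t)) (b (X x (a x * t)) * t))
      (F (G x (b (X x (a x * t)) * t)) (a x * t))
    linarith
  have hle : ∀ {e η : ℝ} {p x : M}, NearFlows F G A e η p x →
      NearFlows F G (28 * K + A) e η p x := by
    rintro e η p x ⟨α, β, h1, h2, h3⟩
    have : A * η ^ 2 ≤ (28 * K + A) * η ^ 2 := by gcongr; linarith
    exact ⟨α, β, h1.trans this, h2.trans this, h3⟩
  have hdr : dist x₀ x₀ + r ≤ R' := by rw [dist_self]; linarith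
  refine ⟨r, 28 * K + A, hf.mono hr hdr (by linarith), hg.mono hr hdr (by linarith), ?_, ?_, ?_, ?_⟩
  · intro x hx s t hs ht
    exact (hc x (ball_subset_ball (by linarith) hx) s t (by linarith) (by linarith)).trans
      (by gcongr; linarith)
  · intro x hx s t hs ht
    exact (hcf x (ball_subset_ball (by linarith) hx) s t (by linarith) (by linarith)).trans
      (by gcongr; linarith)
  · intro ε hε
    obtain ⟨δ, hδ, h⟩ := hbrk ε hε
    refine ⟨δ, hδ, fun x hx η h0 h1 => hle ?_⟩
    have := h x hx (η ^ 2) η h0 h1 (abs_of_nonneg (by positivity))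
    rwa [bracket, if_pos (by positivity), abs_of_nonneg (by positivity), Real.sqrt_sq h0.le] at this
  · intro ε hε
    obtain ⟨δ, hδ, h⟩ := hbrk ε hε
    refine ⟨δ, hδ, fun x hx η h0 h1 => hle ?_⟩
    have := h x hx (-η ^ 2) η h0 h1 (by rw [abs_neg, abs_of_nonneg (by positivity)])
    have hp : 0 < η ^ 2 := by positivity
    rwa [bracket, if_neg (by linarith), abs_neg, abs_of_nonneg (by positivity),
      Real.sqrt_sq h0.le] at this

theorem PairBox.mono {X Y F G : M → ℝ → M} {z z' : M} {r r' K : ℝ} (h : PairBox X Y F G z r K)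
    (hr : 0 < r') (hz : dist z' z + r' ≤ r) : PairBox X Y F G z' r' K := by
  have hd : 0 ≤ dist z' z := dist_nonneg
  have hs : ∀ x ∈ ball z' r', x ∈ ball z r := fun x hx => ball_subset_ball' (by linarith) hx
  refine ⟨h.fst.mono hr hz le_rfl, h.snd.mono hr hz le_rfl, ?_, ?_, ?_, ?_⟩
  · exact fun x hx s t h1 h2 => h.close_arc x (hs x hx) s t (by linarith) (by linarith)
  · exact fun x hx s t h1 h2 => h.close_flow x (hs x hx) s t (by linarith) (by linarith)
  · intro ε hε
    obtain ⟨δ, hδ, h1⟩ := h.brk_pos ε hε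
    exact ⟨δ, hδ, fun x hx => h1 x (hs x hx)⟩
  · intro ε hε
    obtain ⟨δ, hδ, h1⟩ := h.brk_neg ε hε
    exact ⟨δ, hδ, fun x hx => h1 x (hs x hx)⟩

theorem PairBox.nearFlows_swap {X Y F G : M → ℝ → M} {z : M} {r K : ℝ}
    (h : PairBox X Y F G z r K) {ε : ℝ} (hε : 0 < ε) : ∃ δ > 0, ∀ x ∈ ball z r, ∀ p : M,
    ∀ η, 0 < η → η < δ → NearFlows F G K (ε / 2) η p x → NearFlows G F K ε η p x := by
  have hK := h.fst.K_pos
  obtain ⟨δ1, hδ1, q1⟩ := exists_pos_quadratic_lt hK h.fst.r_pos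
  obtain ⟨δ2, hδ2, q2⟩ := exists_pos_quadratic_lt (A := K * K ^ 2) (c := ε / 2)
    (by positivity) (by positivity)
  refine ⟨min δ1 δ2, by positivity, ?_⟩
  rintro x hx p η h0 h1 ⟨α, β, hα, hβ, hd⟩
  obtain ⟨h1, h2⟩ := lt_min_iff.1 h1
  have q1 := q1 η h0.le h1
  have q2 := q2 η h0.le h2
  refine ⟨β, α, hβ, hα, ?_⟩
  have d1 := h.close_flow x hx β α (by linarith) (by linarith)
  have d2 : K * (|β| * |α|) ≤ ε / 2 * η ^ 2 := by
    calc K * (|β| * |α|) ≤ K * ((K * η ^ 2) * (K * η ^ 2)) := by gcongr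
      _ = K * K ^ 2 * η ^ 2 * η ^ 2 := by ring
      _ ≤ _ := by gcongr
  have := dist_triangle_right p (G (F x α) β) (F (G x β) α)
  linarith

theorem PairBox.symm {X Y F G : M → ℝ → M} {z : M} {r K : ℝ} (h : PairBox X Y F G z r K) :
    PairBox Y X G F z r K := by
  refine ⟨h.snd, h.fst, ?_, ?_, ?_, ?_⟩
  · intro x hx s t hs ht
    rw [dist_comm, mul_comm |s|]
    exact h.close_arc x hx t s ht hs
  · intro x hx s t hs ht
    rw [dist_comm, mul_comm |s|]
    exact h.close_flow x hx t s ht hs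
  · intro ε hε
    obtain ⟨δ, hδ, h1⟩ := h.brk_neg (ε / 2) (by positivity)
    obtain ⟨δ', hδ', h2⟩ := h.nearFlows_swap hε
    exact ⟨min δ δ', by positivity, fun x hx η h3 h4 => h2 x hx _ η h3 (lt_min_iff.1 h4).2
      (h1 x hx η h3 (lt_min_iff.1 h4).1)⟩
  · intro ε hε
    obtain ⟨δ, hδ, h1⟩ := h.brk_pos (ε / 2) (by positivity)
    obtain ⟨δ', hδ', h2⟩ := h.nearFlows_swap hε
    exact ⟨min δ δ', by positivity, fun x hx η h3 h4 => h2 x hx _ η h3 (lt_min_iff.1 h4).2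
      (h1 x hx η h3 (lt_min_iff.1 h4).1)⟩

theorem NearFlows.mono {F G : M → ℝ → M} {B B' e e' η : ℝ} {p x : M}
    (h : NearFlows F G B e η p x) (hB : B ≤ B') (he : e ≤ e') : NearFlows F G B' e' η p x := by
  obtain ⟨α, β, h1, h2, h3⟩ := h
  have hB : B * η ^ 2 ≤ B' * η ^ 2 := by gcongr
  have he : e * η ^ 2 ≤ e' * η ^ 2 := by gcongr
  exact ⟨α, β, h1.trans hB, h2.trans hB, h3.trans he⟩

theorem abs_le_of_le_mul_sq {B η α : ℝ} (hη : 0 < η) (hB : B * η ≤ 1) (h : |α| ≤ B * η ^ 2) :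
    |α| ≤ η := by nlinarith

section PairBoxCalculus

variable {X Y F G : M → ℝ → M} {z : M} {r K : ℝ}

theorem PairBox.dist_two (h : PairBox X Y F G z r K) {x y : M} {η α β : ℝ}
    (hx : dist x z + K * η < r) (hy : dist y z + K * η < r) (hηr : η < r) (hα : |α| ≤ η)
    (hβ : |β| ≤ η) :
    dist (F (G x β) α) (F (G y β) α) ≤ (1 + K * η) ^ 2 * dist x y := by
  have hK := h.fst.K_pos
  have hη : 0 ≤ η := (abs_nonneg _).trans hα
  have hKη : 0 ≤ K * η := by positivity
  have hKβ : K * |β| ≤ K * η := by gcongr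
  have mx : x ∈ ball z r := by rw [mem_ball]; linarith
  have my : y ∈ ball z r := by rw [mem_ball]; linarith
  have m1 : G x β ∈ ball z r := by
    rw [mem_ball]; linarith [h.snd.flow_dist mx (t := β) (by linarith)]
  have m2 : G y β ∈ ball z r := by
    rw [mem_ball]; linarith [h.snd.flow_dist my (t := β) (by linarith)]
  calc dist (F (G x β) α) (F (G y β) α) ≤ (1 + K * |α|) * dist (G x β) (G y β) :=
        h.fst.flow_lip _ m1 _ m2 α (by linarith)
    _ ≤ (1 + K * |α|) * ((1 + K * |β|) * dist x y) := by
        gcongr; exact h.snd.flow_lip _ mx _ my β (by linarith)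
    _ ≤ (1 + K * η) * ((1 + K * η) * dist x y) := by gcongr
    _ = _ := by ring

theorem PairBox.dist_flows_le (h : PairBox X Y F G z r K) {x : M} {η α β : ℝ}
    (hx : dist x z + K * η < r) (hηr : η < r) (hα : |α| ≤ η)
    (hβ : |β| ≤ η) : dist (F (G x β) α) z ≤ dist x z + 2 * K * η := by
  have hK := h.fst.K_pos
  have hη : 0 ≤ η := (abs_nonneg _).trans hα
  have hKη : 0 ≤ K * η := by positivity
  have hKβ : K * |β| ≤ K * η := by gcongr
  have hKα : K * |α| ≤ K * η := by gcongr
  have mx : x ∈ ball z r := by rw [mem_ball]; linarith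
  have d1 := h.snd.flow_dist mx (t := β) (by linarith)
  have m1 : G x β ∈ ball z r := by rw [mem_ball]; linarith
  have := h.fst.flow_dist m1 (t := α) (by linarith)
  linarith

theorem PairBox.flows_add (h : PairBox X Y F G z r K) {x : M} {η α β α' β' : ℝ}
    (hx : dist x z + 4 * K * η < r) (hηr : 2 * η < r) (hα : |α| ≤ η)
    (hβ : |β| ≤ η) (hα' : |α'| ≤ η) (hβ' : |β'| ≤ η) :
    dist (F (G (F (G x β') α') β) α) (F (G x (β + β')) (α + α')) ≤
      (1 + K * η) * (K * (|β| * |α'|)) := by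
  have hK := h.fst.K_pos
  have hη : 0 ≤ η := (abs_nonneg _).trans hα
  have hKη : 0 ≤ K * η := by positivity
  have hKβ : K * |β| ≤ K * η := by gcongr
  have hKβ' : K * |β'| ≤ K * η := by gcongr
  have hKα' : K * |α'| ≤ K * η := by gcongr
  have mx : x ∈ ball z r := by rw [mem_ball]; linarith
  have d1 := h.snd.flow_dist mx (t := β') (by linarith)
  have m1 : G x β' ∈ ball z r := by rw [mem_ball]; linarith
  have d2 := h.fst.flow_dist m1 (t := α') (by linarith)
  have m2 : F (G x β') α' ∈ ball z r := by rw [mem_ball]; linarith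
  have d3 := h.snd.flow_dist m2 (t := β) (by linarith)
  have m3 : G (F (G x β') α') β ∈ ball z r := by rw [mem_ball]; linarith
  have d4 := h.snd.flow_dist m1 (t := β) (by linarith)
  have m4 : G (G x β') β ∈ ball z r := by rw [mem_ball]; linarith
  have d5 := h.fst.flow_dist m4 (t := α') (by linarith)
  have m5 : F (G (G x β') β) α' ∈ ball z r := by rw [mem_ball]; linarith
  have hββ : |β' + β| < r := (abs_add_le _ _).trans_lt (by linarith)
  have hαα : |α' + α| < r := (abs_add_le _ _).trans_lt (by linarith)
  rw [add_comm β, add_comm α, h.snd.flow_add _ mx β' β (by linarith) (by linarith) hββ,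
    h.fst.flow_add _ m4 α' α (by linarith) (by linarith) hαα]
  calc _ ≤ (1 + K * |α|) * dist (G (F (G x β') α') β) (F (G (G x β') β) α') :=
        h.fst.flow_lip _ m3 _ m5 α (by linarith)
    _ ≤ (1 + K * η) * (K * (|β| * |α'|)) := by
        gcongr
        exact h.close_flow _ m1 β α' (by linarith) (by linarith)

theorem PairBox.nearFlows_trans (h : PairBox X Y F G z r K) {p q y : M} {η B B' e e' : ℝ}
    (hη : 0 < η) (hB : 0 ≤ B) (hB' : 0 ≤ B') (hBη : (B + B') * η ≤ 1) (hηr : 2 * η < r)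
    (hKη : K * η ≤ 1) (hq : dist q z + 4 * K * η < r) (hy : dist y z + 4 * K * η < r)
    (h1 : NearFlows F G B e η p q) (h2 : NearFlows F G B' e' η q y) :
    NearFlows F G (B + B') (e + (1 + K * η) ^ 2 * e' + 2 * K * B * B' * η ^ 2) η p y := by
  obtain ⟨α, β, hα, hβ, hd⟩ := h1
  obtain ⟨α', β', hα', hβ', hd'⟩ := h2
  have hK := h.fst.K_pos
  have hK0 : 0 ≤ K * η := by positivity
  have hBη0 : 0 ≤ B * η := by positivity
  have hBη0' : 0 ≤ B' * η := by positivity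
  have a1 := abs_le_of_le_mul_sq hη (by linarith) hα
  have a2 := abs_le_of_le_mul_sq hη (by linarith) hβ
  have a3 := abs_le_of_le_mul_sq hη (by linarith) hα'
  have a4 := abs_le_of_le_mul_sq hη (by linarith) hβ'
  refine ⟨α + α', β + β', (abs_add_le _ _).trans (by linarith), (abs_add_le _ _).trans
    (by linarith), ?_⟩
  have d0 := h.dist_flows_le (x := y) (α := α') (β := β') (η := η) (by linarith) (by linarith) a3 a4
  have d1 := h.dist_two (x := q) (y := F (G y β') α') (η := η) (α := α) (β := β) (by linarith)
    (by linarith) (by linarith) a1 a2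
  have d2 := h.flows_add (x := y) hy hηr a1 a2 a3 a4
  have d3 : (1 + K * η) ^ 2 * dist q (F (G y β') α') ≤ (1 + K * η) ^ 2 * (e' * η ^ 2) := by
    gcongr
  have d4 : (1 + K * η) * (K * (|β| * |α'|)) ≤ 2 * (K * ((B * η ^ 2) * (B' * η ^ 2))) := by
    gcongr; linarith
  have := dist_triangle4 p (F (G q β) α) (F (G (F (G y β') α') β) α)
    (F (G y (β + β')) (α + α'))
  calc _ ≤ _ := this
    _ ≤ e * η ^ 2 + (1 + K * η) ^ 2 * (e' * η ^ 2) + 2 * (K * ((B * η ^ 2) * (B' * η ^ 2))) := by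
      linarith
    _ = _ := by ring

theorem PairBox.nearFlows_symm (h : PairBox X Y F G z r K) {p q : M} {η B e : ℝ}
    (hη : 0 < η) (hB : 0 ≤ B) (hBη : B * η ≤ 1) (hηr : 2 * η < r)
    (hKη : K * η ≤ 1) (hp : dist p z + 4 * K * η < r) (hq : dist q z + 4 * K * η < r)
    (h1 : NearFlows F G B e η p q) :
    NearFlows F G B ((1 + K * η) ^ 2 * e + 2 * K * B * B * η ^ 2) η q p := by
  obtain ⟨α, β, hα, hβ, hd⟩ := h1
  have hK := h.fst.K_pos
  have hK0 : 0 ≤ K * η := by positivity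
  have a1 := abs_le_of_le_mul_sq hη (by linarith) hα
  have a2 := abs_le_of_le_mul_sq hη (by linarith) hβ
  have a1' : |-α| ≤ η := by rwa [abs_neg]
  have a2' : |-β| ≤ η := by rwa [abs_neg]
  refine ⟨-α, -β, by rwa [abs_neg], by rwa [abs_neg], ?_⟩
  have d0 := h.dist_flows_le (x := q) (α := α) (β := β) (η := η) (by linarith) (by linarith) a1 a2
  have d1 := h.dist_two (x := p) (y := F (G q β) α) (η := η) (α := -α) (β := -β) (by linarith)
    (by linarith) (by linarith) a1' a2'
  have d2 := h.flows_add (x := q) hq hηr a1' a2' a1 a2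
  rw [neg_add_cancel, neg_add_cancel, h.snd.flow_zero, h.fst.flow_zero, abs_neg] at d2
  have d3 : (1 + K * η) ^ 2 * dist p (F (G q β) α) ≤ (1 + K * η) ^ 2 * (e * η ^ 2) := by
    gcongr
  have d4 : (1 + K * η) * (K * (|β| * |α|)) ≤ 2 * (K * ((B * η ^ 2) * (B * η ^ 2))) := by
    gcongr; linarith
  have := dist_triangle_right q (F (G p (-β)) (-α)) (F (G (F (G q β) α) (-β)) (-α))
  rw [dist_comm (F (G (F (G q β) α) (-β)) (-α)) q] at d2
  calc _ ≤ _ := this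
    _ ≤ (1 + K * η) ^ 2 * (e * η ^ 2) + 2 * (K * ((B * η ^ 2) * (B * η ^ 2))) := by
      linarith
    _ = _ := by ring

/-- The filter of small positive parameters and points close to `z`. -/
def germ (z : M) : Filter (ℝ × M) := nhdsWithin (0 : ℝ) (Ioi 0) ×ˢ nhds z

theorem germ_pos (z : M) : ∀ᶠ p in germ z, 0 < p.1 :=
  Filter.Eventually.prod_inl self_mem_nhdsWithin _

theorem germ_of_continuous (z : M) {u : ℝ → ℝ} (hu : Continuous u) {c : ℝ} (hc : u 0 < c) :
    ∀ᶠ p in germ z, u p.1 < c := by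
  refine Filter.Eventually.prod_inl (p := fun h => u h < c) ?_ _
  have := (hu.tendsto 0).mono_left (nhdsWithin_le_nhds (s := Ioi (0 : ℝ)))
  exact this.eventually_lt_const hc

theorem germ_lt (z : M) {c : ℝ} (hc : 0 < c) : ∀ᶠ p in germ z, p.1 < c :=
  germ_of_continuous z continuous_id hc

theorem germ_dist_lt (z : M) {c : ℝ} (hc : 0 < c) : ∀ᶠ p in germ z, dist p.2 z < c :=
  Filter.Eventually.prod_inr (ball_mem_nhds z hc) _

theorem eventually_germ_iff {z : M} {P : ℝ × M → Prop} : (∀ᶠ p in germ z, P p) ↔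
    ∃ δ > 0, ∀ x ∈ ball z δ, ∀ h, 0 < h → h < δ → P (h, x) := by
  constructor
  · intro hP
    obtain ⟨s, hs, t, ht, hst⟩ := Filter.mem_prod_iff.1 hP
    obtain ⟨δ1, hδ1, h1⟩ := Metric.mem_nhdsWithin_iff.1 hs
    obtain ⟨δ2, hδ2, h2⟩ := Metric.mem_nhds_iff.1 ht
    refine ⟨min δ1 δ2, by positivity, fun x hx h h0 hh => hst ⟨h1 ⟨?_, h0⟩, h2 ?_⟩⟩
    · rw [mem_ball, Real.dist_eq, sub_zero, abs_of_pos h0]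
      exact hh.trans_le (min_le_left _ _)
    · exact ball_subset_ball (min_le_right _ _) hx
  · rintro ⟨δ, hδ, h⟩
    filter_upwards [germ_pos z, germ_lt z hδ, germ_dist_lt z hδ] with p h1 h2 h3
    exact h p.2 h3 p.1 h1 h2

end PairBoxCalculus

/-- A family of self-maps which is infinitesimally bi-Lipschitz close to the identity near `z`
and commutes with the flows `F` and `G` up to second order. -/
def Tame (F G : M → ℝ → M) (z : M) (f : ℝ → Function.End M) : Prop :=
  ∃ C > 0, ∃ ρ > 0, ∀ h, 0 < h → h < ρ → ∀ x ∈ ball z ρ,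
    dist (f h x) x ≤ C * h ∧
    (∀ y ∈ ball z ρ, dist (f h x) (f h y) ≤ (1 + C * h) * dist x y) ∧
    ∀ α, |α| ≤ h → dist (f h (F x α)) (F (f h x) α) ≤ C * h * |α| ∧
      dist (f h (G x α)) (G (f h x) α) ≤ C * h * |α|

/-- The family `f` agrees with `g` near `z` up to an error `e * h ^ 2` and flow corrections
with times at most `B * h ^ 2`. -/
def GermRel (F G : M → ℝ → M) (z : M) (f g : ℝ → Function.End M) (e B : ℝ) : Prop :=
  0 ≤ e ∧ 0 ≤ B ∧ ∀ ε > 0, ∀ᶠ p in germ z, NearFlows F G B (e + ε) p.1 (f p.1 p.2) (g p.1 p.2)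

/-- The family of maps `h ↦ X_{c h}`. -/
def atSpeed (X : M → ℝ → M) (c : ℝ) : ℝ → Function.End M := fun h x => X x (c * h)

section TameCalculus

variable {X Y F G : M → ℝ → M} {z : M} {r K : ℝ}

theorem Tame.symm {f : ℝ → Function.End M} (h : Tame F G z f) : Tame G F z f := by
  obtain ⟨C, hC, ρ, hρ, h⟩ := h
  exact ⟨C, hC, ρ, hρ, fun t h0 h1 x hx => ⟨(h t h0 h1 x hx).1, (h t h0 h1 x hx).2.1,
    fun α hα => ((h t h0 h1 x hx).2.2 α hα).symm⟩⟩

theorem Tame.one : Tame F G z 1 := by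
  refine ⟨1, one_pos, 1, one_pos, fun h h0 _ x _ => ⟨?_, fun y _ => ?_, fun α _ => ⟨?_, ?_⟩⟩⟩
  · change dist x x ≤ _
    rw [dist_self]; positivity
  · change dist x y ≤ _
    have : 0 ≤ dist x y := dist_nonneg
    nlinarith
  · change dist (F x α) (F x α) ≤ _
    rw [dist_self]; positivity
  · change dist (G x α) (G x α) ≤ _
    rw [dist_self]; positivity

theorem PairBox.tame_mul (hP : PairBox X Y F G z r K) {f g : ℝ → Function.End M}
    (hf : Tame F G z f) (hg : Tame F G z g) : Tame F G z (f * g) := by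
  obtain ⟨C, hC, ρ, hρ, hf⟩ := hf
  obtain ⟨D, hD, σ, hσ, hg⟩ := hg
  have hK := hP.fst.K_pos
  have hr := hP.fst.r_pos
  set m := min r (min ρ σ)
  have hmr : m ≤ r := min_le_left _ _
  have hmρ : m ≤ ρ := (min_le_right _ _).trans (min_le_left _ _)
  have hmσ : m ≤ σ := (min_le_right _ _).trans (min_le_right _ _)
  have hm : 0 < m := by positivity
  refine ⟨C + D + C * D, by positivity, min 1 (m / (2 + D + K)), by positivity, ?_⟩
  intro h h0 h1 x hx
  rw [mem_ball] at hx
  obtain ⟨h1, h2⟩ := lt_min_iff.1 h1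
  obtain ⟨-, hx⟩ := lt_min_iff.1 hx
  rw [lt_div_iff₀ (by positivity)] at h2 hx
  have hDh : 0 ≤ D * h := by positivity
  have hKh : 0 ≤ K * h := by positivity
  have hCh : 0 ≤ C * h := by positivity
  have hCDh : C * D * h ^ 2 ≤ C * D * h := by
    have : 0 ≤ C * D * h := by positivity
    nlinarith
  have key : ∀ y : M, dist y z * (2 + D + K) < m → dist y z + D * h + K * h < m := by
    intro y hy
    have hd : 0 ≤ dist y z := dist_nonneg
    by_contra hcon
    have h4 : dist y z < m / (2 + D + K) := by rwa [lt_div_iff₀ (by positivity)]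
    have h5 : h < m / (2 + D + K) := by rwa [lt_div_iff₀ (by positivity)]
    have h6 : m / (2 + D + K) * (1 + D + K) < m := by
      rw [div_mul_eq_mul_div, div_lt_iff₀ (by positivity)]
      nlinarith
    nlinarith
  have hh : h < m := by nlinarith
  have hxm := key x hx
  have hxσ : x ∈ ball z σ := by rw [mem_ball]; linarith
  have hxr : x ∈ ball z r := by rw [mem_ball]; linarith
  have hgd : ∀ y ∈ ball z σ, dist (g h y) z ≤ dist y z + D * h := fun y hy => by
    have := (hg h h0 (by linarith) y hy).1
    have := dist_triangle (g h y) y z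
    linarith
  have hgx := hgd x hxσ
  have hgxρ : g h x ∈ ball z ρ := by rw [mem_ball]; linarith
  have hgxr : g h x ∈ ball z r := by rw [mem_ball]; linarith
  obtain ⟨g1, g2, g3⟩ := hg h h0 (by linarith) x hxσ
  obtain ⟨f1, f2, f3⟩ := hf h h0 (by linarith) (g h x) hgxρ
  have comm : ∀ (p q w : M) (α : ℝ), |α| ≤ h → p ∈ ball z ρ → q ∈ ball z ρ →
      dist p q ≤ D * h * |α| → dist (f h q) w ≤ C * h * |α| →
      dist (f h p) w ≤ (C + D + C * D) * h * |α| := by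
    intro p q w α hα hp hq hpq hqw
    have h5 := (hf h h0 (by linarith) p hp).2.1 q hq
    have h6 : (1 + C * h) * dist p q ≤ (1 + C * h) * (D * h * |α|) := by gcongr
    have h7 : C * D * h ^ 2 * |α| ≤ C * D * h * |α| := by gcongr
    have := dist_triangle (f h p) (f h q) w
    nlinarith
  refine ⟨?_, fun y hy => ?_, fun α hα => ⟨?_, ?_⟩⟩
  · change dist (f h (g h x)) x ≤ _
    have := dist_triangle (f h (g h x)) (g h x) x
    have : 0 ≤ C * D * h := by positivity
    linarith
  · change dist (f h (g h x)) (f h (g h y)) ≤ _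
    rw [mem_ball] at hy
    obtain ⟨-, hy⟩ := lt_min_iff.1 hy
    rw [lt_div_iff₀ (by positivity)] at hy
    have hym := key y hy
    have hyσ : y ∈ ball z σ := by rw [mem_ball]; linarith
    have hgy := hgd y hyσ
    calc _ ≤ (1 + C * h) * dist (g h x) (g h y) := f2 _ (by rw [mem_ball]; linarith)
      _ ≤ (1 + C * h) * ((1 + D * h) * dist x y) := by gcongr; exact g2 y hyσ
      _ = (1 + C * h + D * h + C * D * h ^ 2) * dist x y := by ring
      _ ≤ _ := mul_le_mul_of_nonneg_right (by linarith) dist_nonneg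
  · have hKα : K * |α| ≤ K * h := by gcongr
    have d1 := hP.fst.flow_dist hxr (t := α) (by linarith)
    have d2 := hP.fst.flow_dist hgxr (t := α) (by linarith)
    have d3 := hgd (F x α) (by rw [mem_ball]; linarith)
    exact comm (g h (F x α)) (F (g h x) α) _ α hα (by rw [mem_ball]; linarith)
      (by rw [mem_ball]; linarith) (g3 α hα).1 (f3 α hα).1
  · have hKα : K * |α| ≤ K * h := by gcongr
    have d1 := hP.snd.flow_dist hxr (t := α) (by linarith)
    have d2 := hP.snd.flow_dist hgxr (t := α) (by linarith)
    have d3 := hgd (G x α) (by rw [mem_ball]; linarith)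
    exact comm (g h (G x α)) (G (g h x) α) _ α hα (by rw [mem_ball]; linarith)
      (by rw [mem_ball]; linarith) (g3 α hα).2 (f3 α hα).2

/-- A uniform scale below which all local estimates at speed `c` apply. -/
theorem exists_small_scale (hr : 0 < r) (hK : 0 < K) (c : ℝ) : ∃ ρ > 0, ∀ h x, 0 < h → h < ρ →
    x ∈ ball z ρ → |c * h| < r ∧ h < r ∧ dist x z + K * |c * h| + K * h < r ∧ K * |c * h| ≤ 1 := by
  refine ⟨min r 1 / (4 * (K + 1) * (|c| + 1)), by positivity, fun h x h0 h1 hx => ?_⟩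
  have hc := abs_nonneg c
  rw [mem_ball] at hx
  rw [lt_div_iff₀ (by positivity)] at h1 hx
  have hm1 : min r 1 ≤ r := min_le_left _ _
  have hm2 : min r 1 ≤ 1 := min_le_right _ _
  have hd : 0 ≤ dist x z := dist_nonneg
  rw [abs_mul, abs_of_pos h0]
  have p1 : 0 ≤ |c| * h := by positivity
  have p2 : 0 ≤ K * (|c| * h) := by positivity
  have p3 : 0 ≤ K * h := by positivity
  have p4 : 0 ≤ K * dist x z := by positivity
  have p5 : 0 ≤ |c| * dist x z := by positivity
  have p6 : 0 ≤ K * (|c| * dist x z) := by positivity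
  refine ⟨?_, ?_, ?_, ?_⟩ <;> nlinarith

theorem PairBox.tame_flow (hP : PairBox X Y F G z r K) (c : ℝ) : Tame F G z (atSpeed F c) := by
  have hK := hP.fst.K_pos
  have hr := hP.fst.r_pos
  obtain ⟨ρ, hρ, hs⟩ := exists_small_scale (z := z) (r := r / 2) (half_pos hr) hK c
  refine ⟨K * (|c| + 1), by positivity, ρ, hρ, fun h h0 h1 x hx => ?_⟩
  obtain ⟨s1, s2, s3, s4⟩ := hs h x h0 h1 hx
  have hch : |c * h| = |c| * h := by rw [abs_mul, abs_of_pos h0]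
  have hKh : 0 ≤ K * h := by positivity
  have hmem : ∀ y ∈ ball z ρ, y ∈ ball z r := fun y hy => by
    obtain ⟨-, -, s3, -⟩ := hs h y h0 h1 hy
    have : 0 ≤ K * |c * h| := by positivity
    rw [mem_ball]; linarith
  have hx' := hmem x hx
  refine ⟨?_, fun y hy => ?_, fun α hα => ⟨?_, ?_⟩⟩
  · have := hP.fst.flow_speed x hx' (c * h) (by linarith)
    rw [hch] at this
    simp only [atSpeed]; linarith
  · have := hP.fst.flow_lip x hx' y (hmem y hy) (c * h) (by linarith)
    rw [hch] at this
    refine this.trans (mul_le_mul_of_nonneg_right ?_ dist_nonneg)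
    linarith
  · have hab : |c * h + α| < r := (abs_add_le _ _).trans_lt (by linarith)
    have e1 := hP.fst.flow_add x hx' (c * h) α (by linarith) (by linarith) hab
    have e2 := hP.fst.flow_add x hx' α (c * h) (by linarith) (by linarith) (by rwa [add_comm])
    simp only [atSpeed]
    rw [← e1, ← e2, add_comm, dist_self]; positivity
  · have := hP.close_flow x hx' α (c * h) (by linarith) (by linarith)
    rw [dist_comm, hch] at this
    refine this.trans ?_
    have : 0 ≤ K * h * |α| := by positivity
    nlinarith

theorem PairBox.tame_arc (hP : PairBox X Y F G z r K) (c : ℝ) : Tame F G z (atSpeed X c) := by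
  have hK := hP.fst.K_pos
  have hr := hP.fst.r_pos
  obtain ⟨ρ, hρ, hs⟩ := exists_small_scale (z := z) (r := r / 2) (half_pos hr) hK c
  refine ⟨K * (2 * |c| + 3), by positivity, ρ, hρ, fun h h0 h1 x hx => ?_⟩
  obtain ⟨s1, s2, s3, s4⟩ := hs h x h0 h1 hx
  have hch : |c * h| = |c| * h := by rw [abs_mul, abs_of_pos h0]
  have hKh : 0 ≤ K * h := by positivity
  have hKch : 0 ≤ K * |c * h| := by positivity
  have hmem : ∀ y ∈ ball z ρ, y ∈ ball z r := fun y hy => by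
    obtain ⟨-, -, s3, -⟩ := hs h y h0 h1 hy
    rw [mem_ball]; linarith
  have hx' := hmem x hx
  have hcc : 0 ≤ K * |c| * h := by positivity
  refine ⟨?_, fun y hy => ?_, fun α hα => ?_⟩
  · have := hP.fst.arc_speed x hx' (c * h) (by linarith)
    rw [hch] at this
    simp only [atSpeed]; linarith
  · have := hP.fst.arc_lip x hx' y (hmem y hy) (c * h) (by linarith)
    rw [hch] at this
    refine this.trans (mul_le_mul_of_nonneg_right ?_ dist_nonneg)
    linarith
  have hKα : K * |α| ≤ K * h := by gcongr
  have hα2 : K * |α| ^ 2 ≤ K * h * |α| := by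
    rw [sq, ← mul_assoc]; gcongr
  have mX : X x (c * h) ∈ ball z r := by
    rw [mem_ball]; linarith [hP.fst.arc_dist hx' (t := c * h) (by linarith)]
  have lip : ∀ p ∈ ball z r, ∀ q ∈ ball z r, dist p q ≤ K * |α| ^ 2 →
      dist (X p (c * h)) (X q (c * h)) ≤ 2 * (K * h * |α|) := by
    intro p hp q hq hpq
    calc _ ≤ (1 + K * |c * h|) * dist p q := hP.fst.arc_lip p hp q hq (c * h) (by linarith)
      _ ≤ 2 * (K * h * |α|) := by gcongr; linarith; linarith
  have hprod : K * (|c * h| * |α|) = K * |c| * h * |α| := by rw [hch]; ring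
  simp only [atSpeed]
  constructor
  · have m1 : F x α ∈ ball z r := by
      rw [mem_ball]; linarith [hP.fst.flow_dist hx' (t := α) (by linarith)]
    have m2 : X x α ∈ ball z r := by
      rw [mem_ball]; linarith [hP.fst.arc_dist hx' (t := α) (by linarith)]
    have d0 := hP.fst.near x hx' α (by linarith)
    rw [dist_comm] at d0
    have d1 := lip _ m1 _ m2 d0
    have d2 := hP.fst.arc_add x hx' α (c * h) (by linarith) (by linarith)
    have d3 := hP.fst.arc_add x hx' (c * h) α (by linarith) (by linarith)
    have d4 := hP.fst.near _ mX α (by linarith)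
    rw [add_comm, mul_comm |α|, hprod] at d2
    rw [hprod] at d3
    have t1 := dist_triangle4 (X (F x α) (c * h)) (X (X x α) (c * h)) (X x (c * h + α))
      (F (X x (c * h)) α)
    have t2 := dist_triangle (X x (c * h + α)) (X (X x (c * h)) α) (F (X x (c * h)) α)
    rw [dist_comm (X (X x α) (c * h))] at t1
    linarith
  · have m1 : G x α ∈ ball z r := by
      rw [mem_ball]; linarith [hP.snd.flow_dist hx' (t := α) (by linarith)]
    have m2 : Y x α ∈ ball z r := by
      rw [mem_ball]; linarith [hP.snd.arc_dist hx' (t := α) (by linarith)]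
    have d0 := hP.snd.near x hx' α (by linarith)
    rw [dist_comm] at d0
    have d1 := lip _ m1 _ m2 d0
    have d2 := hP.close_arc x hx' α (c * h) (by linarith) (by linarith)
    have d4 := hP.snd.near _ mX α (by linarith)
    rw [mul_comm |α|, hprod, dist_comm] at d2
    have t1 := dist_triangle4 (X (G x α) (c * h)) (X (Y x α) (c * h)) (Y (X x (c * h)) α)
      (G (X x (c * h)) α)
    have : 0 ≤ K * |c| * h * |α| := by positivity
    linarith

theorem PairBox.tame_flow' (hP : PairBox X Y F G z r K) (c : ℝ) : Tame F G z (atSpeed G c) :=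
  (hP.symm.tame_flow c).symm

theorem PairBox.tame_arc' (hP : PairBox X Y F G z r K) (c : ℝ) : Tame F G z (atSpeed Y c) :=
  (hP.symm.tame_arc c).symm

end TameCalculus

section GermRelCalculus

variable {X Y F G : M → ℝ → M} {z : M} {r K : ℝ} {f g k : ℝ → Function.End M} {e e' B B' : ℝ}

theorem Tame.tendsto (hf : Tame F G z f) :
    Filter.Tendsto (fun p : ℝ × M => (p.1, f p.1 p.2)) (germ z) (germ z) := by
  obtain ⟨C, hC, ρ, hρ, hf⟩ := hf
  refine Filter.Tendsto.prodMk Filter.tendsto_fst (Metric.tendsto_nhds.2 fun ε hε => ?_)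
  have hu : Continuous fun h : ℝ => C * h := by fun_prop
  filter_upwards [germ_pos z, germ_lt z hρ, germ_dist_lt z hρ, germ_dist_lt z (half_pos hε),
    germ_of_continuous z hu (c := ε / 2) (by simpa using hε)] with p h1 h2 h3 h4 h5
  have := (hf p.1 h1 h2 p.2 h3).1
  have := dist_triangle (f p.1 p.2) p.2 z
  linarith

theorem Tame.eventually_dist_lt (hf : Tame F G z f) (hr : 0 < r) (K : ℝ) :
    ∀ᶠ p in germ z, dist (f p.1 p.2) z + 4 * K * p.1 < r := by
  have hu : Continuous fun h : ℝ => 4 * K * h := by fun_prop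
  filter_upwards [hf.tendsto.eventually (germ_dist_lt z (half_pos hr)),
    germ_of_continuous z hu (c := r / 2) (by simpa using hr)] with p h1 h2
  linarith

theorem GermRel.mono (h : GermRel F G z f g e B) (he : e ≤ e') (hB : B ≤ B') :
    GermRel F G z f g e' B' :=
  ⟨h.1.trans he, h.2.1.trans hB, fun ε hε => (h.2.2 ε hε).mono fun _ hp =>
    hp.mono hB (by linarith)⟩

theorem GermRel.of_near (hF : ∀ x, F x 0 = x) (hG : ∀ x, G x 0 = x) (he : 0 ≤ e)
    (h : ∀ ε > 0, ∀ᶠ p in germ z, dist (f p.1 p.2) (g p.1 p.2) ≤ (e + ε) * p.1 ^ 2) :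
    GermRel F G z f g e 0 :=
  ⟨he, le_rfl, fun ε hε => (h ε hε).mono fun p hp =>
    ⟨0, 0, by simp, by simp, by rwa [hG, hF]⟩⟩

theorem GermRel.of_forall (h : ∀ ε > 0, GermRel F G z f g ε B) : GermRel F G z f g 0 B := by
  refine ⟨le_rfl, (h 1 one_pos).2.1, fun ε hε => ?_⟩
  filter_upwards [(h (ε / 2) (half_pos hε)).2.2 (ε / 2) (half_pos hε)] with p hp
  exact hp.mono le_rfl (by linarith)

namespace PairBox

theorem germRel_of_near (hP : PairBox X Y F G z r K) (he : 0 ≤ e)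
    (h : ∀ ε > 0, ∀ᶠ p in germ z, dist (f p.1 p.2) (g p.1 p.2) ≤ (e + ε) * p.1 ^ 2) :
    GermRel F G z f g e 0 :=
  GermRel.of_near hP.fst.flow_zero hP.snd.flow_zero he h

theorem germRel_of_eventuallyEq (hP : PairBox X Y F G z r K)
    (h : ∀ᶠ p in germ z, f p.1 p.2 = g p.1 p.2) : GermRel F G z f g 0 0 := by
  refine hP.germRel_of_near le_rfl fun ε hε => h.mono fun p hp => ?_
  rw [hp, dist_self]; positivity

theorem germRel_refl (hP : PairBox X Y F G z r K) (f : ℝ → Function.End M) :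
    GermRel F G z f f 0 0 :=
  hP.germRel_of_eventuallyEq (Filter.Eventually.of_forall fun _ => rfl)

theorem germRel_trans (hP : PairBox X Y F G z r K) (hg : Tame F G z g) (hk : Tame F G z k)
    (h1 : GermRel F G z f g e B) (h2 : GermRel F G z g k e' B') :
    GermRel F G z f k (e + e') (B + B') := by
  refine ⟨add_nonneg h1.1 h2.1, add_nonneg h1.2.1 h2.2.1, fun ε hε => ?_⟩
  have hr := hP.fst.r_pos
  have u1 : Continuous fun h : ℝ => (B + B') * h := by fun_prop
  have u2 : Continuous fun h : ℝ => K * h := by fun_prop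
  have u3 : Continuous fun h : ℝ => (1 + K * h) ^ 2 * (e' + ε / 4) + 2 * K * B * B' * h ^ 2 := by
    fun_prop
  filter_upwards [h1.2.2 (ε / 4) (by positivity), h2.2.2 (ε / 4) (by positivity), germ_pos z,
    germ_of_continuous z u1 (c := 1) (by simp), germ_of_continuous z u2 (c := 1) (by simp),
    germ_of_continuous z u3 (c := e' + ε / 2) (by simp; linarith),
    germ_lt z (half_pos hr), hg.eventually_dist_lt hr K, hk.eventually_dist_lt hr K]
    with p a1 a2 a3 a4 a5 a6 a7 a8 a9
  exact (hP.nearFlows_trans a3 h1.2.1 h2.2.1 a4.le (by linarith) a5.le a8 a9 a1 a2).mono le_rfl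
    (by linarith)

theorem germRel_symm (hP : PairBox X Y F G z r K) (hf : Tame F G z f) (hg : Tame F G z g)
    (h1 : GermRel F G z f g e B) : GermRel F G z g f e B := by
  refine ⟨h1.1, h1.2.1, fun ε hε => ?_⟩
  have hr := hP.fst.r_pos
  have u1 : Continuous fun h : ℝ => B * h := by fun_prop
  have u2 : Continuous fun h : ℝ => K * h := by fun_prop
  have u3 : Continuous fun h : ℝ => (1 + K * h) ^ 2 * (e + ε / 4) + 2 * K * B * B * h ^ 2 := by
    fun_prop
  filter_upwards [h1.2.2 (ε / 4) (by positivity), germ_pos z,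
    germ_of_continuous z u1 (c := 1) (by simp), germ_of_continuous z u2 (c := 1) (by simp),
    germ_of_continuous z u3 (c := e + ε / 2) (by simp; linarith),
    germ_lt z (half_pos hr), hf.eventually_dist_lt hr K, hg.eventually_dist_lt hr K]
    with p a1 a3 a4 a5 a6 a7 a8 a9
  exact (hP.nearFlows_symm a3 h1.2.1 a4.le (by linarith) a5.le a8 a9 a1).mono le_rfl
    (by linarith)

theorem germRel_mul_right (hk : Tame F G z k) (h1 : GermRel F G z f g e B) :
    GermRel F G z (f * k) (g * k) e B :=
  ⟨h1.1, h1.2.1, fun ε hε => hk.tendsto.eventually (h1.2.2 ε hε)⟩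

theorem germRel_mul_left (hP : PairBox X Y F G z r K) (hf : Tame F G z f) (hg : Tame F G z g)
    (hk : Tame F G z k) (h1 : GermRel F G z f g e B) :
    GermRel F G z (k * f) (k * g) e B := by
  refine ⟨h1.1, h1.2.1, fun ε hε => ?_⟩
  have hr := hP.fst.r_pos
  have hK := hP.fst.K_pos
  have hkg := hP.tame_mul hk hg
  obtain ⟨C, hC, ρ, hρ, hk'⟩ := id hk
  have u1 : Continuous fun h : ℝ => B * h := by fun_prop
  have u2 : Continuous fun h : ℝ => K * h := by fun_prop
  have u3 : Continuous fun h : ℝ => (1 + C * h) * (e + ε / 4) + 3 * C * B * h := by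
    fun_prop
  have u4 : Continuous fun h : ℝ => C * h := by fun_prop
  set m := min r ρ
  have hmr : m ≤ r := min_le_left _ _
  have hmρ : m ≤ ρ := min_le_right _ _
  have hm : 0 < m := by positivity
  filter_upwards [h1.2.2 (ε / 4) (by positivity), germ_pos z,
    germ_of_continuous z u1 (c := 1) (by simp), germ_of_continuous z u2 (c := 1) (by simp),
    germ_of_continuous z u3 (c := e + ε / 2) (by simp; linarith),
    germ_lt z (half_pos hm), hf.eventually_dist_lt (half_pos hm) K,
    hg.eventually_dist_lt (half_pos hm) K,
    hkg.eventually_dist_lt (half_pos hm) K,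
    germ_of_continuous z u4 (c := m / 2) (by simpa using hm)]
    with p a1 a3 a4 a5 a6 a7 a8 a9 a10 a11
  obtain ⟨α, β, hα, hβ, hd⟩ := a1
  set h := p.1
  have hKh : 0 ≤ K * h := by positivity
  have b1 := abs_le_of_le_mul_sq a3 a4.le hα
  have b2 := abs_le_of_le_mul_sq a3 a4.le hβ
  have hKα : K * |α| ≤ K * h := by gcongr
  have hKβ : K * |β| ≤ K * h := by gcongr
  refine ⟨α, β, hα, hβ, ?_⟩
  change dist (k h (f h p.2)) (F (G (k h (g h p.2)) β) α) ≤ _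
  change dist (k h (g h p.2)) z + _ < _ at a10
  set fp := f h p.2
  set gp := g h p.2
  have m1 : fp ∈ ball z m := by rw [mem_ball]; linarith
  have m2 : gp ∈ ball z m := by rw [mem_ball]; linarith
  have m2' := ball_subset_ball hmr m2
  have d3 := hP.snd.flow_dist m2' (t := β) (by linarith)
  have m3 : G gp β ∈ ball z m := by rw [mem_ball]; linarith
  have d4 := hP.fst.flow_dist (ball_subset_ball hmr m3) (t := α) (by linarith)
  have m4 : F (G gp β) α ∈ ball z m := by rw [mem_ball]; linarith
  obtain ⟨c1, -, c3⟩ := hk' h a3 (by linarith) (G gp β) (ball_subset_ball hmρ m3)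
  have d5 := dist_triangle (k h (G gp β)) (G gp β) z
  have m5 : k h (G gp β) ∈ ball z r := by rw [mem_ball]; linarith
  have m6 : k h gp ∈ ball z r := by rw [mem_ball]; linarith
  have d7 := hP.snd.flow_dist m6 (t := β) (by linarith)
  have m7 : G (k h gp) β ∈ ball z r := by rw [mem_ball]; linarith
  have t1 : dist (k h fp) (k h (F (G gp β) α)) ≤ (1 + C * h) * ((e + ε / 4) * h ^ 2) :=
    ((hk' h a3 (by linarith) fp (ball_subset_ball hmρ m1)).2.1 _ (ball_subset_ball hmρ m4)).trans
      (by gcongr)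
  have t2 : dist (k h (F (G gp β) α)) (F (k h (G gp β)) α) ≤ C * h * (B * h ^ 2) :=
    (c3 α b1).1.trans (by gcongr)
  have t3 : dist (F (k h (G gp β)) α) (F (G (k h gp) β) α) ≤ 2 * (C * h * (B * h ^ 2)) := by
    refine (hP.fst.flow_lip _ m5 _ m7 α (by linarith)).trans ?_
    gcongr
    · linarith
    · exact ((hk' h a3 (by linarith) gp (ball_subset_ball hmρ m2)).2.2 β b2).2.trans (by gcongr)
  calc _ ≤ _ := dist_triangle4 _ (k h (F (G gp β) α)) (F (k h (G gp β)) α) _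
    _ ≤ ((1 + C * h) * (e + ε / 4) + 3 * C * B * h) * h ^ 2 := by linarith
    _ ≤ _ := mul_le_mul_of_nonneg_right (by linarith) (sq_nonneg _)

theorem germRel_swap (hP : PairBox X Y F G z r K) (hg : Tame F G z g)
    (h1 : GermRel F G z f g e B) : GermRel G F z f g e B := by
  refine ⟨h1.1, h1.2.1, fun ε hε => ?_⟩
  have hr := hP.fst.r_pos
  have hK := hP.fst.K_pos
  have u1 : Continuous fun h : ℝ => B * h := by fun_prop
  have u3 : Continuous fun h : ℝ => K * (B * B) * h ^ 2 := by fun_prop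
  filter_upwards [h1.2.2 (ε / 4) (by positivity), germ_pos z,
    germ_of_continuous z u1 (c := 1) (by simp),
    germ_of_continuous z u3 (c := ε / 2) (by simp; linarith),
    germ_lt z (half_pos hr), hg.eventually_dist_lt hr K]
    with p a1 a3 a4 a6 a7 a9
  obtain ⟨α, β, hα, hβ, hd⟩ := a1
  have b1 := abs_le_of_le_mul_sq a3 a4.le hα
  have b2 := abs_le_of_le_mul_sq a3 a4.le hβ
  have hKh : 0 ≤ K * p.1 := by positivity
  refine ⟨β, α, hβ, hα, ?_⟩
  have d1 := hP.close_flow (g p.1 p.2) (by rw [mem_ball]; linarith) β α (by linarith) (by linarith)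
  rw [dist_comm] at d1
  have hB : 0 ≤ B * p.1 ^ 2 := (abs_nonneg _).trans hα
  have d2 : K * (|β| * |α|) ≤ K * ((B * p.1 ^ 2) * (B * p.1 ^ 2)) := by gcongr
  calc _ ≤ _ := dist_triangle _ (F (G (g p.1 p.2) β) α) _
    _ ≤ (e + ε / 4 + K * (B * B) * p.1 ^ 2) * p.1 ^ 2 := by linarith
    _ ≤ _ := mul_le_mul_of_nonneg_right (by linarith) (sq_nonneg _)

end PairBox

end GermRelCalculus

/-- A congruence on a monoid graded by two additive error terms. -/
structure ErrorCongruence {T : Type*} [Monoid T] (R : T → T → ℝ → ℝ → Prop) : Prop where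
  refl : ∀ a, R a a 0 0
  mono : ∀ {a b e e' B B'}, R a b e B → e ≤ e' → B ≤ B' → R a b e' B'
  symm : ∀ {a b e B}, R a b e B → R b a e B
  trans : ∀ {a b c e e' B B'}, R a b e B → R b c e' B' → R a c (e + e') (B + B')
  mul_left : ∀ {a b e B} (c), R a b e B → R (c * a) (c * b) e B
  mul_right : ∀ {a b e B} (c), R a b e B → R (a * c) (b * c) e B

namespace ErrorCongruence

variable {T : Type*} [Monoid T] {R : T → T → ℝ → ℝ → Prop}

theorem sandwich (h : ErrorCongruence R) {a b : T} {e B : ℝ} (x y : T) (hab : R a b e B) :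
    R (x * (a * y)) (x * (b * y)) e B :=
  h.mul_left x (h.mul_right y hab)

theorem cancel (h : ErrorCongruence R) {a : T} {e B : ℝ} (x y : T) (ha : R a 1 e B) :
    R (x * (a * y)) (x * y) e B := by
  simpa only [one_mul] using h.sandwich x y ha

theorem pow_mul_pow (h : ErrorCongruence R) {a b : T} {κ : ℝ} (hab : R (a * b) 1 0 κ) (n : ℕ) :
    R (a ^ n * b ^ n) 1 0 (n * κ) := by
  induction n with
  | zero => simpa using h.refl 1
  | succ n ih =>
    have h1 := h.trans (h.cancel (a ^ n) (b ^ n) hab) ih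
    rw [pow_succ, pow_succ']
    push_cast
    rw [add_mul, one_mul, add_comm (_ * κ)]
    simpa only [mul_assoc, add_zero] using h1

theorem of_left_inverse (h : ErrorCongruence R) {l p q i i' : T} {e e' e'' B B' B'' : ℝ}
    (hp : R (l * p) 1 e B) (hq : R (l * q) 1 e' B') (hqi : R q i e'' B'')
    (h1 : R (i * i') 1 0 0) :
    R p i (e + e' + e'') (B + B' + B'') := by
  have a1 : R (l * (q * (i' * p))) (l * (i * (i' * p))) e'' B'' := h.sandwich _ _ hqi
  have a2 : R (l * (i * (i' * p))) (l * p) 0 0 := by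
    simpa only [mul_assoc] using h.cancel l p h1
  have a3 : R (l * (q * (i' * p))) (i' * p) e' B' := by
    simpa only [mul_assoc, one_mul] using h.mul_right (i' * p) hq
  have a4 := h.mul_left i (h.trans (h.symm a3) (h.trans a1 (h.trans a2 hp)))
  have a5 : R p (i * (i' * p)) 0 0 := by
    simpa only [mul_assoc, one_mul] using h.symm (h.mul_right p h1)
  rw [mul_one] at a4
  exact h.mono (h.trans a5 a4) (by linarith) (by linarith)

variable {f g : ℝ → T} {x y x' y' : T} {ν κ : ℝ}

theorem staircase (h : ErrorCongruence R) (hκ : 0 ≤ κ)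
    (hf0 : R (f 0) 1 0 0) (hg0 : R (g 0) 1 0 0)
    (hf : ∀ s t, R (f s * f t) (f (s + t)) 0 0) (hg : ∀ s t, R (g s * g t) (g (s + t)) 0 0)
    (hx : R x (f ν) κ 0) (hy : R y (g ν) κ 0) (hx' : R x' (f (-ν)) κ 0)
    (hy' : R y' (g (-ν)) κ 0) (hc : R (f ν * g ν) (g ν * f ν) κ 0)
    (hb : R (y' * x' * (y * x)) 1 0 κ) (hb' : R (x' * y' * (x * y)) 1 0 κ) (n : ℕ) :
    R (g (1 - n * ν) * ((x * y) ^ n * f (1 - n * ν))) (g 1 * f 1) (4 * n * κ) (n ^ 2 * κ) := by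
  have hfn : ∀ t, R (f (-t) * f t) 1 0 0 := fun t => by
    simpa using h.trans (hf (-t) t) (by simpa using hf0)
  have hgn : ∀ t, R (g (-t) * g t) 1 0 0 := fun t => by
    simpa using h.trans (hg (-t) t) (by simpa using hg0)
  have hfn' : ∀ t, R (f t * f (-t)) 1 0 0 := fun t => by simpa using hfn (-t)
  have hgn' : ∀ t, R (g t * g (-t)) 1 0 0 := fun t => by simpa using hgn (-t)
  have hfa : ∀ {r s t}, s + t = r → R (f r) (f s * f t) 0 0 := fun e => e ▸ h.symm (hf _ _)
  have hga : ∀ {r s t}, s + t = r → R (g r) (g s * g t) 0 0 := fun e => e ▸ h.symm (hg _ _)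
  have hxf : R (x' * f ν) 1 κ 0 := by
    simpa using h.trans (h.mul_right (f ν) hx') (hfn ν)
  have hyg : R (y' * g ν) 1 κ 0 := by
    simpa using h.trans (h.mul_right (g ν) hy') (hgn ν)
  have inv : R (g 1 * f 1 * (f (-1) * g (-1))) 1 0 0 := by
    have := h.cancel (g 1) (g (-1)) (hfn' 1)
    simpa only [mul_assoc, add_zero] using h.trans this (hgn' 1)
  induction n using Nat.twoStepInduction with
  | zero => simpa using h.refl _
  | one =>
    have a1 := h.sandwich (g (1 - ν)) (y * f (1 - ν)) hx
    have a2 := h.sandwich (g (1 - ν) * f ν) (f (1 - ν)) hy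
    have a3 := h.sandwich (g (1 - ν)) (f (1 - ν)) hc
    have a4 := h.mul_right (f ν * f (1 - ν)) (h.symm (hga (r := 1) (s := 1 - ν) (t := ν) (by ring)))
    have a5 := h.mul_left (g 1) (h.symm (hfa (r := 1) (s := ν) (t := 1 - ν) (by ring)))
    simp only [mul_assoc] at a1 a2 a3 a4 a5
    have := h.trans a1 (h.trans a2 (h.trans a3 (h.trans a4 a5)))
    norm_num only [pow_one, Nat.cast_one, one_mul, mul_assoc, one_pow]
    exact h.mono this (by linarith) (by linarith)
  | more n ih _ =>
    push_cast
    obtain ⟨c, hc⟩ : ∃ c, c = 1 - ((n : ℝ) + 2) * ν := ⟨_, rfl⟩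
    have hc' : 1 - (n : ℝ) * ν = c + 2 * ν := by rw [hc]; ring
    rw [← hc]
    rw [hc'] at ih
    have t1 := h.pow_mul_pow hb' (n + 2)
    have t2 := h.pow_mul_pow hb (n + 1)
    push_cast at t1 t2
    have p1 : R (f (-c) * ((x' * y') ^ (n + 2) * g (-c)) * (g c * ((x * y) ^ (n + 2) * f c))) 1
        0 ((n + 2) * κ) := by
      have a1 := h.cancel (f (-c) * (x' * y') ^ (n + 2)) ((x * y) ^ (n + 2) * f c) (hgn c)
      have a2 := h.cancel (f (-c)) (f c) t1
      simp only [mul_assoc] at a1 a2 ⊢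
      simpa using h.trans a1 (h.trans a2 (hfn c))
    have p2 : R (f (-c) * ((x' * y') ^ (n + 2) * g (-c)) *
        (g (c + 2 * ν) * ((x * y) ^ n * f (c + 2 * ν)))) 1 (4 * κ) ((n + 1) * κ) := by
      have e1 : (x' * y') ^ (n + 2) = x' * (y' * x') ^ (n + 1) * y' := by
        rw [pow_succ (x' * y'), ← mul_assoc, mul_pow_mul]
      have e2 : y * (x * y) ^ n * x = (y * x) ^ (n + 1) := by
        rw [pow_succ, ← mul_assoc, mul_pow_mul]
      have g2 : R (g (c + 2 * ν)) (g c * (g ν * g ν)) 0 0 := by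
        simpa using h.trans (hga (r := c + 2 * ν) (s := c) (t := ν + ν) (by ring))
          (h.mul_left _ (hga rfl))
      have f2 : R (f (c + 2 * ν)) (f ν * (f ν * f c)) 0 0 := by
        simpa using h.trans (hfa (r := c + 2 * ν) (s := ν) (t := ν + c) (by ring))
          (h.mul_left _ (hfa rfl))
      have mid : R (g ν * ((x * y) ^ n * f ν)) ((y * x) ^ (n + 1)) (2 * κ) 0 := by
        have b1 := h.mul_right ((x * y) ^ n * f ν) (h.symm hy)
        have b2 := h.mul_left (y * (x * y) ^ n) (h.symm hx)
        rw [← e2]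
        simp only [mul_assoc] at b1 b2 ⊢
        exact h.mono (h.trans b1 b2) (by linarith) (by linarith)
      have a1 := h.sandwich (f (-c) * (x' * (y' * x') ^ (n + 1) * y') * g (-c))
        ((x * y) ^ n * f (c + 2 * ν)) g2
      have a2 := h.mul_left (f (-c) * (x' * (y' * x') ^ (n + 1) * y') * g (-c) *
        (g c * (g ν * g ν)) * (x * y) ^ n) f2
      have a3 := h.cancel (f (-c) * (x' * (y' * x') ^ (n + 1) * y'))
        (g ν * g ν * (x * y) ^ n * (f ν * (f ν * f c))) (hgn c)
      have a4 := h.cancel (f (-c) * (x' * (y' * x') ^ (n + 1)))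
        (g ν * (x * y) ^ n * (f ν * (f ν * f c))) hyg
      have a5 := h.sandwich (f (-c) * (x' * (y' * x') ^ (n + 1))) (f ν * f c) mid
      have a6 := h.cancel (f (-c) * x') (f ν * f c) t2
      have a7 := h.cancel (f (-c)) (f c) hxf
      rw [e1]
      simp only [mul_assoc] at a1 a2 a3 a4 a5 a6 a7 ⊢
      have := h.trans a1 (h.trans a2 (h.trans a3 (h.trans a4 (h.trans a5 (h.trans a6
        (h.trans a7 (hfn c)))))))
      exact h.mono this (by linarith) (by linarith)
    refine h.mono (h.of_left_inverse p1 p2 ih inv) (by linarith) ?_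
    have : 0 ≤ (n : ℝ) * κ := by positivity
    nlinarith

theorem pow_near_swap (h : ErrorCongruence R) (hκ : 0 ≤ κ)
    (hf0 : R (f 0) 1 0 0) (hg0 : R (g 0) 1 0 0)
    (hf : ∀ s t, R (f s * f t) (f (s + t)) 0 0) (hg : ∀ s t, R (g s * g t) (g (s + t)) 0 0)
    (hx : R x (f ν) κ 0) (hy : R y (g ν) κ 0) (hx' : R x' (f (-ν)) κ 0)
    (hy' : R y' (g (-ν)) κ 0) (hc : R (f ν * g ν) (g ν * f ν) κ 0)
    (hb : R (y' * x' * (y * x)) 1 0 κ) (hb' : R (x' * y' * (x * y)) 1 0 κ) (n : ℕ)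
    (hn : (n + 1) * ν = 1) :
    R (g 1 * f 1) (f 1 * g 1) (8 * (n + 1) * κ) (2 * (n + 1) ^ 2 * κ) := by
  have s1 := h.staircase hκ hf0 hg0 hf hg hx hy hx' hy' hc hb hb' n
  have s2 := h.staircase hκ hg0 hf0 hg hf hy hx hy' hx' (h.symm hc) hb' hb (n + 1)
  have e1 : 1 - (n : ℝ) * ν = ν := by linarith
  have e2 : 1 - ((n + 1 : ℕ) : ℝ) * ν = 0 := by push_cast; linarith
  rw [e1] at s1
  rw [e2] at s2
  have b1 := h.mul_right ((x * y) ^ n * x) hy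
  have b2 := h.mul_left (g ν * (x * y) ^ n) hx
  have c1 := h.mul_right ((y * x) ^ (n + 1) * g 0) hf0
  have c2 := h.mul_left ((y * x) ^ (n + 1)) hg0
  have e3 : y * ((x * y) ^ n * x) = (y * x) ^ (n + 1) := by
    rw [pow_succ, ← mul_assoc, ← mul_assoc, mul_pow_mul]
  rw [e3] at b1
  simp only [mul_assoc, one_mul, mul_one] at b1 b2 c1 c2 s1 s2
  have l := h.trans b1 (h.trans b2 s1)
  have l' := h.trans (h.symm c2) (h.trans (h.symm c1) s2)
  have hnκ : 0 ≤ (n : ℝ) * κ := by positivity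
  have hnκ2 : 0 ≤ (n : ℝ) ^ 2 * κ := by positivity
  push_cast at l'
  refine h.mono (h.trans (h.symm l) l') ?_ ?_ <;> nlinarith

end ErrorCongruence

namespace PairBox

variable {X Y F G : M → ℝ → M} {z : M} {r K : ℝ}

/-- The monoid of tame families. -/
def tameSubmonoid (hP : PairBox X Y F G z r K) : Submonoid (ℝ → Function.End M) where
  carrier := {f | Tame F G z f}
  mul_mem' := hP.tame_mul
  one_mem' := Tame.one

theorem errorCongruence (hP : PairBox X Y F G z r K) :
    ErrorCongruence fun a b : hP.tameSubmonoid => GermRel F G z a.1 b.1 where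
  refl a := hP.germRel_refl a.1
  mono := GermRel.mono
  symm {a b _ _} := hP.germRel_symm a.2 b.2
  trans {_ b c _ _ _ _} := hP.germRel_trans b.2 c.2
  mul_left {a b _ _} c := hP.germRel_mul_left a.2 b.2 c.2
  mul_right c := germRel_mul_right c.2

theorem eventually_small (hP : PairBox X Y F G z r K) (c : ℝ) :
    ∀ᶠ p in germ z, |c * p.1| < r := by
  have u : Continuous fun h : ℝ => |c * h| := by fun_prop
  exact germ_of_continuous z u (by simpa using hP.fst.r_pos)

theorem eventually_mem (hP : PairBox X Y F G z r K) : ∀ᶠ p in germ z, p.2 ∈ ball z r :=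
  germ_dist_lt z hP.fst.r_pos

theorem germRel_flow_zero (hP : PairBox X Y F G z r K) :
    GermRel F G z (atSpeed F 0) 1 0 0 := by
  refine hP.germRel_of_eventuallyEq (Filter.Eventually.of_forall fun p => ?_)
  change F p.2 (0 * p.1) = p.2
  rw [zero_mul, hP.fst.flow_zero]

theorem germRel_flow_add (hP : PairBox X Y F G z r K) (s t : ℝ) :
    GermRel F G z (atSpeed F s * atSpeed F t) (atSpeed F (s + t)) 0 0 := by
  refine hP.germRel_of_eventuallyEq ?_
  filter_upwards [hP.eventually_small s, hP.eventually_small t, hP.eventually_small (s + t),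
    hP.eventually_mem] with p h1 h2 h3 h4
  change F (F p.2 (t * p.1)) (s * p.1) = F p.2 ((s + t) * p.1)
  have e : (s + t) * p.1 = t * p.1 + s * p.1 := by ring
  rw [e] at h3 ⊢
  exact (hP.fst.flow_add _ h4 _ _ h2 h1 h3).symm

theorem germRel_arc_flow (hP : PairBox X Y F G z r K) (c : ℝ) :
    GermRel F G z (atSpeed X c) (atSpeed F c) (K * c ^ 2) 0 := by
  have hK := hP.fst.K_pos
  refine hP.germRel_of_near (by positivity) fun ε hε => ?_
  filter_upwards [hP.eventually_small c, hP.eventually_mem] with p h1 h2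
  refine (hP.fst.near _ h2 _ h1).trans ?_
  rw [sq_abs, mul_pow]
  have : 0 ≤ ε * p.1 ^ 2 := by positivity
  linarith

theorem germRel_flow_comm (hP : PairBox X Y F G z r K) (c : ℝ) :
    GermRel F G z (atSpeed F c * atSpeed G c) (atSpeed G c * atSpeed F c) (K * c ^ 2) 0 := by
  have hK := hP.fst.K_pos
  refine hP.germRel_of_near (by positivity) fun ε hε => ?_
  filter_upwards [hP.eventually_small c, hP.eventually_mem] with p h1 h2
  have := hP.close_flow _ h2 _ _ h1 h1
  rw [dist_comm] at this
  refine this.trans ?_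
  rw [← sq, sq_abs, mul_pow]
  have : 0 ≤ ε * p.1 ^ 2 := by positivity
  linarith

theorem germRel_bracket (hP : PairBox X Y F G z r K) {ν : ℝ} (hν : 0 < ν) (hν1 : ν ≤ 1) :
    GermRel F G z (atSpeed Y (-ν) * atSpeed X (-ν) * (atSpeed Y ν * atSpeed X ν)) 1 0
      (K * ν ^ 2) := by
  have hK := hP.fst.K_pos
  refine ⟨le_rfl, by positivity, fun ε hε => ?_⟩
  obtain ⟨δ, hδ, hb⟩ := hP.brk_pos ε hε
  filter_upwards [germ_pos z, germ_lt z hδ, hP.eventually_mem] with p h0 h1 h2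
  obtain ⟨α, β, hα, hβ, hd⟩ := hb p.2 h2 (ν * p.1) (by positivity) (by nlinarith)
  rw [mul_pow, ← mul_assoc] at hα hβ hd
  refine ⟨α, β, hα, hβ, ?_⟩
  change dist (Y (X (Y (X p.2 (ν * p.1)) (ν * p.1)) (-ν * p.1)) (-ν * p.1))
    (F (G p.2 β) α) ≤ _
  rw [neg_mul]
  refine hd.trans (mul_le_mul_of_nonneg_right ?_ (sq_nonneg _))
  have : ν ^ 2 ≤ 1 := pow_le_one₀ hν.le hν1
  nlinarith

theorem germRel_flow_swap (hP : PairBox X Y F G z r K) :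
    GermRel F G z (atSpeed G 1 * atSpeed F 1) (atSpeed F 1 * atSpeed G 1) 0 (2 * K) := by
  have hK := hP.fst.K_pos
  have sw : ∀ {a b : ℝ → Function.End M} {e B : ℝ}, Tame F G z b → GermRel G F z a b e B →
      GermRel F G z a b e B := fun hb => hP.symm.germRel_swap hb.symm
  have key : ∀ n : ℕ, GermRel F G z (atSpeed G 1 * atSpeed F 1) (atSpeed F 1 * atSpeed G 1)
      (8 * K / (n + 1)) (2 * K) := by
    intro n
    have hn : (0 : ℝ) < n + 1 := by positivity
    obtain ⟨ν, hν⟩ : ∃ ν : ℝ, ν = 1 / (n + 1) := ⟨_, rfl⟩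
    have hν0 : 0 < ν := by rw [hν]; positivity
    have hνn : (n + 1) * ν = 1 := by rw [hν]; field_simp
    have hν1 : ν ≤ 1 := by
      rw [hν, div_le_one hn]; linarith [(Nat.cast_nonneg n : (0 : ℝ) ≤ n)]
    have neg_sq' : K * (-ν) ^ 2 = K * ν ^ 2 := by ring
    have := hP.errorCongruence.pow_near_swap (f := fun t => ⟨atSpeed F t, hP.tame_flow t⟩)
      (g := fun t => ⟨atSpeed G t, hP.tame_flow' t⟩) (x := ⟨atSpeed X ν, hP.tame_arc ν⟩)
      (y := ⟨atSpeed Y ν, hP.tame_arc' ν⟩) (x' := ⟨atSpeed X (-ν), hP.tame_arc (-ν)⟩)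
      (y' := ⟨atSpeed Y (-ν), hP.tame_arc' (-ν)⟩) (ν := ν) (κ := K * ν ^ 2) (by positivity)
      hP.germRel_flow_zero (sw Tame.one hP.symm.germRel_flow_zero) hP.germRel_flow_add
      (fun s t => sw (hP.tame_flow' _) (hP.symm.germRel_flow_add s t))
      (hP.germRel_arc_flow ν) (sw (hP.tame_flow' _) (hP.symm.germRel_arc_flow ν))
      (neg_sq' ▸ hP.germRel_arc_flow (-ν))
      (neg_sq' ▸ sw (hP.tame_flow' _) (hP.symm.germRel_arc_flow (-ν)))
      (hP.germRel_flow_comm ν) (hP.germRel_bracket hν0 hν1)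
      (sw Tame.one (hP.symm.germRel_bracket hν0 hν1)) n hνn
    refine GermRel.mono this ?_ ?_
    · rw [le_div_iff₀ hn]
      have : 8 * ((n : ℝ) + 1) * (K * ν ^ 2) * (n + 1) = 8 * K * ((n + 1) * ν) ^ 2 := by ring
      rw [this, hνn]; linarith
    · have : 2 * ((n : ℝ) + 1) ^ 2 * (K * ν ^ 2) = 2 * K * ((n + 1) * ν) ^ 2 := by ring
      rw [this, hνn]; linarith
  refine GermRel.of_forall fun ε hε => ?_
  obtain ⟨n, hn⟩ := exists_nat_gt (8 * K / ε)
  refine (key n).mono ?_ le_rfl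
  rw [div_lt_iff₀ hε] at hn
  rw [div_le_iff₀ (by positivity)]
  nlinarith

end PairBox

theorem ErrorCongruence.swap_inv {T : Type*} [Monoid T] {R : T → T → ℝ → ℝ → Prop}
    (h : ErrorCongruence R) {x y y' : T} {e B : ℝ} (hy : R (y * y') 1 0 0)
    (hy' : R (y' * y) 1 0 0) (hxy : R (y * x) (x * y) e B) : R (y' * x) (x * y') e B := by
  have a1 := h.sandwich y' y' hxy
  have a2 := h.mul_right (x * y') hy'
  have a3 := h.mul_left (y' * x) hy
  simp only [mul_assoc, one_mul, mul_one] at a1 a2 a3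
  exact h.mono (h.symm (h.trans (h.symm a2) (h.trans a1 a3))) (by linarith) (by linarith)

namespace PairBox

variable {X Y F G : M → ℝ → M} {z : M} {r K : ℝ}

theorem germRel_flow_neg (hP : PairBox X Y F G z r K) {s t : ℝ} (hst : s + t = 0) :
    GermRel F G z (atSpeed F s * atSpeed F t) 1 0 0 := by
  have h1 := hP.germRel_flow_add s t
  rw [hst] at h1
  simpa using hP.germRel_trans (hP.tame_flow 0) Tame.one h1 hP.germRel_flow_zero

theorem germRel_flow_swap_of_abs (hP : PairBox X Y F G z r K) {a b : ℝ}
    (ha : a = 1 ∨ a = -1) (hb : b = 1 ∨ b = -1) :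
    GermRel F G z (atSpeed G b * atSpeed F a) (atSpeed F a * atSpeed G b) 0 (2 * K) := by
  have hn : ∀ s t : ℝ, s + t = 0 → GermRel F G z (atSpeed G s * atSpeed G t) 1 0 0 := fun s t h =>
    hP.symm.germRel_swap Tame.one (hP.symm.germRel_flow_neg h)
  let f : ℝ → hP.tameSubmonoid := fun t => ⟨atSpeed F t, hP.tame_flow t⟩
  let g : ℝ → hP.tameSubmonoid := fun t => ⟨atSpeed G t, hP.tame_flow' t⟩
  have hE := hP.errorCongruence
  have key : ∀ b : ℝ, b = 1 ∨ b = -1 →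
      GermRel F G z (atSpeed G b * atSpeed F 1) (atSpeed F 1 * atSpeed G b) 0 (2 * K) := by
    rintro b (rfl | rfl)
    · exact hP.germRel_flow_swap
    · exact hE.swap_inv (x := f 1) (y := g 1) (y' := g (-1)) (hn _ _ (by norm_num))
        (hn _ _ (by norm_num)) hP.germRel_flow_swap
  rcases ha with rfl | rfl
  · exact key b hb
  · exact hE.symm (hE.swap_inv (x := g b) (y := f 1) (y' := f (-1))
      (hP.germRel_flow_neg (by norm_num)) (hP.germRel_flow_neg (by norm_num))
      (hE.symm (a := g b * f 1) (b := f 1 * g b) (key b hb)))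

/-- Around `z`, flow rectangles with sides of equal length close up to second order after
adjusting the flow times by second order terms. -/
theorem exists_square_swap (hP : PairBox X Y F G z r K) {ε : ℝ} (hε : 0 < ε) :
    ∃ δ > 0, ∀ x ∈ ball z δ, ∀ u g : ℝ, |u| = |g| → |g| < δ →
      ∃ α β, |α| ≤ 2 * K * g ^ 2 ∧ |β| ≤ 2 * K * g ^ 2 ∧
        dist (G (F x u) g) (F (G x (g + β)) (u + α)) ≤ ε * g ^ 2 := by
  have hr := hP.fst.r_pos
  have hK := hP.fst.K_pos
  have main : ∀ a b : ℝ, a = 1 ∨ a = -1 → b = 1 ∨ b = -1 → ∀ᶠ p in germ z,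
      ∃ α β, |α| ≤ 2 * K * p.1 ^ 2 ∧ |β| ≤ 2 * K * p.1 ^ 2 ∧
        dist (G (F p.2 (a * p.1)) (b * p.1)) (F (G p.2 (b * p.1 + β)) (a * p.1 + α)) ≤
          ε * p.1 ^ 2 := by
    intro a b ha hb
    have hrel := (hP.germRel_flow_swap_of_abs ha hb).2.2 (ε / 2) (half_pos hε)
    have u1 : Continuous fun h : ℝ => 2 * K * h := by fun_prop
    have u2 : Continuous fun h : ℝ => (1 + K * h) * (K * (2 * K * h)) := by fun_prop
    filter_upwards [hrel, germ_pos z, germ_lt z (half_pos hr),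
      Tame.one.eventually_dist_lt (F := F) (G := G) hr K,
      germ_of_continuous z u1 (c := 1) (by simp),
      germ_of_continuous z u2 (c := ε / 2) (by simpa using hε)] with p h1 h2 h3 h4 h5 h6
    obtain ⟨α, β, hα, hβ, hd⟩ := h1
    have b1 := abs_le_of_le_mul_sq h2 h5.le hα
    have b2 := abs_le_of_le_mul_sq h2 h5.le hβ
    have ea : |a * p.1| = p.1 := by
      rw [abs_mul, abs_of_pos h2]; rcases ha with rfl | rfl <;> simp
    have eb : |b * p.1| = p.1 := by
      rw [abs_mul, abs_of_pos h2]; rcases hb with rfl | rfl <;> simp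
    have d := hP.flows_add (x := p.2) h4 (by linarith) b1 b2 ea.le eb.le
    rw [ea] at d
    refine ⟨α, β, hα, hβ, ?_⟩
    rw [add_comm _ α, add_comm _ β]
    have hKh : 0 ≤ K * p.1 := by positivity
    have d' : (1 + K * p.1) * (K * (|β| * p.1)) ≤
        (1 + K * p.1) * (K * ((2 * K * p.1 ^ 2) * p.1)) := by gcongr
    change dist (G (F p.2 (a * p.1)) (b * p.1)) (F (G (F (G p.2 (b * p.1)) (a * p.1)) β) α) ≤ _
      at hd
    calc _ ≤ _ := dist_triangle _ (F (G (F (G p.2 (b * p.1)) (a * p.1)) β) α) _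
      _ ≤ (ε / 2 + (1 + K * p.1) * (K * (2 * K * p.1))) * p.1 ^ 2 := by linarith
      _ ≤ _ := mul_le_mul_of_nonneg_right (by linarith) (sq_nonneg _)
  have sgn : ∀ t : ℝ, ∃ a : ℝ, (a = 1 ∨ a = -1) ∧ t = a * |t| := fun t => by
    rcases le_total 0 t with h | h
    · exact ⟨1, Or.inl rfl, by rw [abs_of_nonneg h, one_mul]⟩
    · exact ⟨-1, Or.inr rfl, by rw [abs_of_nonpos h]; ring⟩
  have all := ((main 1 1 (Or.inl rfl) (Or.inl rfl)).and
    (main 1 (-1) (Or.inl rfl) (Or.inr rfl))).and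
    ((main (-1) 1 (Or.inr rfl) (Or.inl rfl)).and
    (main (-1) (-1) (Or.inr rfl) (Or.inr rfl)))
  obtain ⟨δ, hδ, H⟩ := eventually_germ_iff.1 all
  refine ⟨δ, hδ, fun x hx u g hug hg => ?_⟩
  rcases eq_or_ne g 0 with rfl | hg0
  · rw [abs_zero, abs_eq_zero] at hug
    subst hug
    exact ⟨0, 0, by simp, by simp, by simp [hP.fst.flow_zero, hP.snd.flow_zero]⟩
  · obtain ⟨⟨h1, h2⟩, h3, h4⟩ := H x hx |g| (abs_pos.2 hg0) hg
    simp only [sq_abs] at h1 h2 h3 h4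
    obtain ⟨a, ha, hu⟩ := sgn u
    obtain ⟨b, hb, hg'⟩ := sgn g
    rw [hug] at hu
    have h5 : ∃ α β, |α| ≤ 2 * K * g ^ 2 ∧ |β| ≤ 2 * K * g ^ 2 ∧
        dist (G (F x (a * |g|)) (b * |g|)) (F (G x (b * |g| + β)) (a * |g| + α)) ≤
          ε * g ^ 2 := by
      rcases ha with rfl | rfl <;> rcases hb with rfl | rfl <;> assumption
    rwa [← hu, ← hg'] at h5

theorem exists_square_swap_of_isCompact (hP : PairBox X Y F G z r K) {S : Set M}
    (hS : IsCompact S) (hSz : S ⊆ ball z r) {ε : ℝ} (hε : 0 < ε) :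
    ∃ δ > 0, ∀ x ∈ S, ∀ u g : ℝ, |u| = |g| → |g| < δ →
      ∃ α β, |α| ≤ 2 * K * g ^ 2 ∧ |β| ≤ 2 * K * g ^ 2 ∧
        dist (G (F x u) g) (F (G x (g + β)) (u + α)) ≤ ε * g ^ 2 := by
  refine hS.induction_on (p := fun S => ∃ δ > 0, ∀ x ∈ S, ∀ u g : ℝ, |u| = |g| → |g| < δ →
      ∃ α β, |α| ≤ 2 * K * g ^ 2 ∧ |β| ≤ 2 * K * g ^ 2 ∧
        dist (G (F x u) g) (F (G x (g + β)) (u + α)) ≤ ε * g ^ 2) ?_ ?_ ?_ ?_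
  · exact ⟨1, one_pos, fun x hx => hx.elim⟩
  · rintro s t hst ⟨δ, hδ, h⟩
    exact ⟨δ, hδ, fun x hx => h x (hst hx)⟩
  · rintro s t ⟨δ, hδ, h⟩ ⟨δ', hδ', h'⟩
    refine ⟨min δ δ', by positivity, fun x hx u g hug hg => ?_⟩
    rcases hx with hx | hx
    · exact h x hx u g hug (hg.trans_le (min_le_left _ _))
    · exact h' x hx u g hug (hg.trans_le (min_le_right _ _))
  · intro x hx
    have hx' := mem_ball.1 (hSz hx)
    have hP' : PairBox X Y F G x (r - dist x z) K := hP.mono (by linarith) (by linarith)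
    obtain ⟨δ, hδ, h⟩ := hP'.exists_square_swap hε
    exact ⟨ball x δ, mem_nhdsWithin_of_mem_nhds (ball_mem_nhds x hδ), δ, hδ, h⟩

end PairBox

/-- The surface patch swept out from `x₀` by the flows `G` and `F`. -/
def sheet (F G : M → ℝ → M) (x₀ : M) (q : ℝ × ℝ) : M := F (G x₀ q.2) q.1

/-- A size `ρ` small compared with the constants of a box. -/
structure IsSmallSize (r K ρ : ℝ) : Prop where
  pos : 0 < ρ
  lt : 4 * ρ < r
  mul_lt : 8 * K * ρ < r
  mul_le : 8 * K * ρ ≤ 1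

theorem exists_isSmallSize {r K : ℝ} (hr : 0 < r) (hK : 0 < K) :
    ∃ ρ₀ > 0, ∀ ρ, 0 < ρ → ρ < ρ₀ → IsSmallSize r K ρ := by
  refine ⟨min r 1 / (8 * (K + 1)), by positivity, fun ρ h0 h1 => ?_⟩
  rw [lt_div_iff₀ (by positivity)] at h1
  have hm1 : min r 1 ≤ r := min_le_left _ _
  have hm2 : min r 1 ≤ 1 := min_le_right _ _
  have : 0 < K * ρ := by positivity
  exact ⟨h0, by linarith, by linarith, by linarith⟩

namespace PairBox

variable {X Y F G : M → ℝ → M} {z : M} {r K ρ : ℝ}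

theorem dist_sheet_le (hP : PairBox X Y F G z r K) (hρ : IsSmallSize r K ρ) {s t : ℝ}
    (hs : |s| ≤ 2 * ρ) (ht : |t| ≤ 2 * ρ) :
    dist (G z s) z ≤ K * |s| ∧ dist (sheet F G z (t, s)) z ≤ K * |s| + K * |t| := by
  obtain ⟨h1, h2, h3, h4⟩ := hρ
  have hK := hP.fst.K_pos
  have d1 := hP.snd.flow_dist (mem_ball_self hP.fst.r_pos) (t := s) (by linarith)
  rw [dist_self, zero_add] at d1
  have : K * |s| ≤ K * (2 * ρ) := by gcongr
  have d2 := hP.fst.flow_dist (x := G z s) (by rw [mem_ball]; linarith) (t := t) (by linarith)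
  exact ⟨d1, by simp only [sheet]; linarith⟩

theorem sheet_mem (hP : PairBox X Y F G z r K) (hρ : IsSmallSize r K ρ) {s t : ℝ}
    (hs : |s| ≤ 2 * ρ) (ht : |t| ≤ 2 * ρ) : G z s ∈ ball z r ∧ sheet F G z (t, s) ∈ ball z r := by
  obtain ⟨d1, d2⟩ := hP.dist_sheet_le hρ hs ht
  obtain ⟨h1, h2, h3, h4⟩ := hρ
  have hK := hP.fst.K_pos
  have e1 : K * |s| ≤ K * (2 * ρ) := by gcongr
  have e2 : K * |t| ≤ K * (2 * ρ) := by gcongr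
  have : 0 < K * ρ := by positivity
  exact ⟨by rw [mem_ball]; linarith, by rw [mem_ball]; linarith⟩

theorem _root_.FlowBox.dist_flow_flow_le {X F : M → ℝ → M} (h : FlowBox X F z r K) {x : M} {s t : ℝ}
    (hx : x ∈ ball z r) (hxt : F x t ∈ ball z r) (hs : |s| < r) (ht : |t| < r)
    (hst : |s - t| < r) : dist (F x s) (F x t) ≤ K * |s - t| := by
  have e := h.flow_add x hx t (s - t) ht hst (by rwa [add_sub_cancel])
  rw [add_sub_cancel] at e
  rw [e]
  exact h.flow_speed _ hxt _ hst

theorem dist_sheet_sheet_le (hP : PairBox X Y F G z r K) (hρ : IsSmallSize r K ρ)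
    {s t s' t' : ℝ} (hs : |s| ≤ 2 * ρ) (ht : |t| ≤ 2 * ρ) (hs' : |s'| ≤ 2 * ρ)
    (ht' : |t'| ≤ 2 * ρ) (htt : |t - t'| < r) (hss : |s - s'| < r) :
    dist (sheet F G z (t, s)) (sheet F G z (t', s')) ≤ K * |t - t'| + 2 * K * |s - s'| := by
  obtain ⟨m1, m2⟩ := hP.sheet_mem hρ hs ht
  obtain ⟨m3, m4⟩ := hP.sheet_mem hρ hs' ht'
  obtain ⟨-, m5⟩ := hP.sheet_mem hρ hs ht'
  have hρ1 := hρ.lt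
  have hK := hP.fst.K_pos
  have hρ0 := hρ.pos
  have hρ4 := hρ.mul_le
  have d1 := hP.fst.dist_flow_flow_le (x := G z s) (s := t) (t := t') m1 m5 (by linarith)
    (by linarith) htt
  have d2 := hP.fst.flow_lip _ m1 _ m3 t' (by linarith)
  have d3 := hP.snd.dist_flow_flow_le (mem_ball_self hP.fst.r_pos) m3 (s := s) (by linarith)
    (by linarith) hss
  have e : K * |t'| ≤ K * (2 * ρ) := by gcongr
  have d4 : (1 + K * |t'|) * dist (G z s) (G z s') ≤ 2 * (K * |s - s'|) := by
    gcongr; linarith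
  have := dist_triangle (sheet F G z (t, s)) (F (G z s) t') (sheet F G z (t', s'))
  simp only [sheet] at *
  linarith

theorem continuousOn_sheet (hP : PairBox X Y F G z r K) (hρ : IsSmallSize r K ρ) :
    ContinuousOn (sheet F G z) (Icc (-(2 * ρ)) (2 * ρ) ×ˢ Icc (-(2 * ρ)) (2 * ρ)) := by
  have hr := hP.fst.r_pos
  rintro ⟨t, s⟩ ⟨ht, hs⟩
  have h1 : Filter.Tendsto (fun q : ℝ × ℝ => K * |q.1 - t| + 2 * K * |q.2 - s|)
      (nhdsWithin (t, s) (Icc (-(2 * ρ)) (2 * ρ) ×ˢ Icc (-(2 * ρ)) (2 * ρ))) (nhds 0) := by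
    have : Continuous (fun q : ℝ × ℝ => K * |q.1 - t| + 2 * K * |q.2 - s|) := by fun_prop
    have := (this.tendsto (t, s)).mono_left (nhdsWithin_le_nhds
      (s := Icc (-(2 * ρ)) (2 * ρ) ×ˢ Icc (-(2 * ρ)) (2 * ρ)))
    simpa using this
  have c1 : Continuous fun q : ℝ × ℝ => |q.1 - t| := by fun_prop
  have c2 : Continuous fun q : ℝ × ℝ => |q.2 - s| := by fun_prop
  refine tendsto_iff_dist_tendsto_zero.2 (squeeze_zero' (Filter.Eventually.of_forall
    fun _ => dist_nonneg) ?_ h1)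
  filter_upwards [self_mem_nhdsWithin, mem_nhdsWithin_of_mem_nhds
    ((c1.tendsto (t, s)).eventually_lt_const (u := r) (by simpa using hr)),
    mem_nhdsWithin_of_mem_nhds ((c2.tendsto (t, s)).eventually_lt_const (u := r) (by simpa using hr))]
    with q hq h2 h3
  exact hP.dist_sheet_sheet_le hρ (abs_le.2 hq.2) (abs_le.2 hq.1) (abs_le.2 hs) (abs_le.2 ht) h2 h3

end PairBox

theorem exists_abs_eq_of_le_abs {τ g : ℝ} (h : |g| ≤ |τ|) :
    ∃ u : ℝ, |u| = |g| ∧ |τ - u| = |τ| - |g| := by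
  rcases le_total 0 τ with h0 | h0
  · rw [abs_of_nonneg h0] at h ⊢
    exact ⟨|g|, abs_abs g, abs_of_nonneg (by linarith)⟩
  · rw [abs_of_nonpos h0] at h ⊢
    refine ⟨-|g|, by rw [abs_neg, abs_abs], ?_⟩
    rw [abs_of_nonpos (by linarith)]
    ring

namespace PairBox

variable {X Y F G : M → ℝ → M} {z : M} {r K ρ : ℝ}

set_option maxHeartbeats 1000000 in
theorem sweep_induction (hP : PairBox X Y F G z r K) (hρ : IsSmallSize r K ρ) {ε δ h₀ : ℝ}
    (hε : 0 ≤ ε) (h₀pos : 0 < h₀) (h₀ρ : 2 * h₀ ≤ ρ) (h₀δ : 2 * h₀ < δ)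
    (hsq : ∀ s t : ℝ, |s| ≤ ρ → |t| ≤ ρ → ∀ u g : ℝ, |u| = |g| → |g| < δ →
      ∃ α β, |α| ≤ 2 * K * g ^ 2 ∧ |β| ≤ 2 * K * g ^ 2 ∧
        dist (G (F (sheet F G z (t, s)) u) g) (F (G (sheet F G z (t, s)) (g + β)) (u + α)) ≤
          ε * g ^ 2)
    {s : ℝ} (hs : |s| ≤ ρ) (n : ℕ) :
    ∀ τ g : ℝ, |τ| ≤ ρ → |τ| ≤ n * h₀ / 2 → h₀ / 2 + 4 * K * h₀ * |τ| ≤ |g| →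
      |g| ≤ 2 * h₀ - 4 * K * h₀ * |τ| →
      ∃ T g', |T - τ| ≤ 4 * K * h₀ * |τ| ∧ |g'| ≤ 2 * h₀ ∧
        dist (G (sheet F G z (τ, s)) g) (sheet F G z (T, s + g')) ≤
          (4 * K * h₀ ^ 2 + 2 * ε * h₀ * |τ|) * (1 + 4 * K * |τ|) := by
  have hK := hP.fst.K_pos
  have hr := hP.fst.r_pos
  obtain ⟨ρ1, ρ2, ρ3, ρ4⟩ := id hρ
  have hKh : 0 < K * h₀ := by positivity
  have hKhρ : K * h₀ ≤ K * (ρ / 2) := by gcongr; linarith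
  have base : ∀ τ g : ℝ, |τ| ≤ ρ → |g| ≤ 2 * h₀ - 4 * K * h₀ * |τ| → |τ| ≤ |g| →
      ∃ T g', |T - τ| ≤ 4 * K * h₀ * |τ| ∧ |g'| ≤ 2 * h₀ ∧
        dist (G (sheet F G z (τ, s)) g) (sheet F G z (T, s + g')) ≤
          (4 * K * h₀ ^ 2 + 2 * ε * h₀ * |τ|) * (1 + 4 * K * |τ|) := by
    intro τ g hτ hg hτg
    have h1 : 0 ≤ 4 * K * h₀ * |τ| := by positivity
    refine ⟨τ, g, by simpa using h1, by linarith, ?_⟩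
    have hsg : |s + g| < r := (abs_add_le _ _).trans_lt (by linarith)
    have e := hP.snd.flow_add z (mem_ball_self hr) s g (by linarith) (by linarith) hsg
    have m := (hP.sheet_mem hρ (s := s) (t := 0) (by linarith) (by simp; linarith)).1
    have d := hP.close_flow _ m g τ (by linarith) (by linarith)
    simp only [sheet]
    rw [e]
    refine d.trans ?_
    have h2 : K * (|g| * |τ|) ≤ K * ((2 * h₀) * (2 * h₀)) := by
      have : |g| ≤ 2 * h₀ := by linarith
      gcongr
      linarith
    have h3 : 0 ≤ 2 * ε * h₀ * |τ| := by positivity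
    have h4 : 0 ≤ (4 * K * h₀ ^ 2 + 2 * ε * h₀ * |τ|) * (4 * K * |τ|) := by positivity
    nlinarith
  induction n with
  | zero =>
    intro τ g hτ hτn _ hg
    refine base τ g hτ hg ?_
    simp only [Nat.cast_zero, zero_mul, zero_div] at hτn
    linarith [abs_nonneg g]
  | succ n ih =>
    intro τ g hτ hτn hg1 hg2
    rcases le_total |τ| |g| with hτg | hτg
    · exact base τ g hτ hg2 hτg
    obtain ⟨u, hu, hτu⟩ := exists_abs_eq_of_le_abs hτg
    have hp : 0 ≤ 4 * K * h₀ * |τ| := by positivity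
    have hg0 : 0 ≤ |g| := abs_nonneg g
    have hg2h : |g| ≤ 2 * h₀ := by linarith
    have hτu' : |τ - u| ≤ ρ := by linarith
    obtain ⟨α, β, hα, hβ, hd⟩ := hsq s (τ - u) hs hτu' u g hu (by linarith)
    have hgg : 2 * K * g ^ 2 ≤ 4 * K * h₀ * |g| := by
      rw [← sq_abs]
      have : 0 ≤ 2 * K * |g| := by positivity
      nlinarith
    have b1 : |g + β| ≤ |g| + |β| := abs_add_le _ _
    have b2 : |g| - |β| ≤ |g + β| := by
      have := abs_sub_abs_le_abs_sub g (-β)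
      rwa [abs_neg, sub_neg_eq_add] at this
    have hp' : 4 * K * h₀ * |τ - u| = 4 * K * h₀ * |τ| - 4 * K * h₀ * |g| := by rw [hτu]; ring
    push_cast at hτn
    obtain ⟨T, g', hT, hg', hE⟩ := ih (τ - u) (g + β) hτu' (by linarith) (by linarith)
      (by linarith)
    have hp'' : 0 ≤ 4 * K * h₀ * |τ - u| := by positivity
    have hTρ : 4 * K * h₀ * |τ - u| ≤ h₀ := by
      have : 4 * K * h₀ * |τ - u| ≤ 4 * K * h₀ * ρ := by gcongr
      nlinarith
    have habsT : |T| ≤ |τ - u| + |T - (τ - u)| := by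
      have := abs_add_le (τ - u) (T - (τ - u))
      rwa [add_sub_cancel] at this
    have hKg : 4 * K * h₀ * |g| ≤ |g| := by
      have : 4 * K * h₀ ≤ 1 := by linarith
      nlinarith
    have huα : |u + α| ≤ 2 * |g| := (abs_add_le _ _).trans (by linarith)
    have hsg : |s + g'| ≤ 2 * ρ := (abs_add_le _ _).trans (by linarith)
    have hTT : |T| ≤ 2 * ρ := by linarith
    have hTu : |T + (u + α)| < r := (abs_add_le _ _).trans_lt (by linarith)
    refine ⟨T + (u + α), g', ?_, hg', ?_⟩
    · have := abs_add_le (T - (τ - u)) α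
      have e : T - (τ - u) + α = T + (u + α) - τ := by ring
      rw [e] at this
      linarith
    · have my := (hP.sheet_mem hρ (s := s) (t := 0) (by linarith) (by simp; linarith)).1
      have mp := (hP.sheet_mem hρ (s := s) (t := τ - u) (by linarith) (by linarith)).2
      have dp := (hP.dist_sheet_le hρ (s := s) (t := τ - u) (by linarith) (by linarith)).2
      obtain ⟨mq, mq'⟩ := hP.sheet_mem hρ hsg hTT
      have e1 : F (sheet F G z (τ - u, s)) u = sheet F G z (τ, s) := by
        have := hP.fst.flow_add _ my (τ - u) u (by linarith) (by linarith)
          (by rw [sub_add_cancel]; linarith)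
        rw [sub_add_cancel] at this
        exact this.symm
      have e2 : F (sheet F G z (T, s + g')) (u + α) = sheet F G z (T + (u + α), s + g') :=
        (hP.fst.flow_add _ mq T (u + α) (by linarith) (by linarith) hTu).symm
      have dG := hP.snd.flow_dist mp (t := g + β) (by linarith)
      have hKs : K * |s| ≤ K * ρ := by gcongr
      have hKτ : K * |τ - u| ≤ K * ρ := by gcongr
      have hKg' : K * |g + β| ≤ K * (2 * h₀) := by gcongr; linarith
      have hKρ : 0 < K * ρ := by positivity
      have mG : G (sheet F G z (τ - u, s)) (g + β) ∈ ball z r := by rw [mem_ball]; linarith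
      have lip := hP.fst.flow_lip _ mG _ mq' (u + α) (by linarith)
      rw [e2] at lip
      rw [e1] at hd
      set A := 4 * K * h₀ ^ 2 + 2 * ε * h₀ * |τ - u| with hA
      have hA0 : 0 ≤ A := by positivity
      have hA' : 4 * K * h₀ ^ 2 + 2 * ε * h₀ * |τ| = A + 2 * ε * h₀ * |g| := by
        rw [hA, hτu]; ring
      have f1 : (1 + K * |u + α|) *
          dist (G (sheet F G z (τ - u, s)) (g + β)) (sheet F G z (T, s + g')) ≤
          (1 + K * (2 * |g|)) * (A * (1 + 4 * K * |τ - u|)) := by gcongr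
      have f2 : (1 + K * (2 * |g|)) * (1 + 4 * K * |τ - u|) ≤ 1 + 4 * K * |τ| := by
        have e3 : 4 * K * |τ| = 4 * K * |τ - u| + 4 * K * |g| := by rw [hτu]; ring
        have e4 : K * |g| * (4 * K * |τ - u|) ≤ K * |g| * 1 := by gcongr; linarith
        have : 0 ≤ K * |g| := by positivity
        rw [e3]
        linarith
      have f3 : ε * g ^ 2 ≤ 2 * ε * h₀ * |g| := by
        rw [← sq_abs]
        have : 0 ≤ ε * |g| := by positivity
        nlinarith
      have f4 : 0 ≤ 2 * ε * h₀ * |g| * (4 * K * |τ|) := by positivity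
      have f5 := mul_le_mul_of_nonneg_left f2 hA0
      rw [hA']
      calc _ ≤ _ := dist_triangle _
            (F (G (sheet F G z (τ - u, s)) (g + β)) (u + α)) _
        _ ≤ ε * g ^ 2 + (1 + K * (2 * |g|)) * (A * (1 + 4 * K * |τ - u|)) :=
          add_le_add hd (lip.trans f1)
        _ = ε * g ^ 2 + A * ((1 + K * (2 * |g|)) * (1 + 4 * K * |τ - u|)) := by ring
        _ ≤ 2 * ε * h₀ * |g| + A * (1 + 4 * K * |τ|) := add_le_add f3 f5
        _ ≤ _ := by linarith only [f4]

/-- Moving a point of the sheet along `G` stays close to the sheet. -/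
theorem exists_near_sheet (hP : PairBox X Y F G z r K) (hρ : IsSmallSize r K ρ) {ε : ℝ}
    (hε : 0 < ε) : ∃ δ > 0, ∀ τ s h : ℝ, |τ| ≤ ρ → |s| ≤ ρ → |h| < δ →
      ∃ T g, |T - τ| ≤ |h| ∧ |g| ≤ 2 * |h| ∧
        dist (G (sheet F G z (τ, s)) h) (sheet F G z (T, s + g)) ≤ ε * |h| := by
  have hK := hP.fst.K_pos
  have hr := hP.fst.r_pos
  obtain ⟨ρ1, ρ2, ρ3, ρ4⟩ := id hρ
  set Q := Icc (-ρ) ρ ×ˢ Icc (-ρ) ρ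
  have hQ : IsCompact (sheet F G z '' Q) := by
    refine (isCompact_Icc.prod isCompact_Icc).image_of_continuousOn
      ((hP.continuousOn_sheet hρ).mono ?_)
    have : Icc (-ρ) ρ ⊆ Icc (-(2 * ρ)) (2 * ρ) := Icc_subset_Icc (by linarith) (by linarith)
    exact prod_mono this this
  have hQz : sheet F G z '' Q ⊆ ball z r := by
    rintro _ ⟨⟨t, s⟩, ⟨ht, hs⟩, rfl⟩
    exact (hP.sheet_mem hρ ((abs_le.2 hs).trans (by linarith))
      ((abs_le.2 ht).trans (by linarith))).2
  set ε' := ε / (8 * ρ) with hε'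
  have hε'0 : 0 < ε' := by positivity
  obtain ⟨δ, hδ, hsq⟩ := hP.exists_square_swap_of_isCompact hQ hQz hε'0
  refine ⟨min (min (δ / 2) (ρ / 2)) (ε / (16 * K)), by positivity, fun τ s h hτ hs hh => ?_⟩
  obtain ⟨hh, h3⟩ := lt_min_iff.1 hh
  obtain ⟨h1, h2⟩ := lt_min_iff.1 hh
  rcases eq_or_ne h 0 with rfl | h0
  · exact ⟨τ, 0, by simp, by simp, by simp [hP.snd.flow_zero]⟩
  have hpos := abs_pos.2 h0
  obtain ⟨n, hn⟩ := exists_nat_gt (2 * ρ / |h|)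
  rw [div_lt_iff₀ hpos] at hn
  have hsmall : 4 * K * |h| * |τ| ≤ |h| / 2 := by
    have : K * |τ| ≤ K * ρ := by gcongr
    nlinarith
  obtain ⟨T, g, hT, hg, hd⟩ := hP.sweep_induction hρ hε'0.le hpos (by linarith) (by linarith)
    (fun s t hs ht => hsq _ ⟨(t, s), ⟨abs_le.1 ht, abs_le.1 hs⟩, rfl⟩) hs n τ h hτ (by linarith)
    (by linarith) (by linarith)
  refine ⟨T, g, by linarith, hg, hd.trans ?_⟩
  have e1 : 4 * K * |τ| ≤ 1 := by
    have : K * |τ| ≤ K * ρ := by gcongr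
    linarith
  have e2 : 2 * ε' * |h| * |τ| ≤ ε * |h| / 4 := by
    have : 2 * ε' * |h| * |τ| ≤ 2 * ε' * |h| * ρ := by gcongr
    have e : 2 * ε' * |h| * ρ = ε * |h| / 4 := by rw [hε']; field_simp; norm_num
    linarith
  have e3 : 4 * K * |h| ^ 2 ≤ ε * |h| / 4 := by
    rw [lt_div_iff₀ (by positivity)] at h3
    nlinarith
  calc _ ≤ (ε * |h| / 4 + ε * |h| / 4) * (1 + 1) := by gcongr
    _ = _ := by ring

end PairBox

theorem abs_clamp_le (y : ℝ) : |max (-1) (min 1 y)| ≤ |y| := by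
  have h := abs_nonneg y
  refine abs_le.2 ⟨?_, max_le (by linarith) ((min_le_right _ _).trans (le_abs_self y))⟩
  rcases le_total 1 y with h1 | h1
  · rw [min_eq_left h1]; exact le_trans (by linarith) (le_max_right _ _)
  · rw [min_eq_right h1]; exact (neg_abs_le y).trans (le_max_right _ _)

namespace PairBox

variable {X Y F G : M → ℝ → M} {z : M} {r K ρ : ℝ}

theorem le_dist_flow (hP : PairBox X Y F G z r K) {δ : ℝ}
    (htr : ∀ x ∈ ball z δ, ∀ s t : ℝ, |s| < δ → |t| < δ → δ * (|s| + |t|) ≤ dist (X x s) (Y x t))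
    {x : M} (hx : x ∈ ball z r) (hxδ : x ∈ ball z δ) {s t : ℝ} (hs : |s| < min r δ)
    (ht : |t| < min r δ) (hsK : 2 * K * |s| ≤ δ) (htK : 2 * K * |t| ≤ δ) :
    δ / 2 * (|s| + |t|) ≤ dist (F x s) (G x t) := by
  have h0 := htr x hxδ s t (hs.trans_le (min_le_right _ _)) (ht.trans_le (min_le_right _ _))
  have h1 := hP.fst.near x hx s (hs.trans_le (min_le_left _ _))
  have h2 := hP.snd.near x hx t (ht.trans_le (min_le_left _ _))
  have h3 := dist_triangle4 (X x s) (F x s) (G x t) (Y x t)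
  rw [dist_comm (G x t)] at h3
  have h4 := mul_le_mul_of_nonneg_right hsK (abs_nonneg s)
  have h5 := mul_le_mul_of_nonneg_right htK (abs_nonneg t)
  linarith

/-- The sheet of a transverse pair has a Lipschitz inverse. -/
theorem exists_le_dist_sheet (hP : PairBox X Y F G z r K) (htr : Transverse X Y) :
    ∃ ρ₁ > 0, ∃ c > 0, ∀ ρ, IsSmallSize r K ρ → ρ < ρ₁ → ∀ s t s' t' : ℝ,
      |s| ≤ ρ → |t| ≤ ρ → |s'| ≤ ρ → |t'| ≤ ρ →
        c * (|t - t'| + |s - s'|) ≤ dist (sheet F G z (t, s)) (sheet F G z (t', s')) := by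
  obtain ⟨δ, hδ, htr⟩ := htr z
  have hK := hP.fst.K_pos
  have hr := hP.fst.r_pos
  refine ⟨min (δ / 2) (δ / (4 * K)), by positivity, δ / 4, by positivity,
    fun ρ hρ hρ1 s t s' t' hs ht hs' ht' => ?_⟩
  obtain ⟨k1, k2⟩ := lt_min_iff.1 hρ1
  rw [lt_div_iff₀ (by positivity)] at k2
  obtain ⟨ρ1, ρ2, ρ3, ρ4⟩ := id hρ
  have hss : |s' - s| ≤ 2 * ρ := (abs_sub _ _).trans (by linarith)
  have htt : |t - t'| ≤ 2 * ρ := (abs_sub _ _).trans (by linarith)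
  obtain ⟨m1, m2⟩ := hP.sheet_mem hρ (s := s) (t := t) (by linarith) (by linarith)
  obtain ⟨m3, m4⟩ := hP.sheet_mem hρ (s := s') (t := t') (by linarith) (by linarith)
  have d1 := (hP.dist_sheet_le hρ (s := s) (t := t) (by linarith) (by linarith)).1
  have e1 : K * |s| ≤ K * ρ := by gcongr
  have e2 : 2 * K * |t - t'| ≤ 2 * K * (2 * ρ) := by gcongr
  have e3 : 2 * K * |s' - s| ≤ 2 * K * (2 * ρ) := by gcongr
  have e4 : K * |t'| ≤ K * ρ := by gcongr
  have low := hP.le_dist_flow htr m1 (by rw [mem_ball]; linarith) (s := t - t') (t := s' - s)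
    (lt_min (by linarith) (by linarith)) (lt_min (by linarith) (by linarith)) (by linarith)
    (by linarith)
  have f1 : F (sheet F G z (t, s)) (-t') = F (G z s) (t - t') := by
    rw [sub_eq_add_neg]
    exact (hP.fst.flow_add _ m1 t (-t') (by linarith) (by rw [abs_neg]; linarith)
      (by rw [← sub_eq_add_neg]; linarith)).symm
  have f2 : F (sheet F G z (t', s')) (-t') = G z s' := by
    have := hP.fst.flow_add _ m3 t' (-t') (by linarith) (by rw [abs_neg]; linarith)
      (by simpa using hr)
    rw [add_neg_cancel, hP.fst.flow_zero] at this
    exact this.symm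
  have f3 : G z s' = G (G z s) (s' - s) := by
    have := hP.snd.flow_add z (mem_ball_self hr) s (s' - s) (by linarith) (by linarith)
      (by rw [add_sub_cancel]; linarith)
    rwa [add_sub_cancel] at this
  have lip := hP.fst.flow_lip _ m2 _ m4 (-t') (by rw [abs_neg]; linarith)
  rw [f1, f2, f3, abs_neg] at lip
  have up : (1 + K * |t'|) * dist (sheet F G z (t, s)) (sheet F G z (t', s')) ≤
      2 * dist (sheet F G z (t, s)) (sheet F G z (t', s')) := by gcongr; linarith
  rw [abs_sub_comm s s']
  linarith

/-- The open sheet is tangent to every combination of the two arc fields. -/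
theorem setTangentTo_sheet (hP : PairBox X Y F G z r K) (hρ : IsSmallSize r K ρ) {c : ℝ}
    (hc : 0 < c) (hlow : ∀ s t s' t' : ℝ, |s| ≤ ρ → |t| ≤ ρ → |s'| ≤ ρ → |t'| ≤ ρ →
      c * (|t - t'| + |s - s'|) ≤ dist (sheet F G z (t, s)) (sheet F G z (t', s')))
    {a b : M → ℝ} (ha : ∃ L, LipschitzWith L a) (hb : ∃ L, LipschitzWith L b) :
    SetTangentTo (sheet F G z '' (Ioo (-ρ) ρ ×ˢ Ioo (-ρ) ρ))
      (sumArc (smulArc a X) (smulArc b Y)) := by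
  obtain ⟨A₁, hA₁, hA₁a⟩ := lipschitz_locally_bounded ha z
  obtain ⟨A₂, hA₂, hA₂b⟩ := lipschitz_locally_bounded hb z
  set A := max A₁ A₂
  have hA : 0 < A := lt_max_of_lt_left hA₁
  have hK := hP.fst.K_pos
  have hr := hP.fst.r_pos
  have hr1 := hP.fst.r_le
  obtain ⟨ρ1, ρ2, ρ3, ρ4⟩ := id hρ
  rintro _ ⟨⟨t₁, s₁⟩, ⟨ht₁, hs₁⟩, rfl⟩
  have ht₁ : |t₁| < ρ := abs_lt.2 ht₁
  have hs₁ : |s₁| < ρ := abs_lt.2 hs₁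
  obtain ⟨m, hm, hmt, hms⟩ : ∃ m > 0, |t₁| ≤ ρ - m ∧ |s₁| ≤ ρ - m :=
    ⟨min (ρ - |t₁|) (ρ - |s₁|), lt_min (by linarith) (by linarith),
      by linarith [min_le_left (ρ - |t₁|) (ρ - |s₁|)],
      by linarith [min_le_right (ρ - |t₁|) (ρ - |s₁|)]⟩
  refine ⟨c * (m / 2), by positivity, fun ε hε => ?_⟩
  obtain ⟨δ, hδ, hnear⟩ := hP.exists_near_sheet hρ (ε := ε / (2 * A)) (by positivity)
  refine ⟨min (min δ (m / 6) / A) (min (r / (2 * K * A)) (ε / (6 * K * A ^ 2))), by positivity,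
    ?_⟩
  rintro _ ⟨⟨⟨t, s⟩, ⟨ht, hs⟩, rfl⟩, hx⟩ θ hθ0 hθ
  have ht : |t| < ρ := abs_lt.2 ht
  have hs : |s| < ρ := abs_lt.2 hs
  set x := sheet F G z (t, s)
  obtain ⟨hθ1, hθ2⟩ := lt_min_iff.1 hθ
  obtain ⟨hθ2, hθ3⟩ := lt_min_iff.1 hθ2
  rw [lt_div_iff₀ (by positivity)] at hθ1 hθ2 hθ3
  obtain ⟨hθδ, hθm⟩ := lt_min_iff.1 hθ1
  have hclose : |t - t₁| + |s - s₁| < m / 2 :=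
    lt_of_mul_lt_mul_left ((hlow s t s₁ t₁ hs.le ht.le hs₁.le ht₁.le).trans_lt hx) hc.le
  have htm : |t| ≤ ρ - m / 2 := by
    have := abs_add_le (t - t₁) t₁
    rw [sub_add_cancel] at this
    linarith [abs_nonneg (s - s₁)]
  have hsm : |s| ≤ ρ - m / 2 := by
    have := abs_add_le (s - s₁) s₁
    rw [sub_add_cancel] at this
    linarith [abs_nonneg (t - t₁)]
  have e1 : K * |s| ≤ K * ρ := by gcongr
  have e2 : K * |t| ≤ K * ρ := by gcongr
  have dx := (hP.dist_sheet_le hρ (s := s) (t := t) (by linarith) (by linarith)).2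
  obtain ⟨my, mx⟩ := hP.sheet_mem hρ (s := s) (t := t) (by linarith) (by linarith)
  have mρ : m ≤ ρ := by linarith [abs_nonneg s₁]
  set α := max (-1) (min 1 (a x * θ)) with hα
  have hαA : |α| ≤ |θ| * A := by
    refine (abs_clamp_le _).trans ?_
    rw [abs_mul, mul_comm]
    gcongr
    exact (hA₁a x (ball_subset_ball hr1 mx)).trans (le_max_left _ _)
  have hKα : K * |α| < r / 2 := by
    have : K * |α| ≤ K * (|θ| * A) := by gcongr
    linarith
  set p := X x α with hp
  have dp := hP.fst.arc_speed x mx α (by linarith)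
  have mp : p ∈ ball z r := by
    have := dist_triangle p x z
    rw [mem_ball]
    linarith
  set β := max (-1) (min 1 (b p * θ)) with hβ
  have hβA : |β| ≤ |θ| * A := by
    refine (abs_clamp_le _).trans ?_
    rw [abs_mul, mul_comm]
    gcongr
    exact (hA₂b p (ball_subset_ball hr1 mp)).trans (le_max_right _ _)
  have hαβ : |t + α| ≤ |t| + |α| := abs_add_le _ _
  have e3 : F x α = sheet F G z (t + α, s) :=
    (hP.fst.flow_add _ my t α (by linarith) (by linarith) (by linarith)).symm
  have mq : F x α ∈ ball z r := by
    rw [e3]; exact (hP.sheet_mem hρ (by linarith) (by linarith)).2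
  obtain ⟨T, g, hT, hg, hd⟩ := hnear (t + α) s β (by linarith) (by linarith) (by linarith)
  rw [← e3] at hd
  have hS : sheet F G z (T, s + g) ∈ sheet F G z '' (Ioo (-ρ) ρ ×ˢ Ioo (-ρ) ρ) := by
    refine mem_image_of_mem _ ⟨abs_lt.1 ?_, abs_lt.1 ((abs_add_le _ _).trans_lt (by linarith))⟩
    have := abs_add_le (T - (t + α)) (t + α)
    rw [sub_add_cancel] at this
    linarith
  have n1 := hP.fst.near x mx α (by linarith)
  have n2 := hP.snd.near p mp β (by linarith)
  have n3 := hP.snd.flow_lip p mp _ mq β (by linarith)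
  have hKβ : K * |β| ≤ 1 := by
    have : K * |β| ≤ K * ρ := by gcongr; linarith
    linarith
  have n4 : (1 + K * |β|) * dist p (F x α) ≤ (1 + 1) * (K * (|θ| * A) ^ 2) := by
    gcongr
    exact n1.trans (by gcongr)
  have n5 : K * |β| ^ 2 ≤ K * (|θ| * A) ^ 2 := by gcongr
  have n6 : ε / (2 * A) * |β| ≤ ε / 2 * |θ| := by
    calc _ ≤ ε / (2 * A) * (|θ| * A) := by gcongr
      _ = _ := by field_simp
  have n7 : 3 * (K * (|θ| * A) ^ 2) ≤ ε / 2 * |θ| := by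
    have := mul_le_mul_of_nonneg_right hθ3.le hθ0.le
    linarith
  have tri := dist_triangle4 (Y p β) (G p β) (G (F x α) β) (sheet F G z (T, s + g))
  refine (infDist_le_dist_of_mem hS).trans ?_
  change dist (Y p β) _ ≤ _
  linarith

/-- The open sheet is a two-dimensional topological manifold. -/
theorem nonempty_chartedSpace_sheet (hP : PairBox X Y F G z r K) (hρ : IsSmallSize r K ρ) {c : ℝ}
    (hc : 0 < c) (hlow : ∀ s t s' t' : ℝ, |s| ≤ ρ → |t| ≤ ρ → |s'| ≤ ρ → |t'| ≤ ρ →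
      c * (|t - t'| + |s - s'|) ≤ dist (sheet F G z (t, s)) (sheet F G z (t', s'))) :
    Nonempty (ChartedSpace (EuclideanSpace ℝ (Fin 2))
      (sheet F G z '' (Ioo (-ρ) ρ ×ˢ Ioo (-ρ) ρ))) := by
  set U : Set (ℝ × ℝ) := Ioo (-ρ) ρ ×ˢ Ioo (-ρ) ρ with hU
  have hUo : IsOpen U := isOpen_Ioo.prod isOpen_Ioo
  have hρ0 := hρ.pos
  have hdim : Module.finrank ℝ (ℝ × ℝ) = Module.finrank ℝ (EuclideanSpace ℝ (Fin 2)) := by simp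
  let e : (ℝ × ℝ) ≃L[ℝ] EuclideanSpace ℝ (Fin 2) := ContinuousLinearEquiv.ofFinrankEq hdim
  have hcont : Continuous (U.domRestrict (sheet F G z)) := by
    refine continuousOn_iff_continuous_domRestrict.1 ((hP.continuousOn_sheet hρ).mono ?_)
    have : Ioo (-ρ) ρ ⊆ Icc (-(2 * ρ)) (2 * ρ) :=
      Ioo_subset_Icc_self.trans (Icc_subset_Icc (by linarith) (by linarith))
    exact prod_mono this this
  have hanti : AntilipschitzWith (Real.toNNReal c⁻¹) (U.domRestrict (sheet F G z)) := by
    refine AntilipschitzWith.of_le_mul_dist fun ⟨⟨t, s⟩, ht, hs⟩ ⟨⟨t', s'⟩, ht', hs'⟩ => ?_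
    have h := hlow s t s' t' (abs_lt.2 hs).le (abs_lt.2 ht).le (abs_lt.2 hs').le (abs_lt.2 ht').le
    rw [Real.coe_toNNReal _ (by positivity), inv_mul_eq_div, le_div_iff₀ hc, mul_comm]
    refine le_trans ?_ h
    gcongr
    rw [Subtype.dist_eq, Prod.dist_eq, Real.dist_eq, Real.dist_eq]
    exact max_le_add_of_nonneg (abs_nonneg _) (abs_nonneg _)
  have hemb : Topology.IsEmbedding (U.domRestrict (sheet F G z)) :=
    hanti.isEmbedding hcont
  let f : sheet F G z '' U ≃ₜ U :=
    ((hemb.toHomeomorph).trans (Homeomorph.setCongr (range_domRestrict _ _))).symm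
  have hopen : Topology.IsOpenEmbedding fun x => e (f x) :=
    e.toHomeomorph.isOpenEmbedding.comp (hUo.isOpenEmbedding_subtypeVal.comp f.isOpenEmbedding)
  have : Nonempty (sheet F G z '' U) :=
    ⟨⟨_, mem_image_of_mem _ (show ((0 : ℝ), (0 : ℝ)) ∈ U by simp [hU, hρ0])⟩⟩
  exact ⟨hopen.singletonChartedSpace⟩

end PairBox

/-- Corollary of the local Frobenius theorem: if `X` and `Y`
close, are transverse, satisfy E1 and E2, are 2nd-order locally uniformly tangent
to their local flows, and `[X,Y] ∼ aX + bY` for some Lipschitz `a`, `b`, then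
through every point there is an integral surface of `X` and `Y`. -/
theorem local_frobenius_arcField_bracket
    {M : Type*} [MetricSpace M] (hM : LocallyComplete M) (X Y : M → ℝ → M)
    (hX : IsArcField X) (hY : IsArcField Y) (hclose : Close X Y)
    (htrans : Transverse X Y)
    (hXE1 : CondE1 X) (hXE2 : CondE2 X) (hYE1 : CondE1 Y) (hYE2 : CondE2 Y)
    (IX IY : M → Set ℝ) (F G : M → ℝ → M)
    (hF : ∀ x : M, IsSolutionCurve X (IX x) (F x) x ∧
      ∀ (J : Set ℝ) (τ : ℝ → M), IsSolutionCurve X J τ x →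
        J ⊆ IX x ∧ Set.EqOn τ (F x) J)
    (hG : ∀ x : M, IsSolutionCurve Y (IY x) (G x) x ∧
      ∀ (J : Set ℝ) (τ : ℝ → M), IsSolutionCurve Y J τ x →
        J ⊆ IY x ∧ Set.EqOn τ (G x) J)
    (hXF : ∀ x₀ : M, ∃ C > (0 : ℝ), ∃ r > (0 : ℝ), ∃ δ > (0 : ℝ),
      ∀ x ∈ Metric.ball x₀ r, ∀ t : ℝ, |t| < δ → t ∈ IX x →
        dist (X x t) (F x t) ≤ C * t ^ 2)
    (hYG : ∀ x₀ : M, ∃ C > (0 : ℝ), ∃ r > (0 : ℝ), ∃ δ > (0 : ℝ),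
      ∀ x ∈ Metric.ball x₀ r, ∀ t : ℝ, |t| < δ → t ∈ IY x →
        dist (Y x t) (G x t) ≤ C * t ^ 2)
    (a b : M → ℝ) (ha : ∃ K, LipschitzWith K a) (hb : ∃ K, LipschitzWith K b)
    (hbr : LocUnifTangent (bracket X Y) (sumArc (smulArc a X) (smulArc b Y))) :
    ∀ x₀ : M, ∃ S : Set M, x₀ ∈ S ∧ IsIntegralSurface X Y S := by
  intro x₀
  obtain ⟨r, K, hP⟩ := exists_pairBox hM hX hY hclose hXE1 hXE2 hYE1 hYE2 hF hG hXF hYG ha hb hbr x₀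
  obtain ⟨ρ₀, hρ₀, hsize⟩ := exists_isSmallSize hP.fst.r_pos hP.fst.K_pos
  obtain ⟨ρ₁, hρ₁, c, hc, hlow⟩ := hP.exists_le_dist_sheet htrans
  have hm : 0 < min ρ₀ ρ₁ := lt_min hρ₀ hρ₁
  obtain ⟨ρ, hρ, hρm⟩ := exists_between hm
  obtain ⟨h1, h2⟩ := lt_min_iff.1 hρm
  have hsmall := hsize ρ hρ h1
  refine ⟨_, ?_, hP.nonempty_chartedSpace_sheet hsmall hc (hlow ρ hsmall h2),
    fun a' b' ha' hb' => hP.setTangentTo_sheet hsmall hc (hlow ρ hsmall h2) ha' hb'⟩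
  refine ⟨(0, 0), by simp [hρ], ?_⟩
  simp [sheet, hP.fst.flow_zero, hP.snd.flow_zero]
end

section
/- (Metric space Nagumo–Brezis invariance theorem.) Let X be an arc field satisfying Conditions E1 and E2 on a locally complete metric space M with local flow F, and let S ⊆ M be a closed set that is locally uniformly tangent to X. Then S is invariant under the flow: for every x ∈ S, F_t(x) ∈ S for all t in the domain (α_x,β_x) of the maximal solution curve through x. -/
open Metric Set Asymptotics

variable {M : Type*} [MetricSpace M]

/-- One step of an arc field tangent to `S` increases the distance to `S` at most by the factor of
Condition E1, up to an error of lower order than the time step. -/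
theorem SetTangentTo.infDist_le {M : Type*} [MetricSpace M] {X : M → ℝ → M} {S : Set M}
    (hE1 : CondE1 X) (hS : SetTangentTo S X) {x₀ : M} (hx₀ : x₀ ∈ S) :
    ∃ r > (0 : ℝ), ∃ Λ > (0 : ℝ), ∀ ε > (0 : ℝ), ∃ δ > (0 : ℝ), ∀ y ∈ ball x₀ r, ∀ h : ℝ,
      0 < |h| → |h| < δ → infDist (X y h) S ≤ infDist y S * (1 + |h| * Λ) + ε * |h| := by
  obtain ⟨r₁, hr₁, δ₁, hδ₁, Λ, hΛ, hE⟩ := hE1 x₀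
  obtain ⟨r₂, hr₂, hT⟩ := hS x₀ hx₀
  refine ⟨min r₁ r₂ / 2, by positivity, Λ, hΛ, fun ε hε => ?_⟩
  obtain ⟨δ₂, hδ₂, hT⟩ := hT ε hε
  refine ⟨min δ₁ δ₂, by positivity, fun y hy h hh0 hh => ?_⟩
  rw [mem_ball] at hy
  have h₁ := min_le_left r₁ r₂
  have h₂ := min_le_right r₁ r₂
  have hφ : infDist y S < min r₁ r₂ / 2 := (infDist_le_dist_of_mem hx₀).trans_lt hy
  have step : ∀ d, infDist y S < d → d < min r₁ r₂ / 2 →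
      infDist (X y h) S ≤ d * (1 + |h| * Λ) + ε * |h| := by
    intro d hd hdr
    obtain ⟨z, hzS, hz⟩ := (infDist_lt_iff ⟨x₀, hx₀⟩).1 hd
    have hzx : dist z x₀ < min r₁ r₂ := by
      linarith [dist_triangle_left z x₀ y]
    have hEz := hE y (mem_ball.2 (by linarith [dist_nonneg (x := y) (y := x₀)])) z
      (mem_ball.2 (by linarith)) h (hh.trans_le (min_le_left _ _))
    have hTz := hT z ⟨hzS, mem_ball.2 (by linarith)⟩ h hh0 (hh.trans_le (min_le_right _ _))
    calc infDist (X y h) S ≤ infDist (X z h) S + dist (X y h) (X z h) :=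
          infDist_le_infDist_add_dist
      _ ≤ ε * |h| + d * (1 + |h| * Λ) := by
          refine add_le_add hTz (hEz.trans ?_)
          gcongr
      _ = _ := by ring
  have hcont : Filter.Tendsto (fun d => d * (1 + |h| * Λ) + ε * |h|)
      (nhdsWithin (infDist y S) (Ioi (infDist y S)))
      (nhds (infDist y S * (1 + |h| * Λ) + ε * |h|)) :=
    (Continuous.tendsto (by fun_prop) _).mono_left nhdsWithin_le_nhds
  refine ge_of_tendsto hcont ?_
  filter_upwards [Ioo_mem_nhdsGT hφ] with d hd using step d hd.1 hd.2

/-- A solution curve of `X`, run forwards (`c = 1`) or backwards (`c = -1`), which starts in a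
closed set tangent to `X` and stays where distances to that set are controlled by the step
estimate, stays in the set. -/
theorem mem_of_infDist_step_le {M : Type*} [MetricSpace M] {X : M → ℝ → M} {S : Set M}
    (hScl : IsClosed S) {U : Set M} {Λ : ℝ}
    (hstep : ∀ ε > (0 : ℝ), ∃ δ > (0 : ℝ), ∀ y ∈ U, ∀ h : ℝ,
      0 < |h| → |h| < δ → infDist (X y h) S ≤ infDist y S * (1 + |h| * Λ) + ε * |h|)
    {τ : ℝ → M} {b c : ℝ} (hc : |c| = 1) (hτ : ContinuousOn τ (Icc 0 b))
    (hτU : ∀ t ∈ Icc 0 b, τ t ∈ U) (hτ0 : τ 0 ∈ S)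
    (htan : ∀ t ∈ Icc 0 b,
      (fun h : ℝ => dist (τ (t + h)) (X (τ t) (c * h))) =o[nhds (0 : ℝ)] fun h => h) :
    ∀ t ∈ Icc 0 b, τ t ∈ S := by
  have key := le_gronwallBound_of_liminf_deriv_right_le (f := fun t => infDist (τ t) S)
    (f' := fun t => Λ * infDist (τ t) S) (δ := 0) (K := Λ) (ε := 0) (a := 0) (b := b)
    ((continuous_infDist_pt S).comp_continuousOn hτ) ?_ (infDist_zero_of_mem hτ0).le
    (fun t _ => by simp)
  · intro t ht
    have h := key t ht
    rw [gronwallBound_ε0_δ0] at h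
    exact (hScl.mem_iff_infDist_zero ⟨_, hτ0⟩).2 (le_antisymm h infDist_nonneg)
  · intro t ht ρ hρ
    have ht' := Ico_subset_Icc_self ht
    set ε := (ρ - Λ * infDist (τ t) S) / 3 with hε
    have hε0 : 0 < ε := by rw [hε]; linarith
    obtain ⟨δ, hδ, hstep⟩ := hstep ε hε0
    have hto : Filter.Tendsto (fun z : ℝ => z - t) (nhdsWithin t (Ioi t)) (nhds 0) := by
      have : Filter.Tendsto (fun z : ℝ => z - t) (nhds t) (nhds (t - t)) :=
        Continuous.tendsto (by fun_prop) t
      rw [sub_self] at this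
      exact this.mono_left nhdsWithin_le_nhds
    refine Filter.Eventually.frequently ?_
    filter_upwards [hto.eventually ((htan t ht').def hε0), self_mem_nhdsWithin,
      hto.eventually (Metric.ball_mem_nhds 0 hδ)] with z hz₁ hz₂ hz₃
    have hpos : 0 < z - t := sub_pos.2 hz₂
    have habs : |c * (z - t)| = z - t := by rw [abs_mul, hc, one_mul, abs_of_pos hpos]
    rw [dist_zero_right, Real.norm_eq_abs, abs_of_pos hpos] at hz₃
    rw [add_sub_cancel, Real.norm_of_nonneg dist_nonneg, Real.norm_eq_abs, abs_of_pos hpos] at hz₁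
    have hs := hstep (τ t) (hτU t ht') (c * (z - t)) (by rwa [habs]) (by rwa [habs])
    rw [habs] at hs
    have htri : infDist (τ z) S ≤ infDist (X (τ t) (c * (z - t))) S
        + dist (τ z) (X (τ t) (c * (z - t))) := infDist_le_infDist_add_dist
    rw [inv_mul_lt_iff₀ hpos]
    have : ρ = Λ * infDist (τ t) S + 3 * ε := by rw [hε]; ring
    rw [this]
    nlinarith [mul_pos hpos hε0]

/-- A solution curve which meets a closed set tangent to `X` stays in it for nearby times. -/
theorem IsSolutionCurve.eventually_mem {M : Type*} [MetricSpace M] {X : M → ℝ → M} {S : Set M}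
    (hE1 : CondE1 X) (hScl : IsClosed S) (hS : SetTangentTo S X) {I : Set ℝ} {σ : ℝ → M} {x : M}
    (hσ : IsSolutionCurve X I σ x) {t₀ : ℝ} (ht₀ : t₀ ∈ I) (hmem : σ t₀ ∈ S) :
    ∀ᶠ t in nhds t₀, σ t ∈ S := by
  obtain ⟨r, hr, Λ, -, hstep⟩ := hS.infDist_le hE1 hmem
  have hI := hσ.isOpen.mem_nhds ht₀
  have hev : ∀ᶠ t in nhds t₀, t ∈ I ∧ σ t ∈ ball (σ t₀) r :=
    Filter.Eventually.and hI ((hσ.cont.continuousAt hI).eventually (ball_mem_nhds _ hr))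
  obtain ⟨b, hb, hev⟩ := Metric.eventually_nhds_iff.1 hev
  have main : ∀ c : ℝ, |c| = 1 → ∀ u, 0 ≤ u → u < b → σ (t₀ + c * u) ∈ S := by
    intro c hc u hu hub
    have hdom : ∀ t ∈ Icc 0 u, t₀ + c * t ∈ I ∧ σ (t₀ + c * t) ∈ ball (σ t₀) r := by
      intro t ht
      apply hev
      rw [Real.dist_eq, add_sub_cancel_left, abs_mul, hc, one_mul, abs_of_nonneg ht.1]
      exact ht.2.trans_lt hub
    refine mem_of_infDist_step_le (τ := fun t => σ (t₀ + c * t)) hScl hstep hc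
      (hσ.cont.comp (by fun_prop) fun t ht => (hdom t ht).1) (fun t ht => (hdom t ht).2)
      (by simpa using hmem) (fun t ht => ?_) u ⟨hu, le_rfl⟩
    have hto : Filter.Tendsto (fun h : ℝ => c * h) (nhds 0) (nhds 0) := by
      simpa using (continuous_const_mul c).tendsto 0
    have ho := (hσ.tangent _ (hdom t ht).1).comp_tendsto hto
    have hO : ((fun h => h) ∘ fun h : ℝ => c * h) =O[nhds 0] fun h : ℝ => h :=
      isBigO_const_mul_self c _ _
    simpa only [Function.comp_def, mul_add, add_assoc] using ho.trans_isBigO hO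
  refine Metric.eventually_nhds_iff.2 ⟨b, hb, fun t ht => ?_⟩
  rw [Real.dist_eq] at ht
  rcases le_total t₀ t with h | h
  · rw [abs_of_nonneg (sub_nonneg.2 h)] at ht
    simpa using main 1 (by simp) (t - t₀) (sub_nonneg.2 h) ht
  · rw [abs_of_nonpos (sub_nonpos.2 h)] at ht
    simpa using main (-1) (by simp) (t₀ - t) (sub_nonneg.2 h) (by linarith)

/-- Metric space Nagumo–Brezis invariance theorem: a closed set
locally uniformly tangent to an arc field satisfying E1 and E2 on a locally
complete metric space is invariant under the flow. -/
theorem nagumo_brezis_invariance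
    {M : Type*} [MetricSpace M] (hM : LocallyComplete M)
    (X : M → ℝ → M) (hX : IsArcField X) (hE1 : CondE1 X) (hE2 : CondE2 X)
    (I : M → Set ℝ) (F : M → ℝ → M)
    (hF : ∀ x : M, IsSolutionCurve X (I x) (F x) x ∧
      ∀ (J : Set ℝ) (τ : ℝ → M), IsSolutionCurve X J τ x →
        J ⊆ I x ∧ Set.EqOn τ (F x) J)
    (S : Set M) (hScl : IsClosed S) (hStan : SetTangentTo S X) :
    ∀ x ∈ S, ∀ t ∈ I x, F x t ∈ S := by
  intro x hx
  obtain ⟨hσ, -⟩ := hF x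
  have hopen : IsOpen (I x ∩ F x ⁻¹' S) := isOpen_iff_mem_nhds.2 fun t ht =>
    Filter.inter_mem (hσ.isOpen.mem_nhds ht.1) (hσ.eventually_mem hE1 hScl hStan ht.1 ht.2)
  have hsub := hσ.ordConnected.isPreconnected.subset_of_closure_inter_subset hopen
    ⟨0, hσ.zero_mem, hσ.zero_mem, by simpa [hσ.init] using hx⟩ fun t ht =>
      ⟨ht.2, hScl.mem_of_frequently_of_tendsto
        ((mem_closure_iff_frequently.1 ht.1).mono fun _ h => h.2)
        (hσ.cont.continuousAt (hσ.isOpen.mem_nhds ht.2))⟩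
  exact fun t ht => (hsub ht).2
end
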